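/- arXiv:2404.14628 — 2 statements merged into one kernel-verified Lean document; each statement's English description precedes it below -/
import Mathlib

section
/- Fix ε ∈ (0,1) and C ≥ 1. Let ψ: ℕ → ℝ_{≥0} be a function, let Q ≥ 1 and y, t, s ≥ 1. Then ∑∑_{(q,r)∈[1,Q]², D(q,r) ≤ y, L_t(q,r) ≥ 1/s} (ψ(q)φ(q)/q)·(ψ(r)φ(r)/r) ≪_{ε,C} e^{−Ct/s}·y^{1−ε}·Ψ(Q)^{1+ε}, uniformly in ψ, Q, y, t, s, where the implied constant depends only on ε and C. -/
/-- `Ψ(Q) = 2 ∑_{q ≤ Q} φ(q) ψ(q) / q`. -/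
noncomputable def Psi (ψ : ℕ → ℝ) (Q : ℕ) : ℝ :=
  2 * ∑ q ∈ Finset.Icc 1 Q, (Nat.totient q : ℝ) * ψ q / q

/-- `D(q,r) = max(r ψ(q), q ψ(r)) / gcd(q,r)`. -/
noncomputable def Dfun (ψ : ℕ → ℝ) (q r : ℕ) : ℝ :=
  max ((r : ℝ) * ψ q) ((q : ℝ) * ψ r) / (Nat.gcd q r : ℝ)

/-- `L_t(q,r) = ∑_{p | qr/gcd(q,r)², p > t} 1/p`. -/
noncomputable def Lfun (t : ℝ) (q r : ℕ) : ℝ :=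
  ∑ p ∈ (q * r / Nat.gcd q r ^ 2).primeFactors.filter (fun p : ℕ => t < (p : ℝ)), (1 : ℝ) / p

/-- `ω_t(q,r) = #{p prime : p | qr/gcd(q,r)², p ≤ t}`. -/
noncomputable def omegaFun (t : ℝ) (q r : ℕ) : ℕ :=
  ((q * r / Nat.gcd q r ^ 2).primeFactors.filter (fun p : ℕ => (p : ℝ) ≤ t)).card


open Finset in
lemma kern_bound {ι : Type*} (I J : Finset ι) (κ : ι → ι → ℝ) (x y : ι → ℝ) (β S : ℝ)
    (hβ : 1/2 ≤ β) (hS : 0 ≤ S) (hκ : ∀ i j, 0 ≤ κ i j) (hx : ∀ i, 0 ≤ x i) (hy : ∀ i, 0 ≤ y i)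
    (hrow : ∀ i ∈ I, ∑ j ∈ J, κ i j ≤ S) (hcol : ∀ j ∈ J, ∑ i ∈ I, κ i j ≤ S) :
    ∑ i ∈ I, ∑ j ∈ J, κ i j * (x i * y j) ^ β ≤ S * ((∑ i ∈ I, x i) * (∑ j ∈ J, y j)) ^ β := by
  set X := ∑ i ∈ I, x i with hX
  set Y := ∑ j ∈ J, y j with hY
  have hX0 : 0 ≤ X := sum_nonneg fun i _ => hx i
  have hY0 : 0 ≤ Y := sum_nonneg fun i _ => hy i
  have hb0 : β ≠ 0 := by linarith
  have key : ∀ i ∈ I, ∀ j ∈ J, κ i j * (x i * y j) ^ β ≤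
      κ i j * ((x i / X + y j / Y) / 2) * (X * Y) ^ β := by
    intro i hi j hj
    have hxi : x i ≤ X := single_le_sum (f := x) (fun i _ => hx i) hi
    have hyj : y j ≤ Y := single_le_sum (f := y) (fun i _ => hy i) hj
    rw [mul_assoc]
    refine mul_le_mul_of_nonneg_left ?_ (hκ i j)
    rcases hX0.eq_or_lt with h | h
    · have : x i = 0 := le_antisymm (by rw [h]; exact hxi) (hx i)
      simp [this, hb0, ← h]
    rcases hY0.eq_or_lt with h' | h'
    · have : y j = 0 := le_antisymm (by rw [h']; exact hyj) (hy j)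
      simp [this, hb0, ← h']
    set u := x i / X with hu
    set v := y j / Y with hv
    have e : x i * y j = (u * v) * (X * Y) := by rw [hu, hv]; field_simp
    have hu0 : 0 ≤ u := div_nonneg (hx i) hX0
    have hv0 : 0 ≤ v := div_nonneg (hy j) hY0
    have hu1 : u ≤ 1 := (div_le_one h).2 hxi
    have hv1 : v ≤ 1 := (div_le_one h').2 hyj
    rw [e, Real.mul_rpow (by positivity) (by positivity)]
    refine mul_le_mul_of_nonneg_right ?_ (by positivity)
    calc (u * v) ^ β ≤ (u * v) ^ ((1:ℝ)/2) := by
          rcases (mul_nonneg hu0 hv0).eq_or_lt with h | h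
          · rw [← h]; simp [hb0]
          · exact Real.rpow_le_rpow_of_exponent_ge h (by nlinarith) hβ
      _ = Real.sqrt (u * v) := by rw [Real.sqrt_eq_rpow]
      _ ≤ (u + v) / 2 := by
          apply Real.sqrt_le_iff.2
          constructor
          · positivity
          · nlinarith [sq_nonneg (u - v)]
  calc _ ≤ ∑ i ∈ I, ∑ j ∈ J, κ i j * ((x i / X + y j / Y) / 2) * (X * Y) ^ β :=
        sum_le_sum fun i hi => sum_le_sum fun j hj => key i hi j hj
    _ = (∑ i ∈ I, ∑ j ∈ J, κ i j * ((x i / X + y j / Y) / 2)) * (X * Y) ^ β := by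
        simp_rw [sum_mul]
    _ ≤ S * (X * Y) ^ β := by
        refine mul_le_mul_of_nonneg_right ?_ (by positivity)
        have e1 : ∑ i ∈ I, ∑ j ∈ J, κ i j * ((x i / X + y j / Y) / 2) =
          (∑ i ∈ I, (x i / X) * ∑ j ∈ J, κ i j) / 2 + (∑ j ∈ J, (y j / Y) * ∑ i ∈ I, κ i j) / 2 := by
          simp_rw [mul_sum]
          rw [sum_comm (s := J), ← add_div, ← sum_add_distrib, sum_div]
          refine sum_congr rfl fun i _ => ?_
          rw [← sum_add_distrib, sum_div]
          refine sum_congr rfl fun j _ => ?_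
          ring
        have e2 : ∑ i ∈ I, (x i / X) * ∑ j ∈ J, κ i j ≤ S := by
          calc _ ≤ ∑ i ∈ I, (x i / X) * S := sum_le_sum fun i hi =>
                mul_le_mul_of_nonneg_left (hrow i hi) (div_nonneg (hx i) hX0)
            _ = (X / X) * S := by rw [← sum_mul, ← sum_div]
            _ ≤ S := by nlinarith [div_self_le_one X]
        have e3 : ∑ i ∈ J, (y i / Y) * ∑ j ∈ I, κ j i ≤ S := by
          calc _ ≤ ∑ i ∈ J, (y i / Y) * S := sum_le_sum fun i hi =>
                mul_le_mul_of_nonneg_left (hcol i hi) (div_nonneg (hy i) hY0)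
            _ = (Y / Y) * S := by rw [← sum_mul, ← sum_div]
            _ ≤ S := by nlinarith [div_self_le_one Y]
        rw [e1]; linarith

lemma geo_le (r : ℝ) (h0 : 0 ≤ r) (h1 : r < 1) (n : ℕ) :
    ∑ i ∈ Finset.range n, r ^ (i + 1) ≤ r / (1 - r) := by
  have : ∑ i ∈ Finset.range n, r ^ (i + 1) = r * ∑ i ∈ Finset.range n, r ^ i := by
    rw [Finset.mul_sum]; exact Finset.sum_congr rfl fun i _ => by ring
  rw [this, div_eq_mul_inv]
  refine mul_le_mul_of_nonneg_left ?_ h0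
  rw [← tsum_geometric_of_lt_one h0 h1]
  exact (summable_geometric_of_lt_one h0 h1).sum_le_tsum _ (fun i _ => by positivity)

open Finset in
lemma row_le (r : ℝ) (h0 : 0 ≤ r) (h1 : r < 1) (I : Finset ℕ) (i : ℕ) :
    ∑ j ∈ I, (if i = j then 0 else r ^ ((i - j) + (j - i))) ≤ 2 * (r / (1 - r)) := by
  obtain ⟨n, hn⟩ : ∃ n, I ⊆ range n := ⟨I.sup id + 1, fun j hj => by
    simp only [mem_range]; exact Nat.lt_succ_of_le (Finset.le_sup (f := id) hj)⟩
  calc _ ≤ ∑ j ∈ range (i + 1 + n), (if i = j then 0 else r ^ ((i - j) + (j - i))) := by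
        apply sum_le_sum_of_subset_of_nonneg
        · exact hn.trans (range_mono (by omega))
        · intros; split_ifs <;> positivity
    _ ≤ 2 * (r / (1 - r)) := by
        rw [sum_range_add, sum_range_succ]
        have a1 : ∑ j ∈ range i, (if i = j then 0 else r ^ ((i - j) + (j - i))) ≤ r / (1 - r) := by
          rw [← sum_range_reflect]
          refine le_trans (le_of_eq ?_) (geo_le r h0 h1 i)
          refine sum_congr rfl fun j hj => ?_
          rw [mem_range] at hj
          rw [if_neg (by omega)]; congr 1; omega
        have a2 : ∑ j ∈ range n, (if i = i + 1 + j then 0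
            else r ^ ((i - (i + 1 + j)) + (i + 1 + j - i))) ≤ r / (1 - r) := by
          refine le_trans (le_of_eq ?_) (geo_le r h0 h1 n)
          refine sum_congr rfl fun j hj => ?_
          rw [if_neg (by omega)]; congr 1; omega
        simp only [if_true]
        linarith

/-- kernel -/
noncomputable def kap (Ω r : ℝ) (i j : ℕ) : ℝ := if i = j then 1 else Ω * r ^ ((i - j) + (j - i))

lemma kap_nonneg {Ω r : ℝ} (hΩ : 0 ≤ Ω) (hr : 0 ≤ r) (i j : ℕ) : 0 ≤ kap Ω r i j := by
  unfold kap; split_ifs <;> positivity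

lemma kap_symm (Ω r : ℝ) (i j : ℕ) : kap Ω r i j = kap Ω r j i := by
  unfold kap
  rw [add_comm (i - j)]
  simp [eq_comm]

open Finset in
lemma kap_row_off {Ω r : ℝ} (hΩ : 0 ≤ Ω) (h0 : 0 ≤ r) (h1 : r < 1) (I : Finset ℕ) (i : ℕ)
    (hi : i ∉ I) : ∑ j ∈ I, kap Ω r i j ≤ Ω * (2 * (r / (1 - r))) := by
  refine le_trans (le_of_eq ?_) (mul_le_mul_of_nonneg_left (row_le r h0 h1 I i) hΩ)
  rw [mul_sum]
  refine sum_congr rfl fun j hj => ?_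
  have : i ≠ j := fun h => hi (h ▸ hj)
  simp [kap, this]

open Finset in
lemma kap_row {Ω r : ℝ} (hΩ : 0 ≤ Ω) (h0 : 0 ≤ r) (h1 : r < 1) (I : Finset ℕ) (i : ℕ) :
    ∑ j ∈ I, kap Ω r i j ≤ 1 + Ω * (2 * (r / (1 - r))) := by
  by_cases hi : i ∈ I
  · rw [← add_sum_erase _ _ hi]
    have := kap_row_off hΩ h0 h1 (I.erase i) i (by simp)
    have e : kap Ω r i i = 1 := by simp [kap]
    rw [e]; linarith
  · have := kap_row_off hΩ h0 h1 I i hi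
    linarith

open Finset in
lemma kap_all {Ω r β : ℝ} (hβ : 1/2 ≤ β) (hΩ : 0 ≤ Ω) (h0 : 0 ≤ r) (h1 : r < 1) (I J : Finset ℕ)
    (x y : ℕ → ℝ) (hx : ∀ i, 0 ≤ x i) (hy : ∀ i, 0 ≤ y i) :
    ∑ i ∈ I, ∑ j ∈ J, kap Ω r i j * (x i * y j) ^ β ≤
      (1 + Ω * (2 * (r / (1 - r)))) * ((∑ i ∈ I, x i) * (∑ j ∈ J, y j)) ^ β := by
  have : 0 ≤ r / (1 - r) := div_nonneg h0 (by linarith)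
  apply kern_bound I J _ x y β _ hβ (by positivity) (kap_nonneg hΩ h0) hx hy
  · intro i _; exact kap_row hΩ h0 h1 J i
  · intro i _; simp_rw [kap_symm _ _ _ i]; exact kap_row hΩ h0 h1 I i

set_option maxHeartbeats 1600000 in
open Finset in
lemma conc_exists (β Ω : ℝ) (hβ : 1/2 < β) (hβ1 : β < 1) (hΩ : 1 ≤ Ω) :
    ∃ r0 A0 : ℝ, 0 < r0 ∧ 0 < A0 ∧ ∀ r, 0 < r → r ≤ r0 → ∀ (I : Finset ℕ) (x y : ℕ → ℝ),
      (∀ i, 0 ≤ x i) → (∀ i, 0 ≤ y i) → ∑ i ∈ I, x i = 1 → ∑ i ∈ I, y i = 1 →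
      1 < ∑ i ∈ I, ∑ j ∈ I, kap Ω r i j * (x i * y j) ^ β →
      ∃ k ∈ I, 1 - x k ≤ A0 * r ^ (1 / (1 - β)) ∧ 1 - y k ≤ A0 * r ^ (1 / (1 - β)) := by
  obtain ⟨σ0, hσ0, hσ1, hσ2⟩ : ∃ σ0 : ℝ, 0 < σ0 ∧ σ0 < 1 ∧ 2 * σ0 ^ (2 * β - 1) ≤ β / 2 := by
    have hc : 0 < 2 * β - 1 := by linarith
    refine ⟨(β / 4) ^ (1 / (2 * β - 1)), by positivity, ?_, ?_⟩
    · exact Real.rpow_lt_one (by positivity) (by linarith) (by positivity)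
    · rw [← Real.rpow_mul (by positivity), one_div_mul_cancel hc.ne', Real.rpow_one]; linarith
  set s0 := 1 - (1 - σ0) ^ (β - 1/2) with hs0
  have hs0p : 0 < s0 := by
    have := Real.rpow_lt_one (x := 1 - σ0) (by linarith) (by linarith) (z := β - 1/2) (by linarith)
    linarith
  have hs01 : s0 ≤ 1 := by
    have := Real.rpow_nonneg (x := 1 - σ0) (by linarith) (β - 1/2)
    linarith
  refine ⟨min (1/2) (s0 / (4 * Ω)), (16 * Ω / β) ^ (1 / (1 - β)), by positivity, by positivity, ?_⟩
  intro r hr hr0 I x y hx hy hxs hys hlt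
  have hr2 : r ≤ 1/2 := hr0.trans (min_le_left _ _)
  have hr3 : r ≤ s0 / (4 * Ω) := hr0.trans (min_le_right _ _)
  have hr1 : r < 1 := by linarith
  set s := Ω * (2 * (r / (1 - r))) with hs
  have hsr : s ≤ 4 * Ω * r := by
    have : r / (1 - r) ≤ 2 * r := by
      rw [div_le_iff₀ (by linarith)]; nlinarith
    rw [hs]; nlinarith
  have hss : s ≤ s0 := by
    rw [le_div_iff₀ (by positivity)] at hr3; linarith
  have hsn : 0 ≤ s := by
    have : 0 ≤ r / (1 - r) := div_nonneg hr.le (by linarith)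
    positivity
  have hΩ0 : 0 ≤ Ω := by linarith
  have hIne : I.Nonempty := by
    rw [nonempty_iff_ne_empty]; rintro rfl; simp at hxs
  have hx1 : ∀ i ∈ I, x i ≤ 1 := fun i hi => hxs ▸ single_le_sum (fun i _ => hx i) hi
  have hy1 : ∀ i ∈ I, y i ≤ 1 := fun i hi => hys ▸ single_le_sum (fun i _ => hy i) hi
  obtain ⟨k, hk, hmax⟩ := exists_max_image I (fun i => x i * y i) hIne
  -- step 1
  have step1 : 1 - s0 < (x k * y k) ^ (β - 1/2) := by
    have hoff : ∑ i ∈ I, ∑ j ∈ I, (if i = j then 0 else kap Ω r i j) * (x i * y j) ^ β ≤ s := by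
      have h := kern_bound I I (fun i j => if i = j then 0 else kap Ω r i j) x y β s hβ.le hsn
        (fun i j => by
          split_ifs
          · exact le_rfl
          · exact kap_nonneg hΩ0 hr.le i j) hx hy ?_ ?_
      · rw [hxs, hys] at h; simpa using h
      · intro i _
        refine le_trans (le_of_eq ?_) (mul_le_mul_of_nonneg_left (row_le r hr.le hr1 I i) hΩ0)
        rw [mul_sum]
        refine sum_congr rfl fun j _ => ?_
        by_cases h : i = j <;> simp [kap, h]
      · intro i _
        refine le_trans (le_of_eq ?_) (mul_le_mul_of_nonneg_left (row_le r hr.le hr1 I i) hΩ0)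
        rw [mul_sum]
        refine sum_congr rfl fun j _ => ?_
        by_cases h : i = j
        · simp [h]
        · have h' : j ≠ i := fun e => h e.symm
          simp [kap, h, h', add_comm]
    have hdiag : ∑ i ∈ I, (x i * y i) ^ β ≤ (x k * y k) ^ (β - 1/2) := by
      have hsq : ∑ i ∈ I, Real.sqrt (x i * y i) ≤ 1 := by
        calc _ ≤ ∑ i ∈ I, (x i + y i) / 2 := by
              refine sum_le_sum fun i _ => Real.sqrt_le_iff.2 ⟨?_, ?_⟩
              · have := hx i; have := hy i; positivity
              · nlinarith [sq_nonneg (x i - y i)]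
          _ = 1 := by rw [← sum_div, sum_add_distrib, hxs, hys]; norm_num
      calc _ ≤ ∑ i ∈ I, Real.sqrt (x i * y i) * (x k * y k) ^ (β - 1/2) := by
            refine sum_le_sum fun i hi => ?_
            have h0 : 0 ≤ x i * y i := mul_nonneg (hx i) (hy i)
            have : (x i * y i) ^ β = Real.sqrt (x i * y i) * (x i * y i) ^ (β - 1/2) := by
              rw [Real.sqrt_eq_rpow, ← Real.rpow_add_of_nonneg h0 (by norm_num) (by linarith)]
              congr 1; ring
            rw [this]
            exact mul_le_mul_of_nonneg_left (Real.rpow_le_rpow h0 (hmax i hi) (by linarith))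
              (Real.sqrt_nonneg _)
        _ = (∑ i ∈ I, Real.sqrt (x i * y i)) * (x k * y k) ^ (β - 1/2) := by rw [sum_mul]
        _ ≤ _ := by
            have := Real.rpow_nonneg (mul_nonneg (hx k) (hy k)) (β - 1/2)
            nlinarith
    have hsplit : ∑ i ∈ I, ∑ j ∈ I, kap Ω r i j * (x i * y j) ^ β =
        ∑ i ∈ I, (x i * y i) ^ β +
        ∑ i ∈ I, ∑ j ∈ I, (if i = j then 0 else kap Ω r i j) * (x i * y j) ^ β := by
      rw [← sum_add_distrib]
      refine sum_congr rfl fun i hi => ?_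
      have : (x i * y i) ^ β = ∑ j ∈ I, if i = j then (x i * y j) ^ β else 0 := by
        rw [sum_ite_eq]; simp [hi]
      rw [this, ← sum_add_distrib]
      refine sum_congr rfl fun j hj => ?_
      by_cases h : i = j <;> simp [h, kap]
    linarith
  have hxy : 1 - σ0 ≤ x k * y k := by
    by_contra h
    push Not at h
    have := Real.rpow_le_rpow (mul_nonneg (hx k) (hy k)) h.le (z := β - 1/2) (by linarith)
    linarith
  set σ := max (1 - x k) (1 - y k) with hσ
  have hxk := hx1 k hk
  have hyk := hy1 k hk
  have hxk0 := hx k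
  have hyk0 := hy k
  have hσn : 0 ≤ σ := le_trans (by linarith) (le_max_left _ _)
  have hσσ0 : σ ≤ σ0 := max_le (by nlinarith) (by nlinarith)
  have hd1 : 1 - x k ≤ σ := le_max_left _ _
  have hd2 : 1 - y k ≤ σ := le_max_right _ _
  have hsum_x : ∑ i ∈ I.erase k, x i = 1 - x k := by rw [← hxs, ← add_sum_erase _ _ hk]; ring
  have hsum_y : ∑ i ∈ I.erase k, y i = 1 - y k := by rw [← hys, ← add_sum_erase _ _ hk]; ring
  have hb0 : 0 ≤ β := by linarith
  have step2 : β * σ ≤ 2 * s * σ ^ β + (1 + s) * σ ^ (2 * β) := by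
    have h4 : ∑ i ∈ I, ∑ j ∈ I, kap Ω r i j * (x i * y j) ^ β =
        (x k * y k) ^ β + ∑ j ∈ I.erase k, kap Ω r k j * (x k * y j) ^ β +
        (∑ i ∈ I.erase k, kap Ω r i k * (x i * y k) ^ β +
        ∑ i ∈ I.erase k, ∑ j ∈ I.erase k, kap Ω r i j * (x i * y j) ^ β) := by
      rw [← add_sum_erase _ _ hk, ← add_sum_erase _ _ hk, ← sum_add_distrib]
      congr 1
      · simp [kap]
      · exact sum_congr rfl fun i _ => by rw [← add_sum_erase _ _ hk]
    have b1 : (x k * y k) ^ β ≤ 1 - β * σ := by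
      have : x k * y k ≤ 1 + (-σ) := by
        rcases max_choice (1 - x k) (1 - y k) with h | h <;> rw [← hσ] at h <;> nlinarith
      refine (Real.rpow_le_rpow (mul_nonneg hxk0 hyk0) this hb0).trans ?_
      have := rpow_one_add_le_one_add_mul_self (s := -σ) (by linarith) hb0 hβ1.le
      linarith
    have b2 : ∑ j ∈ I.erase k, kap Ω r k j * (x k * y j) ^ β ≤ s * σ ^ β := by
      have h := kern_bound {k} (I.erase k) (kap Ω r) x y β s hβ.le hsn (kap_nonneg hΩ0 hr.le) hx hy
        (fun i hi => by
          rw [mem_singleton] at hi; subst hi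
          exact kap_row_off hΩ0 hr.le hr1 _ _ (by simp))
        (fun j hj => by
          simp_rw [kap_symm _ _ _ j]
          exact kap_row_off hΩ0 hr.le hr1 _ _ (by simpa using (mem_erase.1 hj).1))
      rw [sum_singleton, sum_singleton, hsum_y] at h
      refine h.trans (mul_le_mul_of_nonneg_left (Real.rpow_le_rpow ?_ ?_ hb0) hsn)
      · nlinarith
      · nlinarith
    have b3 : ∑ i ∈ I.erase k, kap Ω r i k * (x i * y k) ^ β ≤ s * σ ^ β := by
      have h := kern_bound (I.erase k) {k} (kap Ω r) x y β s hβ.le hsn (kap_nonneg hΩ0 hr.le) hx hy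
        (fun j hj => by
          exact kap_row_off hΩ0 hr.le hr1 _ _ (by simpa using (mem_erase.1 hj).1))
        (fun i hi => by
          rw [mem_singleton] at hi; subst hi
          simp_rw [kap_symm _ _ _ i]
          exact kap_row_off hΩ0 hr.le hr1 _ _ (by simp))
      simp only [sum_singleton, hsum_x] at h
      refine h.trans (mul_le_mul_of_nonneg_left (Real.rpow_le_rpow ?_ ?_ hb0) hsn)
      · nlinarith
      · nlinarith
    have b4 : ∑ i ∈ I.erase k, ∑ j ∈ I.erase k, kap Ω r i j * (x i * y j) ^ β
        ≤ (1 + s) * σ ^ (2 * β) := by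
      have h := kap_all hβ.le hΩ0 hr.le hr1 (I.erase k) (I.erase k) x y hx hy
      rw [hsum_x, hsum_y] at h
      refine h.trans (mul_le_mul_of_nonneg_left ?_ (by linarith))
      rw [Real.rpow_mul hσn]
      refine Real.rpow_le_rpow (mul_nonneg (by linarith) (by linarith)) ?_ hb0
      rw [Real.rpow_two]; nlinarith
    rw [h4] at hlt
    linarith
  have hfin : σ ≤ (16 * Ω / β) ^ (1 / (1 - β)) * r ^ (1 / (1 - β)) := by
    rcases hσn.eq_or_lt with h | h
    · rw [← h]; positivity
    have e1 : σ ^ (2 * β) = σ * σ ^ (2 * β - 1) := by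
      rw [← Real.rpow_one_add' hσn (by linarith)]; congr 1; ring
    have e2 : σ ^ (2 * β - 1) ≤ σ0 ^ (2 * β - 1) := Real.rpow_le_rpow hσn hσσ0 (by linarith)
    have e3 : σ = σ ^ β * σ ^ (1 - β) := by
      rw [← Real.rpow_add h]; simp
    have e4 : β / 2 * σ ≤ 2 * s * σ ^ β := by
      have : (1 + s) * σ ^ (2 * β) ≤ β / 2 * σ := by
        rw [e1]
        have h1 : 0 ≤ σ ^ (2 * β - 1) := Real.rpow_nonneg hσn _
        have : (1 + s) * σ ^ (2 * β - 1) ≤ β / 2 := by nlinarith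
        nlinarith
      linarith
    have e5 : σ ^ (1 - β) ≤ 16 * Ω / β * r := by
      have hp : 0 < σ ^ β := Real.rpow_pos_of_pos h _
      have : β / 2 * σ ^ (1 - β) ≤ 2 * s := by
        refine le_of_mul_le_mul_left ?_ hp
        calc σ ^ β * (β / 2 * σ ^ (1 - β)) = β / 2 * (σ ^ β * σ ^ (1 - β)) := by ring
          _ = β / 2 * σ := by rw [← e3]
          _ ≤ _ := by linarith
      rw [div_mul_eq_mul_div, le_div_iff₀ (by linarith)]
      nlinarith
    rw [← Real.mul_rpow (by positivity) hr.le]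
    calc σ = (σ ^ (1 - β)) ^ (1 / (1 - β)) := by
          rw [← Real.rpow_mul hσn, mul_one_div_cancel (by linarith), Real.rpow_one]
      _ ≤ _ := Real.rpow_le_rpow (by positivity) e5 (by
          apply div_nonneg zero_le_one; linarith)
  exact ⟨k, hk, hd1.trans hfin, hd2.trans hfin⟩


def ptt (P : Finset ℕ) (v : ℕ) : ℕ := ∏ p ∈ P, p ^ (v.factorization p)
def ggg (P : Finset ℕ) (v w : ℕ) : ℕ := ∏ p ∈ P, p ^ (w.factorization p - v.factorization p)
noncomputable def ccc (P : Finset ℕ) (v : ℕ) : ℝ :=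
  ∏ p ∈ P, if v.factorization p = 0 then (1 : ℝ) else 1 - 1 / p
noncomputable def mmm (P : Finset ℕ) (ψ : ℕ → ℝ) (v : ℕ) : ℝ := ψ v * ccc P v
noncomputable def wtt (P : Finset ℕ) (ω : ℕ → ℝ) (v w : ℕ) : ℝ :=
  ∏ p ∈ P, if v.factorization p = w.factorization p then (1 : ℝ) else ω p
open Classical in
noncomputable def FFF (P : Finset ℕ) (ψ θ ω : ℕ → ℝ) (A B : ℝ) (v w : ℕ) : ℝ :=
  if ψ v * (ggg P v w : ℝ) ≤ A ∧ θ w * (ggg P w v : ℝ) ≤ B then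
    mmm P ψ v * mmm P θ w * wtt P ω v w else 0
noncomputable def TTT (P : Finset ℕ) (ψ θ ω : ℕ → ℝ) (V W : Finset ℕ) (A B : ℝ) : ℝ :=
  ∑ v ∈ V, ∑ w ∈ W, FFF P ψ θ ω A B v w
noncomputable def MMM (P : Finset ℕ) (ψ : ℕ → ℝ) (V : Finset ℕ) : ℝ := ∑ v ∈ V, mmm P ψ v

def SSS (β : ℝ) (ψ θ ω : ℕ → ℝ) (P : Finset ℕ) (K : ℝ) : Prop :=
  ∀ (V W : Finset ℕ) (A B : ℝ), 0 < A → 0 < B → Set.InjOn (ptt P) V → Set.InjOn (ptt P) W →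
    TTT P ψ θ ω V W A B ≤ K * (A * B) ^ (1 - β) * (MMM P ψ V * MMM P θ W) ^ β

lemma fac_nonneg {p : ℕ} (hp : p.Prime) (n : ℕ) :
    (0 : ℝ) < (if n = 0 then (1 : ℝ) else 1 - 1 / p) ∧
      (if n = 0 then (1 : ℝ) else 1 - 1 / p) ≤ 1 := by
  have : (2 : ℝ) ≤ p := by exact_mod_cast hp.two_le
  have h2 : 1 / (p : ℝ) ≤ 1 / 2 := one_div_le_one_div_of_le (by norm_num) this
  have h3 : 0 < 1 / (p : ℝ) := by positivity
  split_ifs <;> constructor <;> linarith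

lemma ccc_pos {P : Finset ℕ} (hP : ∀ p ∈ P, p.Prime) (v : ℕ) : 0 < ccc P v :=
  Finset.prod_pos fun p hp => (fac_nonneg (hP p hp) _).1

lemma mmm_nonneg {P : Finset ℕ} (hP : ∀ p ∈ P, p.Prime) {ψ : ℕ → ℝ} (hψ : ∀ v, 0 ≤ ψ v) (v : ℕ) :
    0 ≤ mmm P ψ v := mul_nonneg (hψ v) (ccc_pos hP v).le

lemma wtt_pos {P : Finset ℕ} {ω : ℕ → ℝ} (hω : ∀ p, 1 ≤ ω p) (v w : ℕ) : 0 ≤ wtt P ω v w :=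
  Finset.prod_nonneg fun p _ => by
    have := hω p
    split_ifs <;> linarith

lemma FFF_nonneg {P : Finset ℕ} (hP : ∀ p ∈ P, p.Prime) {ψ θ ω : ℕ → ℝ} (hψ : ∀ v, 0 ≤ ψ v)
    (hθ : ∀ v, 0 ≤ θ v) (hω : ∀ p, 1 ≤ ω p) (A B : ℝ) (v w : ℕ) : 0 ≤ FFF P ψ θ ω A B v w := by
  unfold FFF
  split_ifs
  · exact mul_nonneg (mul_nonneg (mmm_nonneg hP hψ v) (mmm_nonneg hP hθ w)) (wtt_pos hω v w)
  · exact le_rfl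

lemma MMM_nonneg {P : Finset ℕ} (hP : ∀ p ∈ P, p.Prime) {ψ : ℕ → ℝ} (hψ : ∀ v, 0 ≤ ψ v)
    (V : Finset ℕ) : 0 ≤ MMM P ψ V := Finset.sum_nonneg fun v _ => mmm_nonneg hP hψ v

/-- fiber -/
def fib (p i : ℕ) (V : Finset ℕ) : Finset ℕ := V.filter (fun v => v.factorization p = i)

open Finset in
/-- splitting step -/
lemma split_ij {β : ℝ} (hβ : 0 < β) (hβ1 : β < 1) {ψ θ ω : ℕ → ℝ} (hψ : ∀ v, 0 ≤ ψ v)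
    (hθ : ∀ v, 0 ≤ θ v) (hω : ∀ p, 1 ≤ ω p) {P : Finset ℕ} (hP : ∀ p ∈ P, p.Prime) {p : ℕ}
    (hp : p ∈ P) {K : ℝ} (hK : 0 ≤ K) (hS : SSS β ψ θ ω (P.erase p) K) (V W : Finset ℕ) (A B : ℝ)
    (hA : 0 < A) (hB : 0 < B) (hV : Set.InjOn (ptt P) V) (hW : Set.InjOn (ptt P) W) (i j : ℕ) :
    TTT P ψ θ ω (fib p i V) (fib p j W) A B ≤ K * (A * B) ^ (1 - β) *
      (kap (ω p) ((p : ℝ) ^ (-(1 - β))) i j *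
        (MMM P ψ (fib p i V) * MMM P θ (fib p j W)) ^ β) := by
  set P' := P.erase p with hP'
  have hp0 : (0 : ℝ) < p := by exact_mod_cast (hP p hp).pos
  have hP'p : ∀ q ∈ P', q.Prime := fun q hq => hP q (mem_of_mem_erase hq)
  set ci : ℝ := if i = 0 then (1 : ℝ) else 1 - 1 / p with hci
  set cj : ℝ := if j = 0 then (1 : ℝ) else 1 - 1 / p with hcj
  obtain ⟨ci0, ci1⟩ : 0 < ci ∧ ci ≤ 1 := fac_nonneg (hP p hp) i
  obtain ⟨cj0, cj1⟩ : 0 < cj ∧ cj ≤ 1 := fac_nonneg (hP p hp) j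
  set wp : ℝ := if i = j then 1 else ω p with hwp
  have hwp0 : 0 ≤ wp := by have := hω p; rw [hwp]; split_ifs <;> linarith
  have minj : ∀ (U : Finset ℕ) (l : ℕ), Set.InjOn (ptt P) U → Set.InjOn (ptt P') (fib p l U) := by
    intro U l hU v hv w hw h
    simp only [fib, coe_filter, Set.mem_ofPred_eq] at hv hw
    refine hU hv.1 hw.1 ?_
    unfold ptt at h ⊢
    rw [← mul_prod_erase P _ hp, ← mul_prod_erase P _ hp, hv.2, hw.2]
    rw [h]
  have mm1 : ∀ (χ : ℕ → ℝ) (U : Finset ℕ) (l v : ℕ), v ∈ fib p l U →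
      mmm P χ v = (if l = 0 then (1 : ℝ) else 1 - 1 / p) * mmm P' χ v := by
    intro χ U l v hv
    have := (mem_filter.1 hv).2
    unfold mmm ccc
    rw [← mul_prod_erase P _ hp, this]; ring
  have MM1 : ∀ (χ : ℕ → ℝ) (U : Finset ℕ) (l : ℕ),
      MMM P χ (fib p l U) = (if l = 0 then (1 : ℝ) else 1 - 1 / p) * MMM P' χ (fib p l U) := by
    intro χ U l
    unfold MMM
    rw [mul_sum]
    exact sum_congr rfl fun v hv => mm1 χ U l v hv
  have g1 : ∀ v w l m, v.factorization p = l → w.factorization p = m →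
      (ggg P v w : ℝ) = (p : ℝ) ^ (m - l) * ggg P' v w := by
    intro v w l m h1 h2
    unfold ggg
    rw [← mul_prod_erase P _ hp, h1, h2]; push_cast; rfl
  have hTT : TTT P ψ θ ω (fib p i V) (fib p j W) A B =
      ci * cj * wp * TTT P' ψ θ ω (fib p i V) (fib p j W) (A / (p : ℝ) ^ (j - i))
        (B / (p : ℝ) ^ (i - j)) := by
    unfold TTT
    simp_rw [mul_sum]
    refine sum_congr rfl fun v hv => sum_congr rfl fun w hw => ?_
    have hv2 := (mem_filter.1 hv).2
    have hw2 := (mem_filter.1 hw).2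
    unfold FFF
    rw [mm1 ψ V i v hv, mm1 θ W j w hw, g1 v w i j hv2 hw2, g1 w v j i hw2 hv2]
    simp only [le_div_iff₀ (show 0 < (p : ℝ) ^ (j - i) by positivity),
      le_div_iff₀ (show 0 < (p : ℝ) ^ (i - j) by positivity)]
    have hwt : wtt P ω v w = wp * wtt P' ω v w := by
      unfold wtt
      rw [← mul_prod_erase P _ hp, hv2, hw2]
    rw [hwt]
    have e1 : ψ v * ((p : ℝ) ^ (j - i) * ggg P' v w) = ψ v * ggg P' v w * (p : ℝ) ^ (j - i) := by
      ring
    have e2 : θ w * ((p : ℝ) ^ (i - j) * ggg P' w v) = θ w * ggg P' w v * (p : ℝ) ^ (i - j) := by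
      ring
    rw [e1, e2, ← hci, ← hcj]
    split_ifs
    · ring
    · simp
  have h := hS (fib p i V) (fib p j W) (A / (p : ℝ) ^ (j - i)) (B / (p : ℝ) ^ (i - j))
    (by positivity) (by positivity) (minj V i hV) (minj W j hW)
  set M' := MMM P' ψ (fib p i V) with hM'
  set N' := MMM P' θ (fib p j W) with hN'
  have hM0 : 0 ≤ M' := MMM_nonneg hP'p hψ _
  have hN0 : 0 ≤ N' := MMM_nonneg hP'p hθ _
  rw [hTT, MM1, MM1, ← hci, ← hcj, ← hM', ← hN']
  have eAB : (A / (p : ℝ) ^ (j - i) * (B / (p : ℝ) ^ (i - j))) ^ (1 - β) =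
      (A * B) ^ (1 - β) * ((p : ℝ) ^ (-(1 - β))) ^ ((i - j) + (j - i)) := by
    have : A / (p : ℝ) ^ (j - i) * (B / (p : ℝ) ^ (i - j)) =
        (A * B) * ((p : ℝ) ^ ((i - j) + (j - i)))⁻¹ := by
      rw [pow_add]; field_simp
    rw [this, Real.mul_rpow (by positivity) (by positivity), Real.inv_rpow (by positivity),
      Real.rpow_neg hp0.le, inv_pow, ← Real.rpow_natCast, ← Real.rpow_natCast,
      ← Real.rpow_mul hp0.le, ← Real.rpow_mul hp0.le, mul_comm (1 - β)]
  have ekap : kap (ω p) ((p : ℝ) ^ (-(1 - β))) i j =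
      wp * ((p : ℝ) ^ (-(1 - β))) ^ ((i - j) + (j - i)) := by
    unfold kap
    rw [hwp]
    split_ifs with hij
    · subst hij; simp
    · rfl
  rw [eAB] at h
  rw [ekap]
  set R := ((p : ℝ) ^ (-(1 - β))) ^ ((i - j) + (j - i)) with hR
  have hR0 : 0 ≤ R := by positivity
  have ecc : ci * cj * (M' * N') ^ β ≤ (ci * M' * (cj * N')) ^ β := by
    have : ci * M' * (cj * N') = (ci * cj) * (M' * N') := by ring
    rw [this, Real.mul_rpow (x := ci * cj) (y := M' * N') (by positivity) (by positivity)]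
    refine mul_le_mul_of_nonneg_right ?_ (Real.rpow_nonneg (mul_nonneg hM0 hN0) β)
    have h1 : ci * cj ≤ 1 := by nlinarith
    calc ci * cj = (ci * cj) ^ (1 : ℝ) := by simp
      _ ≤ _ := Real.rpow_le_rpow_of_exponent_ge (by positivity) h1 hβ1.le
  calc ci * cj * wp * TTT P' ψ θ ω (fib p i V) (fib p j W) (A / (p : ℝ) ^ (j - i))
        (B / (p : ℝ) ^ (i - j))
      ≤ ci * cj * wp * (K * ((A * B) ^ (1 - β) * R) * (M' * N') ^ β) :=
        mul_le_mul_of_nonneg_left h (by positivity)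
    _ = (K * (A * B) ^ (1 - β) * (wp * R)) * (ci * cj * (M' * N') ^ β) := by ring
    _ ≤ (K * (A * B) ^ (1 - β) * (wp * R)) * (ci * M' * (cj * N')) ^ β :=
        mul_le_mul_of_nonneg_left ecc (by positivity)
    _ = _ := by ring

open Finset in
lemma fib_sum (p : ℕ) (V I : Finset ℕ) (hI : ∀ v ∈ V, v.factorization p ∈ I) (f : ℕ → ℝ) :
    ∑ v ∈ V, f v = ∑ i ∈ I, ∑ v ∈ fib p i V, f v := by
  unfold fib
  exact (sum_fiberwise_of_maps_to hI f).symm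

open Finset in
lemma split_sum {β : ℝ} (hβ : 0 < β) (hβ1 : β < 1) {ψ θ ω : ℕ → ℝ} (hψ : ∀ v, 0 ≤ ψ v)
    (hθ : ∀ v, 0 ≤ θ v) (hω : ∀ p, 1 ≤ ω p) {P : Finset ℕ} (hP : ∀ p ∈ P, p.Prime) {p : ℕ}
    (hp : p ∈ P) {K : ℝ} (hK : 0 ≤ K) (hS : SSS β ψ θ ω (P.erase p) K) (V W : Finset ℕ) (A B : ℝ)
    (hA : 0 < A) (hB : 0 < B) (hV : Set.InjOn (ptt P) V) (hW : Set.InjOn (ptt P) W)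
    (I : Finset ℕ) (hI : ∀ v ∈ V, v.factorization p ∈ I) (hJ : ∀ v ∈ W, v.factorization p ∈ I) :
    TTT P ψ θ ω V W A B ≤ K * (A * B) ^ (1 - β) *
      ∑ i ∈ I, ∑ j ∈ I, (kap (ω p) ((p : ℝ) ^ (-(1 - β))) i j *
        (MMM P ψ (fib p i V) * MMM P θ (fib p j W)) ^ β) := by
  have : TTT P ψ θ ω V W A B = ∑ i ∈ I, ∑ j ∈ I, TTT P ψ θ ω (fib p i V) (fib p j W) A B := by
    unfold TTT
    rw [fib_sum p V I hI]
    refine sum_congr rfl fun i _ => ?_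
    rw [sum_comm (s := I)]
    refine sum_congr rfl fun v _ => ?_
    rw [fib_sum p W I hJ]
  rw [this, mul_sum]
  refine sum_le_sum fun i _ => ?_
  rw [mul_sum]
  exact sum_le_sum fun j _ =>
    split_ij hβ hβ1 hψ hθ hω hP hp hK hS V W A B hA hB hV hW i j

lemma kap_mono {Ω Ω' r : ℝ} (h : Ω ≤ Ω') (hr : 0 ≤ r) (i j : ℕ) : kap Ω r i j ≤ kap Ω' r i j := by
  unfold kap
  split_ifs
  · exact le_rfl
  · exact mul_le_mul_of_nonneg_right h (by positivity)

lemma rp_lt {β : ℝ} (hβ1 : β < 1) {p : ℕ} (hp : p.Prime) :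
    0 < (p : ℝ) ^ (-(1 - β)) ∧ (p : ℝ) ^ (-(1 - β)) ≤ (2 : ℝ) ^ (-(1 - β)) ∧
      (2 : ℝ) ^ (-(1 - β)) < 1 := by
  have hp0 : (0 : ℝ) < p := by exact_mod_cast hp.pos
  have hp2 : (2 : ℝ) ≤ p := by exact_mod_cast hp.two_le
  refine ⟨by positivity, ?_, ?_⟩
  · exact Real.rpow_le_rpow_of_nonpos (by norm_num) hp2 (by linarith)
  · exact Real.rpow_lt_one_of_one_lt_of_neg (by norm_num) (by linarith)

open Finset in
/-- generic step with loss -/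
lemma step_loss {β Ω : ℝ} (hβ : 1/2 < β) (hβ1 : β < 1) {ψ θ ω : ℕ → ℝ} (hψ : ∀ v, 0 ≤ ψ v)
    (hθ : ∀ v, 0 ≤ θ v) (hω : ∀ p, 1 ≤ ω p) (hωΩ : ∀ p, ω p ≤ Ω) {P : Finset ℕ}
    (hP : ∀ p ∈ P, p.Prime) {p : ℕ}
    (hp : p ∈ P) {K : ℝ} (hK : 0 ≤ K) (hS : SSS β ψ θ ω (P.erase p) K) :
    SSS β ψ θ ω P (K * (1 + Ω * (2 * ((2 : ℝ) ^ (-(1 - β)) / (1 - (2 : ℝ) ^ (-(1 - β))))))) := by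
  intro V W A B hA hB hV hW
  obtain ⟨r0, r1, r2⟩ := rp_lt hβ1 (hP p hp)
  set r := (p : ℝ) ^ (-(1 - β)) with hr
  set r' := (2 : ℝ) ^ (-(1 - β)) with hr'
  have hω0 : 0 ≤ ω p := by linarith [hω p]
  have h := split_sum (by linarith) hβ1 hψ hθ hω hP hp hK hS V W A B hA hB hV hW
    (V.image (fun v => v.factorization p) ∪ W.image (fun v => v.factorization p))
    (fun v hv => mem_union_left _ (mem_image_of_mem _ hv))
    (fun v hv => mem_union_right _ (mem_image_of_mem _ hv))
  set I := V.image (fun v => v.factorization p) ∪ W.image (fun v => v.factorization p) with hI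
  refine h.trans ?_
  have h2 := kap_all hβ.le hω0 r0.le (r1.trans_lt r2) I I (fun i => MMM P ψ (fib p i V))
    (fun i => MMM P θ (fib p i W)) (fun i => MMM_nonneg hP hψ _) (fun i => MMM_nonneg hP hθ _)
  have hM : ∑ i ∈ I, MMM P ψ (fib p i V) = MMM P ψ V :=
    (fib_sum p V I (fun v hv => mem_union_left _ (mem_image_of_mem _ hv)) _).symm
  have hN : ∑ i ∈ I, MMM P θ (fib p i W) = MMM P θ W :=
    (fib_sum p W I (fun v hv => mem_union_right _ (mem_image_of_mem _ hv)) _).symm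
  rw [hM, hN] at h2
  have h3 : ω p * (2 * (r / (1 - r))) ≤ Ω * (2 * (r' / (1 - r'))) := by
    have a : r / (1 - r) ≤ r' / (1 - r') := by
      apply div_le_div₀ <;> linarith
    have b : 0 ≤ r / (1 - r) := div_nonneg r0.le (by linarith)
    have := hωΩ p
    apply mul_le_mul this <;> linarith
  have hX : 0 ≤ (MMM P ψ V * MMM P θ W) ^ β :=
    Real.rpow_nonneg (mul_nonneg (MMM_nonneg hP hψ _) (MMM_nonneg hP hθ _)) _
  calc _ ≤ K * (A * B) ^ (1 - β) * ((1 + ω p * (2 * (r / (1 - r)))) * (MMM P ψ V * MMM P θ W) ^ β) :=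
        mul_le_mul_of_nonneg_left h2 (by positivity)
    _ ≤ K * (A * B) ^ (1 - β) * ((1 + Ω * (2 * (r' / (1 - r')))) * (MMM P ψ V * MMM P θ W) ^ β) := by
        refine mul_le_mul_of_nonneg_left ?_ (by positivity)
        exact mul_le_mul_of_nonneg_right (by linarith) hX
    _ = _ := by ring

/-- concentration -/
def Conc (β Ω r0 A0 : ℝ) : Prop := ∀ r, 0 < r → r ≤ r0 → ∀ (I : Finset ℕ) (x y : ℕ → ℝ),
      (∀ i, 0 ≤ x i) → (∀ i, 0 ≤ y i) → ∑ i ∈ I, x i = 1 → ∑ i ∈ I, y i = 1 →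
      1 < ∑ i ∈ I, ∑ j ∈ I, kap Ω r i j * (x i * y j) ^ β →
      ∃ k ∈ I, 1 - x k ≤ A0 * r ^ (1 / (1 - β)) ∧ 1 - y k ≤ A0 * r ^ (1 / (1 - β))

open Finset in
lemma conc_step {β Ω r0 A0 : ℝ} (hc : Conc β Ω r0 A0) (hβ : 1/2 < β) (hβ1 : β < 1)
    {ψ θ ω : ℕ → ℝ} (hψ : ∀ v, 0 ≤ ψ v)
    (hθ : ∀ v, 0 ≤ θ v) (hω : ∀ p, 1 ≤ ω p) (hωΩ : ∀ p, ω p ≤ Ω) {P : Finset ℕ}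
    (hP : ∀ p ∈ P, p.Prime) {p : ℕ} (hp : p ∈ P) (hpr : (p : ℝ) ^ (-(1 - β)) ≤ r0)
    {K : ℝ} (hK : 0 < K) (hS : SSS β ψ θ ω (P.erase p) K) (V W : Finset ℕ) (A B : ℝ)
    (hA : 0 < A) (hB : 0 < B) (hV : Set.InjOn (ptt P) V) (hW : Set.InjOn (ptt P) W)
    (hM : 0 < MMM P ψ V) (hN : 0 < MMM P θ W)
    (hT : K * (A * B) ^ (1 - β) * (MMM P ψ V * MMM P θ W) ^ β < TTT P ψ θ ω V W A B) :
    ∃ k : ℕ, MMM P ψ (V.filter (fun v => v.factorization p ≠ k)) ≤ A0 / p * MMM P ψ V ∧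
      MMM P θ (W.filter (fun v => v.factorization p ≠ k)) ≤ A0 / p * MMM P θ W := by
  obtain ⟨rp0, -, -⟩ := rp_lt hβ1 (hP p hp)
  have hp0 : (0 : ℝ) < p := by exact_mod_cast (hP p hp).pos
  have h := split_sum (by linarith) hβ1 hψ hθ hω hP hp hK.le hS V W A B hA hB hV hW
    (V.image (fun v => v.factorization p) ∪ W.image (fun v => v.factorization p))
    (fun v hv => mem_union_left _ (mem_image_of_mem _ hv))
    (fun v hv => mem_union_right _ (mem_image_of_mem _ hv))
  set I := V.image (fun v => v.factorization p) ∪ W.image (fun v => v.factorization p) with hI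
  set M := MMM P ψ V with hMd
  set N := MMM P θ W with hNd
  have hMs : ∑ i ∈ I, MMM P ψ (fib p i V) = M :=
    (fib_sum p V I (fun v hv => mem_union_left _ (mem_image_of_mem _ hv)) _).symm
  have hNs : ∑ i ∈ I, MMM P θ (fib p i W) = N :=
    (fib_sum p W I (fun v hv => mem_union_right _ (mem_image_of_mem _ hv)) _).symm
  have h1 : (M * N) ^ β < ∑ i ∈ I, ∑ j ∈ I, (kap (ω p) ((p : ℝ) ^ (-(1 - β))) i j *
        (MMM P ψ (fib p i V) * MMM P θ (fib p j W)) ^ β) :=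
    lt_of_mul_lt_mul_left (hT.trans_le h) (by positivity)
  obtain ⟨k, -, hk1, hk2⟩ := hc ((p : ℝ) ^ (-(1 - β))) rp0 hpr I
    (fun i => MMM P ψ (fib p i V) / M) (fun i => MMM P θ (fib p i W) / N)
    (fun i => div_nonneg (MMM_nonneg hP hψ _) hM.le)
    (fun i => div_nonneg (MMM_nonneg hP hθ _) hN.le)
    (by rw [← sum_div, hMs, div_self hM.ne']) (by rw [← sum_div, hNs, div_self hN.ne']) (by
      have hMN : 0 < (M * N) ^ β := by positivity
      refine lt_of_mul_lt_mul_right ?_ hMN.le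
      rw [one_mul]
      refine h1.trans_le ?_
      rw [sum_mul]
      refine sum_le_sum fun i _ => ?_
      rw [sum_mul]
      refine sum_le_sum fun j _ => ?_
      have a1 := MMM_nonneg hP hψ (fib p i V)
      have a2 := MMM_nonneg hP hθ (fib p j W)
      rw [mul_assoc, ← Real.mul_rpow (by positivity) (by positivity)]
      have : MMM P ψ (fib p i V) / M * (MMM P θ (fib p j W) / N) * (M * N) =
        MMM P ψ (fib p i V) * MMM P θ (fib p j W) := by field_simp
      rw [this]
      exact mul_le_mul_of_nonneg_right (kap_mono (hωΩ p) rp0.le i j) (by positivity))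
  have er : ((p : ℝ) ^ (-(1 - β))) ^ (1 / (1 - β)) = 1 / p := by
    rw [← Real.rpow_mul hp0.le, one_div, neg_mul, mul_inv_cancel₀ (by linarith), Real.rpow_neg_one,
      one_div]
  rw [er] at hk1 hk2
  have hoff : ∀ (χ : ℕ → ℝ) (U : Finset ℕ), MMM P χ (U.filter (fun v => v.factorization p ≠ k)) =
      MMM P χ U - MMM P χ (fib p k U) := by
    intro χ U
    have := sum_filter_add_sum_filter_not U (fun v => v.factorization p = k) (mmm P χ)
    unfold MMM fib
    rw [← this]; simp
  refine ⟨k, ?_, ?_⟩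
  · rw [hoff]
    rw [sub_le_iff_le_add, ← sub_le_iff_le_add', le_div_iff₀ hM] at hk1
    rw [← hMd]; 
    calc _ ≤ M - (1 - A0 * (1 / p)) * M := by linarith
      _ = _ := by ring
  · rw [hoff]
    rw [sub_le_iff_le_add, ← sub_le_iff_le_add', le_div_iff₀ hN] at hk2
    rw [← hNd]; 
    calc _ ≤ N - (1 - A0 * (1 / p)) * N := by linarith
      _ = _ := by ring


def aaa (P : Finset ℕ) (k : ℕ → ℕ) (w : ℕ) : ℕ := ∏ p ∈ P, p ^ (w.factorization p - k p)
def bbb (P : Finset ℕ) (k : ℕ → ℕ) (w : ℕ) : ℕ := ∏ p ∈ P, p ^ (k p - w.factorization p)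
def eee (P : Finset ℕ) (k : ℕ → ℕ) (w : ℕ) : ℕ := ∏ p ∈ P, p ^ (min (w.factorization p) (k p))

open Finset in
lemma prod_pow_pos {P : Finset ℕ} (hP : ∀ p ∈ P, p.Prime) (f : ℕ → ℕ) : 0 < ∏ p ∈ P, p ^ f p :=
  prod_pos fun p hp => pow_pos (hP p hp).pos _

lemma aaa_mul_eee (P : Finset ℕ) (k : ℕ → ℕ) (w : ℕ) : aaa P k w * eee P k w = ptt P w := by
  unfold aaa eee ptt
  rw [← Finset.prod_mul_distrib]
  refine Finset.prod_congr rfl fun p _ => ?_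
  rw [← pow_add]; congr 1; omega

lemma bbb_mul_eee (P : Finset ℕ) (k : ℕ → ℕ) (w : ℕ) :
    bbb P k w * eee P k w = ∏ p ∈ P, p ^ k p := by
  unfold bbb eee
  rw [← Finset.prod_mul_distrib]
  refine Finset.prod_congr rfl fun p _ => ?_
  rw [← pow_add]; congr 1; omega

lemma ggg_eq {P : Finset ℕ} {k : ℕ → ℕ} {v w : ℕ}
    (h : ∀ p ∈ P, v.factorization p = k p ∨ w.factorization p = k p) :
    ggg P v w = bbb P k v * aaa P k w := by
  unfold ggg bbb aaa
  rw [← Finset.prod_mul_distrib]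
  refine Finset.prod_congr rfl fun p hp => ?_
  rw [← pow_add]; congr 1
  have := h p hp
  omega

open Finset in
lemma ccc_le {P : Finset ℕ} (hP : ∀ p ∈ P, p.Prime) (k : ℕ → ℕ) (w : ℕ) :
    ccc P w * (eee P k w : ℝ) ≤ (Nat.totient (eee P k w) : ℝ) := by
  have h := Nat.totient_eq_mul_prod_factors (eee P k w)
  have h' : (Nat.totient (eee P k w) : ℝ) =
      (eee P k w : ℝ) * ∏ p ∈ (eee P k w).primeFactors, (1 - (p : ℝ)⁻¹) := by
    have h2 := congrArg (Rat.cast : ℚ → ℝ) h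
    push_cast at h2
    exact h2
  rw [h', mul_comm]
  refine mul_le_mul_of_nonneg_left ?_ (Nat.cast_nonneg _)
  have hsub : (eee P k w).primeFactors ⊆ P.filter (fun p => w.factorization p ≠ 0) := by
    intro q hq
    have hqp := Nat.prime_of_mem_primeFactors hq
    have hqd := Nat.dvd_of_mem_primeFactors hq
    unfold eee at hqd
    obtain ⟨p, hp, hd⟩ := (hqp.prime.dvd_finsetProd_iff _).1 hqd
    have hqe : q = p := (Nat.prime_dvd_prime_iff_eq hqp (hP p hp)).1 (hqp.dvd_of_dvd_pow hd)
    subst hqe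
    refine mem_filter.2 ⟨hp, fun h0 => ?_⟩
    rw [h0] at hd
    simp at hd
    exact hqp.one_lt.ne' hd
  have e : ccc P w = ∏ p ∈ P.filter (fun p => w.factorization p ≠ 0), (1 - (p : ℝ)⁻¹) := by
    unfold ccc
    rw [prod_filter]
    refine prod_congr rfl fun p _ => ?_
    by_cases h : w.factorization p = 0 <;> simp [h]
  rw [e]
  have hpos : ∀ p ∈ P.filter (fun p => w.factorization p ≠ 0), 0 ≤ (1 - (p : ℝ)⁻¹) := by
    intro p hp
    have := (fac_nonneg (hP p (mem_filter.1 hp).1) 1).1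
    simp at this; simp; linarith
  rw [← prod_sdiff hsub]
  refine mul_le_of_le_one_left (prod_nonneg fun p hp => hpos p (hsub hp)) ?_
  refine prod_le_one (fun p hp => hpos p (mem_sdiff.1 hp).1) ?_
  intro p _
  simp

open Finset in
lemma half_count {P : Finset ℕ} (hP : ∀ p ∈ P, p.Prime) (k : ℕ → ℕ) {θ : ℕ → ℝ}
    (W : Finset ℕ) (hW : Set.InjOn (ptt P) W) {B α l : ℝ}
    (hB : 0 < B) (hα : 0 < α) (hl : 0 < l) :
    ∑ w ∈ W, (if θ w * ((bbb P k w : ℝ) * α) ≤ B ∧ (aaa P k w : ℝ) ≤ l * α then mmm P θ w else 0)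
      ≤ l * B := by
  rw [← sum_filter]
  set W' := W.filter (fun w => θ w * ((bbb P k w : ℝ) * α) ≤ B ∧ (aaa P k w : ℝ) ≤ l * α) with hW'
  set N := ∏ p ∈ P, p ^ k p with hN
  have hN0 : 0 < N := prod_pow_pos hP k
  have hN0' : (0 : ℝ) < N := by exact_mod_cast hN0
  have hm : ∀ w ∈ W', mmm P θ w ≤ B / (N * α) * (Nat.totient (eee P k w) : ℝ) := by
    intro w hw
    have h1 := (mem_filter.1 hw).2.1
    have hb : (0 : ℝ) < bbb P k w := by exact_mod_cast prod_pow_pos hP _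
    have he : (0 : ℝ) < eee P k w := by exact_mod_cast prod_pow_pos hP _
    have hbe : (bbb P k w : ℝ) * eee P k w = N := by exact_mod_cast bbb_mul_eee P k w
    have h2 := ccc_le hP k w
    have h3 := (ccc_pos hP w).le
    rw [div_mul_eq_mul_div, le_div_iff₀ (by positivity)]
    unfold mmm
    calc θ w * ccc P w * (N * α) = (θ w * ((bbb P k w : ℝ) * α)) * (ccc P w * eee P k w) := by
          rw [← hbe]; ring
      _ ≤ B * (ccc P w * eee P k w) := mul_le_mul_of_nonneg_right h1 (by positivity)
      _ ≤ _ := mul_le_mul_of_nonneg_left h2 hB.le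
  calc ∑ w ∈ W', mmm P θ w ≤ ∑ w ∈ W', B / (N * α) * (Nat.totient (eee P k w) : ℝ) :=
        sum_le_sum hm
    _ = ∑ z ∈ W'.image (fun w => (aaa P k w, eee P k w)), B / (N * α) * (Nat.totient z.2 : ℝ) := by
        rw [sum_image]
        intro v hv w hw h
        simp only [Prod.mk.injEq] at h
        refine hW (mem_filter.1 hv).1 (mem_filter.1 hw).1 ?_
        rw [← aaa_mul_eee P k v, ← aaa_mul_eee P k w, h.1, h.2]
    _ ≤ ∑ z ∈ (Icc 1 ⌊l * α⌋₊) ×ˢ N.divisors, B / (N * α) * (Nat.totient z.2 : ℝ) := by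
        refine sum_le_sum_of_subset_of_nonneg ?_ (fun _ _ _ => by positivity)
        intro z hz
        obtain ⟨w, hw, rfl⟩ := mem_image.1 hz
        refine mem_product.2 ⟨mem_Icc.2 ⟨prod_pow_pos hP _, ?_⟩, ?_⟩
        · exact Nat.le_floor (mem_filter.1 hw).2.2
        · exact Nat.mem_divisors.2 ⟨⟨bbb P k w, by rw [mul_comm]; exact (bbb_mul_eee P k w).symm⟩,
            hN0.ne'⟩
    _ = ⌊l * α⌋₊ * (B / (N * α) * N) := by
        rw [sum_product]
        simp only [sum_const, Nat.card_Icc, nsmul_eq_mul, Nat.add_sub_cancel]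
        rw [← mul_sum, ← Nat.cast_sum, Nat.sum_totient]
    _ ≤ (l * α) * (B / (N * α) * N) := by
        refine mul_le_mul_of_nonneg_right (Nat.floor_le (by positivity)) (by positivity)
    _ = l * B := by field_simp

open Finset Classical in
lemma count_lem {P : Finset ℕ} (hP : ∀ p ∈ P, p.Prime) (k : ℕ → ℕ) {ψ θ : ℕ → ℝ}
    (hψ : ∀ v, 0 ≤ ψ v) (hθ : ∀ v, 0 ≤ θ v)
    (V W : Finset ℕ) (hV : Set.InjOn (ptt P) V) (hW : Set.InjOn (ptt P) W) {A B l : ℝ}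
    (hA : 0 < A) (hB : 0 < B) (hl : 0 < l) :
    ∑ v ∈ V, ∑ w ∈ W, (if (ψ v * (ggg P v w : ℝ) ≤ A ∧ θ w * (ggg P w v : ℝ) ≤ B) ∧
        (∀ p ∈ P, v.factorization p = k p ∨ w.factorization p = k p) then
        mmm P ψ v * mmm P θ w else 0) ≤ l * B * MMM P ψ V + l⁻¹ * A * MMM P θ W := by
  have ha : ∀ v, (0 : ℝ) < aaa P k v := fun v => by exact_mod_cast prod_pow_pos hP _
  have h1 : ∀ v ∈ V, ∀ w ∈ W, (if (ψ v * (ggg P v w : ℝ) ≤ A ∧ θ w * (ggg P w v : ℝ) ≤ B) ∧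
        (∀ p ∈ P, v.factorization p = k p ∨ w.factorization p = k p) then
        mmm P ψ v * mmm P θ w else 0) ≤
      mmm P ψ v * (if θ w * ((bbb P k w : ℝ) * aaa P k v) ≤ B ∧
        (aaa P k w : ℝ) ≤ l * aaa P k v then mmm P θ w else 0) +
      mmm P θ w * (if ψ v * ((bbb P k v : ℝ) * aaa P k w) ≤ A ∧
        (aaa P k v : ℝ) ≤ l⁻¹ * aaa P k w then mmm P ψ v else 0) := by
    intro v _ w _
    have m1 := mmm_nonneg hP hψ v
    have m2 := mmm_nonneg hP hθ w
    by_cases hc : (ψ v * (ggg P v w : ℝ) ≤ A ∧ θ w * (ggg P w v : ℝ) ≤ B) ∧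
        (∀ p ∈ P, v.factorization p = k p ∨ w.factorization p = k p)
    · rw [if_pos hc]
      obtain ⟨⟨c1, c2⟩, c3⟩ := hc
      rw [ggg_eq c3] at c1
      rw [ggg_eq (fun p hp => (c3 p hp).symm)] at c2
      push_cast at c1 c2
      by_cases hle : (aaa P k w : ℝ) ≤ l * aaa P k v
      · rw [if_pos ⟨c2, hle⟩]
        have : 0 ≤ mmm P θ w * (if ψ v * ((bbb P k v : ℝ) * aaa P k w) ≤ A ∧
          (aaa P k v : ℝ) ≤ l⁻¹ * aaa P k w then mmm P ψ v else 0) := by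
          split_ifs
          · positivity
          · simp
        linarith
      · have hle' : (aaa P k v : ℝ) ≤ l⁻¹ * aaa P k w := by
          rw [inv_mul_eq_div, le_div_iff₀ hl]; push Not at hle; linarith
        rw [if_pos (c := ψ v * ((bbb P k v : ℝ) * aaa P k w) ≤ A ∧
          (aaa P k v : ℝ) ≤ l⁻¹ * aaa P k w) ⟨c1, hle'⟩]
        have : 0 ≤ mmm P ψ v * (if θ w * ((bbb P k w : ℝ) * aaa P k v) ≤ B ∧
          (aaa P k w : ℝ) ≤ l * aaa P k v then mmm P θ w else 0) := by
          split_ifs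
          · positivity
          · simp
        linarith
    · rw [if_neg hc]
      apply add_nonneg <;> apply mul_nonneg <;> first | assumption | (split_ifs <;> first | assumption | exact le_rfl)
  refine (sum_le_sum fun v hv => sum_le_sum fun w hw => h1 v hv w hw).trans ?_
  simp_rw [sum_add_distrib]
  refine add_le_add ?_ ?_
  · unfold MMM
    rw [mul_sum]
    refine sum_le_sum fun v _ => ?_
    rw [← mul_sum, mul_comm]
    exact mul_le_mul_of_nonneg_right (half_count hP k W hW hB (ha v) hl) (mmm_nonneg hP hψ v)
  · unfold MMM
    rw [sum_comm, mul_sum]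
    refine sum_le_sum fun v _ => ?_
    rw [← mul_sum, mul_comm]
    exact mul_le_mul_of_nonneg_right (half_count hP k V hV hA (ha v) (inv_pos.2 hl))
      (mmm_nonneg hP hθ v)

lemma min_lem {β A B M N G : ℝ} (hβ : 1/2 < β) (hβ1 : β < 1) (hA : 0 < A) (hB : 0 < B)
    (hM : 0 < M) (hN : 0 < N) (h1 : ∀ l : ℝ, 0 < l → G ≤ l * B * M + l⁻¹ * A * N)
    (h2 : G ≤ M * N) : G ≤ 2 * ((A * B) ^ (1 - β) * (M * N) ^ β) := by
  have hX : 0 < (A * B) ^ (1 - β) * (M * N) ^ β := by positivity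
  rcases le_total (M * N) (A * B) with h | h
  · have : M * N ≤ (A * B) ^ (1 - β) * (M * N) ^ β := by
      calc M * N = (M * N) ^ (1 - β) * (M * N) ^ β := by
            rw [← Real.rpow_add (by positivity)]; simp
        _ ≤ _ := mul_le_mul_of_nonneg_right (Real.rpow_le_rpow (by positivity) h (by linarith))
            (by positivity)
    linarith
  · have hG := h1 (Real.sqrt (A * N / (B * M))) (by positivity)
    set l := Real.sqrt (A * N / (B * M)) with hl
    have hl0 : 0 < l := by positivity
    have hl2 : l * l = A * N / (B * M) := Real.mul_self_sqrt (by positivity)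
    have e1 : l⁻¹ * A * N = l * B * M := by
      rw [inv_mul_eq_div, div_mul_eq_mul_div, div_eq_iff hl0.ne']
      calc A * N = (l * l) * (B * M) := by rw [hl2]; field_simp
        _ = _ := by ring
    have e2 : l * B * M = Real.sqrt (A * B) * Real.sqrt (M * N) := by
      rw [← Real.sqrt_mul (by positivity), eq_comm, Real.sqrt_eq_iff_mul_self_eq (by positivity)
        (by positivity)]
      have : l * B * M * (l * B * M) = (l * l) * (B * M) * (B * M) := by ring
      rw [this, hl2]
      field_simp
    have e3 : Real.sqrt (A * B) * Real.sqrt (M * N) ≤ (A * B) ^ (1 - β) * (M * N) ^ β := by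
      have a1 : Real.sqrt (A * B) = (A * B) ^ (1 - β) * (A * B) ^ (β - 1/2) := by
        rw [← Real.rpow_add (by positivity), Real.sqrt_eq_rpow]; congr 1; ring
      have a2 : (M * N) ^ β = (M * N) ^ (β - 1/2) * Real.sqrt (M * N) := by
        rw [Real.sqrt_eq_rpow, ← Real.rpow_add (by positivity)]; congr 1; ring
      rw [a1, a2, mul_assoc]
      refine mul_le_mul_of_nonneg_left ?_ (by positivity)
      exact mul_le_mul_of_nonneg_right (Real.rpow_le_rpow (by positivity) h (by linarith))
        (by positivity)
    linarith


noncomputable def lll (P : Finset ℕ) (ω : ℕ → ℝ) (k : ℕ → ℕ) (v : ℕ) : ℝ :=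
  ∑ p ∈ P, if v.factorization p = k p then 0 else Real.log (ω p)

lemma wtt_le {P : Finset ℕ} {ω : ℕ → ℝ} (hω : ∀ p, 1 ≤ ω p) (k : ℕ → ℕ) (v w : ℕ) :
    wtt P ω v w ≤ Real.exp (lll P ω k v) * Real.exp (lll P ω k w) := by
  unfold wtt lll
  rw [Real.exp_sum, Real.exp_sum, ← Finset.prod_mul_distrib]
  refine Finset.prod_le_prod (fun p _ => ?_) (fun p _ => ?_)
  · have := hω p; split_ifs <;> linarith
  · have h0 := hω p
    have h1 : Real.exp (Real.log (ω p)) = ω p := Real.exp_log (by linarith)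
    by_cases hv : v.factorization p = k p <;> by_cases hw : w.factorization p = k p <;>
      by_cases hvw : v.factorization p = w.factorization p <;>
      simp only [hv, hw, hvw, if_true, if_false, Real.exp_zero, h1] <;> try nlinarith
    all_goals (split_ifs <;> first | nlinarith | (exfalso; omega))

open Finset in
lemma bad_mass {P : Finset ℕ} (hP : ∀ p ∈ P, p.Prime) {ψ ω : ℕ → ℝ} (hψ : ∀ v, 0 ≤ ψ v)
    (hω : ∀ p, 1 ≤ ω p) (k : ℕ → ℕ) (V : Finset ℕ) {A0 H B1 : ℝ} (hA0 : 0 < A0)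
    (hH : ∑ p ∈ P, Real.log (ω p) / p ≤ H) (hB1 : 0 < B1) (hB1' : 16 * (A0 * H) ≤ B1)
    (hk : ∀ p ∈ P, MMM P ψ (V.filter (fun v => v.factorization p ≠ k p)) ≤ A0 / p * MMM P ψ V) :
    MMM P ψ (V.filter (fun v => B1 < lll P ω k v)) ≤ 1 / 16 * MMM P ψ V := by
  have hlog : ∀ p, 0 ≤ Real.log (ω p) := fun p => Real.log_nonneg (hω p)
  have hl0 : ∀ v, 0 ≤ lll P ω k v := fun v => sum_nonneg fun p _ => by
    have := hlog p
    split_ifs <;> linarith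
  have hM := MMM_nonneg hP hψ V
  have h1 : B1 * MMM P ψ (V.filter (fun v => B1 < lll P ω k v)) ≤
      ∑ v ∈ V, mmm P ψ v * lll P ω k v := by
    unfold MMM
    rw [mul_sum]
    calc _ ≤ ∑ v ∈ V.filter (fun v => B1 < lll P ω k v), mmm P ψ v * lll P ω k v := by
          refine sum_le_sum fun v hv => ?_
          rw [mul_comm]
          exact mul_le_mul_of_nonneg_left (mem_filter.1 hv).2.le (mmm_nonneg hP hψ v)
      _ ≤ _ := sum_le_sum_of_subset_of_nonneg (filter_subset _ _)
          (fun v _ _ => mul_nonneg (mmm_nonneg hP hψ v) (hl0 v))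
  have h2 : ∑ v ∈ V, mmm P ψ v * lll P ω k v =
      ∑ p ∈ P, Real.log (ω p) * MMM P ψ (V.filter (fun v => v.factorization p ≠ k p)) := by
    unfold lll MMM
    simp_rw [mul_sum]
    rw [sum_comm]
    refine sum_congr rfl fun p _ => ?_
    rw [sum_filter]
    refine sum_congr rfl fun v _ => ?_
    by_cases h : v.factorization p = k p <;> simp [h, mul_comm]
  have h3 : ∑ p ∈ P, Real.log (ω p) * MMM P ψ (V.filter (fun v => v.factorization p ≠ k p)) ≤
      A0 * H * MMM P ψ V := by
    calc _ ≤ ∑ p ∈ P, Real.log (ω p) * (A0 / p * MMM P ψ V) :=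
          sum_le_sum fun p hp => mul_le_mul_of_nonneg_left (hk p hp) (hlog p)
      _ = (A0 * MMM P ψ V) * ∑ p ∈ P, Real.log (ω p) / p := by
          rw [mul_sum]; exact sum_congr rfl fun p _ => by ring
      _ ≤ (A0 * MMM P ψ V) * H := mul_le_mul_of_nonneg_left hH (by positivity)
      _ = _ := by ring
  have h4 : B1 * MMM P ψ (V.filter (fun v => B1 < lll P ω k v)) ≤
      B1 * (1 / 16 * MMM P ψ V) := by
    calc _ ≤ A0 * H * MMM P ψ V := by linarith
      _ ≤ (B1 / 16) * MMM P ψ V := mul_le_mul_of_nonneg_right (by linarith) hM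
      _ = _ := by ring
  exact le_of_mul_le_mul_left h4 hB1

open Finset in
lemma card_lt_of_mass {P : Finset ℕ} {ψ : ℕ → ℝ} {V V' : Finset ℕ} (hs : V' ⊆ V)
    (h : MMM P ψ V' < MMM P ψ V) : V'.card < V.card := by
  refine card_lt_card (hs.ssubset_of_ne ?_)
  rintro rfl
  exact lt_irrefl _ h

set_option maxHeartbeats 1000000 in
open Finset Classical in
lemma large_primes {β Ω r0 A0 H : ℝ} (hc : Conc β Ω r0 A0) (hβ : 1/2 < β) (hβ1 : β < 1)
    (hA0 : 0 < A0) (hH0 : 0 ≤ H)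
    {ψ θ ω : ℕ → ℝ} (hψ : ∀ v, 0 ≤ ψ v)
    (hθ : ∀ v, 0 ≤ θ v) (hω : ∀ p, 1 ≤ ω p) (hωΩ : ∀ p, ω p ≤ Ω) (P : Finset ℕ) :
    (∀ p ∈ P, p.Prime) → (∀ p ∈ P, (p : ℝ) ^ (-(1 - β)) ≤ r0) →
    (∀ p ∈ P, A0 / p < 1) → (∑ p ∈ P, (A0 / (p : ℝ)) ^ (2 * β) ≤ 1 / 8) →
    (∑ p ∈ P, Real.log (ω p) / p ≤ H) →
    SSS β ψ θ ω P (16 * Real.exp (2 * (16 * (A0 * H) + 1))) := by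
  induction P using Finset.strongInduction with
  | H P ihP =>
  intro hP hPr hPA hPs hPH
  set B1 := 16 * (A0 * H) + 1 with hB1
  set K := 16 * Real.exp (2 * B1) with hKd
  have hB10 : 0 < B1 := by positivity
  have hK : 0 < K := by positivity
  have hb0 : 0 ≤ β := by linarith
  have hSe : ∀ p ∈ P, SSS β ψ θ ω (P.erase p) K := by
    intro p hp
    have hsub : P.erase p ⊆ P := erase_subset _ _
    refine ihP _ (erase_ssubset hp) (fun q hq => hP q (hsub hq)) (fun q hq => hPr q (hsub hq))
      (fun q hq => hPA q (hsub hq)) ?_ ?_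
    · exact (sum_le_sum_of_subset_of_nonneg hsub (fun q _ _ => by positivity)).trans hPs
    · exact (sum_le_sum_of_subset_of_nonneg hsub
        (fun q _ _ => div_nonneg (Real.log_nonneg (hω q)) (Nat.cast_nonneg _))).trans hPH
  suffices hmain : ∀ (n : ℕ) (V W : Finset ℕ), V.card + W.card = n →
      ∀ (A B : ℝ), 0 < A → 0 < B → Set.InjOn (ptt P) V →
      Set.InjOn (ptt P) W →
      TTT P ψ θ ω V W A B ≤ K * (A * B) ^ (1 - β) * (MMM P ψ V * MMM P θ W) ^ β from
    fun V W A B => hmain _ V W rfl A B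
  intro n
  induction n using Nat.strong_induction_on with
  | _ n ih =>
  intro V W hn A B hA hB hV hW
  by_contra hT
  push Not at hT
  have hM0 := MMM_nonneg hP hψ V
  have hN0 := MMM_nonneg hP hθ W
  -- positivity of the masses
  have hFb : ∀ v w, FFF P ψ θ ω A B v w ≤ mmm P ψ v * mmm P θ w * wtt P ω v w := by
    intro v w
    unfold FFF
    split_ifs
    · exact le_rfl
    · exact mul_nonneg (mul_nonneg (mmm_nonneg hP hψ v) (mmm_nonneg hP hθ w)) (wtt_pos hω v w)
  have hTpos : 0 < TTT P ψ θ ω V W A B := lt_of_le_of_lt (by positivity) hT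
  have hM : 0 < MMM P ψ V := by
    refine hM0.lt_of_ne fun h => ?_
    have hz : ∀ v ∈ V, mmm P ψ v = 0 :=
      (sum_eq_zero_iff_of_nonneg fun v _ => mmm_nonneg hP hψ v).1 h.symm
    have : TTT P ψ θ ω V W A B ≤ 0 := by
      refine sum_nonpos fun v hv => sum_nonpos fun w _ => (hFb v w).trans ?_
      rw [hz v hv]; simp
    linarith
  have hN : 0 < MMM P θ W := by
    refine hN0.lt_of_ne fun h => ?_
    have hz : ∀ v ∈ W, mmm P θ v = 0 :=
      (sum_eq_zero_iff_of_nonneg fun v _ => mmm_nonneg hP hθ v).1 h.symm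
    have : TTT P ψ θ ω V W A B ≤ 0 := by
      refine sum_nonpos fun v _ => sum_nonpos fun w hw => (hFb v w).trans ?_
      rw [hz w hw]; simp
    linarith
  have hconc : ∀ p, ∃ k : ℕ, p ∈ P →
      MMM P ψ (V.filter (fun v => v.factorization p ≠ k)) ≤ A0 / p * MMM P ψ V ∧
      MMM P θ (W.filter (fun v => v.factorization p ≠ k)) ≤ A0 / p * MMM P θ W := by
    intro p
    by_cases hp : p ∈ P
    · obtain ⟨k, hk⟩ := conc_step hc hβ hβ1 hψ hθ hω hωΩ hP hp (hPr p hp) hK (hSe p hp) V W A B hA hB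
        hV hW hM hN hT
      exact ⟨k, fun _ => hk⟩
    · exact ⟨0, fun h => absurd h hp⟩
  choose k hk using hconc
  set M := MMM P ψ V with hMd
  set N := MMM P θ W with hNd
  set X := (A * B) ^ (1 - β) * (M * N) ^ β with hX
  have hX0 : 0 < X := by positivity
  have hKX : K * (A * B) ^ (1 - β) * (M * N) ^ β = K * X := by rw [hX]; ring
  rw [hKX] at hT
  set badV := V.filter (fun v => B1 < lll P ω k v) with hbV
  set badW := W.filter (fun v => B1 < lll P ω k v) with hbW
  have mV : MMM P ψ badV ≤ 1 / 16 * M :=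
    bad_mass hP hψ hω k V hA0 hPH hB10 (by linarith) (fun p hp => (hk p hp).1)
  have mW : MMM P θ badW ≤ 1 / 16 * N :=
    bad_mass hP hθ hω k W hA0 hPH hB10 (by linarith) (fun p hp => (hk p hp).2)
  have h16 : ((1 : ℝ) / 16) ^ β ≤ 1 / 4 := by
    calc ((1 : ℝ) / 16) ^ β ≤ ((1 : ℝ) / 16) ^ ((1 : ℝ) / 2) :=
          Real.rpow_le_rpow_of_exponent_ge (by norm_num) (by norm_num) hβ.le
      _ = 1 / 4 := by
          rw [← Real.sqrt_eq_rpow, show (1 : ℝ) / 16 = (1 / 4) ^ 2 by norm_num,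
            Real.sqrt_sq (by norm_num)]
  have t1 : TTT P ψ θ ω badV W A B ≤ K * X / 4 := by
    have hcard : badV.card < V.card := card_lt_of_mass (filter_subset _ _) (by linarith)
    refine (ih _ (by omega) badV W rfl A B hA hB (hV.mono (Finset.coe_subset.2 (Finset.filter_subset _ _))) hW).trans ?_
    have : (MMM P ψ badV * N) ^ β ≤ 1 / 4 * (M * N) ^ β := by
      calc _ ≤ (1 / 16 * (M * N)) ^ β := Real.rpow_le_rpow
            (mul_nonneg (MMM_nonneg hP hψ _) hN0) (by nlinarith) hb0
        _ = (1 / 16) ^ β * (M * N) ^ β := Real.mul_rpow (by norm_num) (by positivity)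
        _ ≤ _ := mul_le_mul_of_nonneg_right h16 (by positivity)
    calc _ ≤ K * (A * B) ^ (1 - β) * (1 / 4 * (M * N) ^ β) :=
          mul_le_mul_of_nonneg_left this (by positivity)
      _ = _ := by rw [hX]; ring
  have t2 : TTT P ψ θ ω V badW A B ≤ K * X / 4 := by
    have hcard : badW.card < W.card := card_lt_of_mass (filter_subset _ _) (by linarith)
    refine (ih _ (by omega) V badW rfl A B hA hB hV (hW.mono (Finset.coe_subset.2 (Finset.filter_subset _ _)))).trans ?_
    have : (M * MMM P θ badW) ^ β ≤ 1 / 4 * (M * N) ^ β := by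
      calc _ ≤ (1 / 16 * (M * N)) ^ β := Real.rpow_le_rpow
            (mul_nonneg hM0 (MMM_nonneg hP hθ _)) (by nlinarith) hb0
        _ = (1 / 16) ^ β * (M * N) ^ β := Real.mul_rpow (by norm_num) (by positivity)
        _ ≤ _ := mul_le_mul_of_nonneg_right h16 (by positivity)
    calc _ ≤ K * (A * B) ^ (1 - β) * (1 / 4 * (M * N) ^ β) :=
          mul_le_mul_of_nonneg_left this (by positivity)
      _ = _ := by rw [hX]; ring
  have t3 : ∑ p ∈ P, TTT P ψ θ ω (V.filter (fun v => v.factorization p ≠ k p))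
      (W.filter (fun v => v.factorization p ≠ k p)) A B ≤ K * X / 8 := by
    calc _ ≤ ∑ p ∈ P, K * X * (A0 / (p : ℝ)) ^ (2 * β) := by
          refine sum_le_sum fun p hp => ?_
          obtain ⟨k1, k2⟩ := hk p hp
          have hpA := hPA p hp
          have hp0 : (0 : ℝ) < p := by exact_mod_cast (hP p hp).pos
          have c1 : (V.filter (fun v => v.factorization p ≠ k p)).card < V.card :=
            card_lt_of_mass (P := P) (ψ := ψ) (filter_subset _ _) (by nlinarith)
          have c2 : (W.filter (fun v => v.factorization p ≠ k p)).card < W.card :=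
            card_lt_of_mass (P := P) (ψ := θ) (filter_subset _ _) (by nlinarith)
          refine (ih _ (by omega) _ _ rfl A B hA hB (hV.mono (Finset.coe_subset.2 (Finset.filter_subset _ _))) (hW.mono (Finset.coe_subset.2 (Finset.filter_subset _ _)))).trans ?_
          have : (MMM P ψ (V.filter (fun v => v.factorization p ≠ k p)) *
              MMM P θ (W.filter (fun v => v.factorization p ≠ k p))) ^ β ≤
              (A0 / (p : ℝ)) ^ (2 * β) * (M * N) ^ β := by
            rw [Real.rpow_mul (by positivity), ← Real.mul_rpow (by positivity) (by positivity)]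
            refine Real.rpow_le_rpow (mul_nonneg (MMM_nonneg hP hψ _) (MMM_nonneg hP hθ _)) ?_ hb0
            refine (mul_le_mul k1 k2 (MMM_nonneg hP hθ _) (by positivity)).trans (le_of_eq ?_)
            rw [Real.rpow_two]; ring
          calc _ ≤ K * (A * B) ^ (1 - β) * ((A0 / (p : ℝ)) ^ (2 * β) * (M * N) ^ β) :=
                mul_le_mul_of_nonneg_left this (by positivity)
            _ = _ := by rw [hX]; ring
      _ = K * X * ∑ p ∈ P, (A0 / (p : ℝ)) ^ (2 * β) := by rw [mul_sum]
      _ ≤ K * X * (1 / 8) := mul_le_mul_of_nonneg_left hPs (by positivity)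
      _ = _ := by ring
  set G : ℕ → ℕ → ℝ := fun v w => (if (ψ v * (ggg P v w : ℝ) ≤ A ∧ θ w * (ggg P w v : ℝ) ≤ B) ∧
        (∀ p ∈ P, v.factorization p = k p ∨ w.factorization p = k p) then
        mmm P ψ v * mmm P θ w else 0) with hG
  have hGn : ∀ v w, 0 ≤ G v w := by
    intro v w
    simp only [hG]
    split_ifs
    · exact mul_nonneg (mmm_nonneg hP hψ v) (mmm_nonneg hP hθ w)
    · exact le_rfl
  have hGs : ∑ v ∈ V, ∑ w ∈ W, G v w ≤ 2 * X := by
    refine min_lem hβ hβ1 hA hB hM hN (fun l hl => count_lem hP k hψ hθ V W hV hW hA hB hl) ?_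
    rw [hMd, hNd]
    unfold MMM
    rw [sum_mul_sum]
    refine sum_le_sum fun v _ => sum_le_sum fun w _ => ?_
    simp only [hG]
    split_ifs
    · exact le_rfl
    · exact mul_nonneg (mmm_nonneg hP hψ v) (mmm_nonneg hP hθ w)
  have hFn := FFF_nonneg (A := A) (B := B) hP hψ hθ hω
  have hpt : ∀ v w, FFF P ψ θ ω A B v w ≤
      (if B1 < lll P ω k v then FFF P ψ θ ω A B v w else 0) +
      (if B1 < lll P ω k w then FFF P ψ θ ω A B v w else 0) +
      (∑ p ∈ P, if v.factorization p ≠ k p then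
        (if w.factorization p ≠ k p then FFF P ψ θ ω A B v w else 0) else 0) +
      Real.exp (2 * B1) * G v w := by
    intro v w
    have hF := hFn v w
    have n1 : 0 ≤ (if B1 < lll P ω k v then FFF P ψ θ ω A B v w else 0) := by
      split_ifs <;> first | exact hF | exact le_rfl
    have n2 : 0 ≤ (if B1 < lll P ω k w then FFF P ψ θ ω A B v w else 0) := by
      split_ifs <;> first | exact hF | exact le_rfl
    have n3' : ∀ p ∈ P, 0 ≤ (if v.factorization p ≠ k p then
        (if w.factorization p ≠ k p then FFF P ψ θ ω A B v w else 0) else 0) := by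
      intro p _
      split_ifs <;> first | exact hF | exact le_rfl
    have n3 := sum_nonneg n3'
    have n4 : 0 ≤ Real.exp (2 * B1) * G v w := mul_nonneg (Real.exp_pos _).le (hGn v w)
    by_cases b1 : B1 < lll P ω k v
    · rw [if_pos b1]; linarith
    by_cases b2 : B1 < lll P ω k w
    · rw [if_pos b2]; linarith
    by_cases b3 : ∀ p ∈ P, v.factorization p = k p ∨ w.factorization p = k p
    · have : FFF P ψ θ ω A B v w ≤ Real.exp (2 * B1) * G v w := by
        unfold FFF
        simp only [hG]
        by_cases hcnd : ψ v * (ggg P v w : ℝ) ≤ A ∧ θ w * (ggg P w v : ℝ) ≤ B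
        · rw [if_pos hcnd, if_pos ⟨hcnd, b3⟩, mul_comm]
          refine mul_le_mul_of_nonneg_right ((wtt_le hω k v w).trans ?_)
            (mul_nonneg (mmm_nonneg hP hψ v) (mmm_nonneg hP hθ w))
          rw [← Real.exp_add]
          exact Real.exp_le_exp.2 (by push Not at b1 b2; linarith)
        · rw [if_neg hcnd, if_neg (fun h => hcnd h.1)]; simp
      linarith
    · push Not at b3
      obtain ⟨p, hp, q1, q2⟩ := b3
      have := single_le_sum n3' hp
      rw [if_pos q1, if_pos q2] at this
      linarith
  have hfin : TTT P ψ θ ω V W A B ≤ TTT P ψ θ ω badV W A B + TTT P ψ θ ω V badW A B +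
      ∑ p ∈ P, TTT P ψ θ ω (V.filter (fun v => v.factorization p ≠ k p))
        (W.filter (fun v => v.factorization p ≠ k p)) A B +
      Real.exp (2 * B1) * ∑ v ∈ V, ∑ w ∈ W, G v w := by
    unfold TTT
    refine (sum_le_sum fun v _ => sum_le_sum fun w _ => hpt v w).trans (le_of_eq ?_)
    simp_rw [sum_add_distrib]
    congr 1
    · congr 1
      · congr 1
        · rw [hbV, sum_filter]
          refine sum_congr rfl fun v _ => ?_
          split_ifs <;> simp
        · refine sum_congr rfl fun v _ => ?_
          rw [hbW, sum_filter]
      · have : ∀ v ∈ V, ∑ w ∈ W, ∑ p ∈ P, (if v.factorization p ≠ k p then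
            (if w.factorization p ≠ k p then FFF P ψ θ ω A B v w else 0) else 0) =
            ∑ p ∈ P, if v.factorization p ≠ k p then
              ∑ w ∈ W.filter (fun v => v.factorization p ≠ k p), FFF P ψ θ ω A B v w else 0 := by
          intro v _
          rw [sum_comm]
          refine sum_congr rfl fun p _ => ?_
          rw [sum_filter]
          split_ifs <;> simp
        rw [sum_congr rfl this, sum_comm]
        refine sum_congr rfl fun p _ => ?_
        rw [sum_filter]
    · simp_rw [mul_sum]
  have hexp : Real.exp (2 * B1) = K / 16 := by rw [hKd]; ring
  have t4 : Real.exp (2 * B1) * ∑ v ∈ V, ∑ w ∈ W, G v w ≤ K * X / 8 := by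
    calc _ ≤ Real.exp (2 * B1) * (2 * X) := mul_le_mul_of_nonneg_left hGs (Real.exp_pos _).le
      _ = _ := by rw [hexp]; ring
  have : 0 < K * X := by positivity
  linarith


lemma SSS_mono {β : ℝ} {ψ θ ω : ℕ → ℝ} (hψ : ∀ v, 0 ≤ ψ v) (hθ : ∀ v, 0 ≤ θ v) {P : Finset ℕ}
    (hP : ∀ p ∈ P, p.Prime) {K K' : ℝ} (hK : K ≤ K') (hS : SSS β ψ θ ω P K) :
    SSS β ψ θ ω P K' := by
  intro V W A B hA hB hV hW
  refine (hS V W A B hA hB hV hW).trans ?_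
  have h1 : 0 ≤ (A * B) ^ (1 - β) := by positivity
  have h2 : 0 ≤ (MMM P ψ V * MMM P θ W) ^ β :=
    Real.rpow_nonneg (mul_nonneg (MMM_nonneg hP hψ V) (MMM_nonneg hP hθ W)) _
  gcongr

lemma add_small {β Ω : ℝ} (hβ : 1/2 < β) (hβ1 : β < 1) {ψ θ ω : ℕ → ℝ} (hψ : ∀ v, 0 ≤ ψ v)
    (hθ : ∀ v, 0 ≤ θ v) (hω : ∀ p, 1 ≤ ω p) (hωΩ : ∀ p, ω p ≤ Ω) {P : Finset ℕ}
    (hP : ∀ p ∈ P, p.Prime) {K K2 : ℝ} (hK : 0 ≤ K) (hK2 : 0 ≤ K2)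
    (hK2e : K2 = (1 + Ω * (2 * ((2 : ℝ) ^ (-(1 - β)) / (1 - (2 : ℝ) ^ (-(1 - β)))))))
    (hS : SSS β ψ θ ω P K) (S : Finset ℕ) (hSp : ∀ p ∈ S, p.Prime) (hd : Disjoint S P) :
    SSS β ψ θ ω (S ∪ P) (K * K2 ^ S.card) := by
  classical
  induction S using Finset.induction_on with
  | empty => simpa using hS
  | insert a S ha ih =>
    rw [Finset.disjoint_insert_left] at hd
    have h := ih (fun p hp => hSp p (Finset.mem_insert_of_mem hp)) hd.2
    rw [Finset.card_insert_of_notMem ha, pow_succ, ← mul_assoc, hK2e, ← hK2e]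
    have he : (insert a S ∪ P).erase a = S ∪ P := by
      rw [Finset.insert_union, Finset.erase_insert]
      simp [ha, hd.1]
    have := step_loss (P := insert a S ∪ P) (p := a) (K := K * K2 ^ S.card) hβ hβ1 hψ hθ hω hωΩ
      (by
        intro p hp
        rcases Finset.mem_union.1 hp with hp | hp
        · exact hSp p hp
        · exact hP p hp) (by simp) (by positivity) (by rw [he]; exact h)
    rw [← hK2e] at this
    exact this

lemma all_primes (β Ω H : ℝ) (hβ : 1/2 < β) (hβ1 : β < 1) (hΩ : 1 ≤ Ω) (hH : 0 ≤ H) :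
    ∃ K : ℝ, 0 < K ∧ ∀ (ψ θ ω : ℕ → ℝ), (∀ v, 0 ≤ ψ v) → (∀ v, 0 ≤ θ v) → (∀ p, 1 ≤ ω p) →
      (∀ p, ω p ≤ Ω) → ∀ P : Finset ℕ, (∀ p ∈ P, p.Prime) →
      (∑ p ∈ P, Real.log (ω p) / p ≤ H) → SSS β ψ θ ω P K := by
  classical
  obtain ⟨r0, A0, hr0, hA0, hc⟩ := conc_exists β Ω hβ hβ1 hΩ
  have hc : Conc β Ω r0 A0 := hc
  have e1 : ∀ᶠ n : ℕ in Filter.atTop, (n : ℝ) ^ (-(1 - β)) ≤ r0 := by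
    have := (tendsto_rpow_neg_atTop (y := 1 - β) (by linarith)).comp
      (tendsto_natCast_atTop_atTop (R := ℝ))
    filter_upwards [this.eventually (gt_mem_nhds hr0)] with n hn
    exact le_of_lt hn
  have e2 : ∀ᶠ n : ℕ in Filter.atTop, A0 / (n : ℝ) < 1 := by
    have := tendsto_const_div_atTop_nhds_zero_nat A0
    exact this.eventually (gt_mem_nhds one_pos)
  have hs : Summable (fun n : ℕ => (A0 / (n : ℝ)) ^ (2 * β)) := by
    have := (Real.summable_one_div_nat_rpow (p := 2 * β)).2 (by linarith)
    refine (this.mul_left (A0 ^ (2 * β))).congr fun n => ?_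
    rw [Real.div_rpow hA0.le (by positivity)]
    ring
  obtain ⟨s, hs⟩ := summable_iff_vanishing_norm.1 hs (1/8) (by norm_num)
  obtain ⟨N1, h1⟩ := Filter.eventually_atTop.1 e1
  obtain ⟨N2, h2⟩ := Filter.eventually_atTop.1 e2
  set p0 := N1 + N2 + s.sup id with hp0
  set K2 := (1 + Ω * (2 * ((2 : ℝ) ^ (-(1 - β)) / (1 - (2 : ℝ) ^ (-(1 - β)))))) with hK2e
  have hK2 : 1 ≤ K2 := by
    have h2 : (2 : ℝ) ^ (-(1 - β)) < 1 :=
      Real.rpow_lt_one_of_one_lt_of_neg (by norm_num) (by linarith)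
    have h3 : 0 < 1 - (2 : ℝ) ^ (-(1 - β)) := by linarith
    have : 0 ≤ Ω * (2 * ((2 : ℝ) ^ (-(1 - β)) / (1 - (2 : ℝ) ^ (-(1 - β))))) := by positivity
    linarith
  refine ⟨16 * Real.exp (2 * (16 * (A0 * H) + 1)) * K2 ^ (p0 + 1), by positivity, ?_⟩
  intro ψ θ ω hψ hθ hω hωΩ P hP hsum
  have hL : SSS β ψ θ ω (P.filter (fun p => ¬ p ≤ p0))
      (16 * Real.exp (2 * (16 * (A0 * H) + 1))) := by
    refine large_primes hc hβ hβ1 hA0 hH hψ hθ hω hωΩ _ ?_ ?_ ?_ ?_ ?_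
    · intro p hp; exact hP p (Finset.mem_filter.1 hp).1
    · intro p hp
      have := (Finset.mem_filter.1 hp).2
      exact h1 p (by omega)
    · intro p hp
      have := (Finset.mem_filter.1 hp).2
      exact h2 p (by omega)
    · refine (le_abs_self _).trans (le_of_lt (hs _ ?_))
      rw [Finset.disjoint_left]
      intro p hp hps
      have := (Finset.mem_filter.1 hp).2
      have h4 : id p ≤ s.sup id := Finset.le_sup hps
      simp only [id] at h4
      omega
    · refine le_trans (Finset.sum_le_sum_of_subset_of_nonneg (Finset.filter_subset _ _) ?_) hsum
      intro p _ _
      exact div_nonneg (Real.log_nonneg (hω p)) (by positivity)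
  have hA := add_small hβ hβ1 hψ hθ hω hωΩ (fun p hp => hP p (Finset.mem_filter.1 hp).1)
    (by positivity) (by linarith) hK2e hL (P.filter (fun p => p ≤ p0))
    (fun p hp => hP p (Finset.mem_filter.1 hp).1) (Finset.disjoint_filter_filter_not _ _ _)
  rw [Finset.filter_union_filter_not_eq] at hA
  refine SSS_mono hψ hθ hP ?_ hA
  have hcard : (P.filter (fun p => p ≤ p0)).card ≤ p0 + 1 := by
    have : P.filter (fun p => p ≤ p0) ⊆ Finset.range (p0 + 1) := by
      intro p hp
      have := (Finset.mem_filter.1 hp).2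
      simp; omega
    simpa using Finset.card_le_card this
  gcongr

lemma omega_sum {C t : ℝ} (hC : 0 ≤ C) (ht : 1 ≤ t) (P : Finset ℕ) :
    ∑ p ∈ P, Real.log (if t < (p : ℝ) then Real.exp (C * t / p) else 1) / p ≤ 2 * C := by
  have h1 : ∑ p ∈ P, Real.log (if t < (p : ℝ) then Real.exp (C * t / p) else 1) / p
      = C * t * ∑ p ∈ P.filter (fun p : ℕ => t < (p : ℝ)), ((p : ℝ) ^ 2)⁻¹ := by
    rw [Finset.mul_sum, Finset.sum_filter]
    refine Finset.sum_congr rfl fun p _ => ?_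
    split_ifs
    · rw [Real.log_exp]; field_simp
    · simp
  have h2 : ∑ p ∈ P.filter (fun p : ℕ => t < (p : ℝ)), ((p : ℝ) ^ 2)⁻¹ ≤ 2 / t := by
    have h3 := sum_Ioo_inv_sq_le (α := ℝ) ⌊t⌋₊ (P.sup id + 1)
    have h4 : 2 / ((⌊t⌋₊ : ℝ) + 1) ≤ 2 / t := by
      have := Nat.lt_floor_add_one t
      gcongr
    refine le_trans (Finset.sum_le_sum_of_subset_of_nonneg ?_ ?_) (h3.trans h4)
    · intro p hp
      obtain ⟨hp1, hp2⟩ := Finset.mem_filter.1 hp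
      have h5 : id p ≤ P.sup id := Finset.le_sup hp1
      simp only [id] at h5
      rw [Finset.mem_Ioo]
      exact ⟨(Nat.floor_lt (by linarith)).2 hp2, by omega⟩
    · intros; positivity
  rw [h1]
  calc _ ≤ C * t * (2 / t) := by gcongr
    _ = 2 * C := by field_simp

lemma omega_ge {C t : ℝ} (hC : 0 ≤ C) (ht : 1 ≤ t) (p : ℕ) :
    1 ≤ (if t < (p : ℝ) then Real.exp (C * t / p) else 1) := by
  split_ifs
  · apply Real.one_le_exp; positivity
  · exact le_rfl

lemma omega_le {C t : ℝ} (hC : 0 ≤ C) (ht : 1 ≤ t) (p : ℕ) :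
    (if t < (p : ℝ) then Real.exp (C * t / p) else 1) ≤ Real.exp C := by
  split_ifs with h
  · apply Real.exp_le_exp.2
    rw [div_le_iff₀ (by linarith)]
    gcongr
  · exact Real.one_le_exp hC

def prm (Q : ℕ) : Finset ℕ := (Finset.Icc 1 Q).filter Nat.Prime

lemma supp_prm {Q v : ℕ} (hv : v ∈ Finset.Icc 1 Q) : v.primeFactors ⊆ prm Q := by
  intro p hp
  rw [Finset.mem_Icc] at hv
  have h1 := Nat.prime_of_mem_primeFactors hp
  have h2 := Nat.le_of_mem_primeFactors hp
  simp only [prm, Finset.mem_filter, Finset.mem_Icc]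
  exact ⟨⟨h1.one_lt.le, h2.trans hv.2⟩, h1⟩

lemma ptt_prm {Q v : ℕ} (hv : v ∈ Finset.Icc 1 Q) : ptt (prm Q) v = v := by
  have h0 : v ≠ 0 := by rw [Finset.mem_Icc] at hv; omega
  conv_rhs => rw [← Nat.prod_factorization_pow_eq_self h0]
  unfold ptt
  rw [Finsupp.prod]
  symm
  refine Finset.prod_subset (supp_prm hv) ?_
  intro p _ hp
  rw [Finsupp.notMem_support_iff.1 hp, pow_zero]

lemma ggg_prm {Q q r : ℕ} (hq : q ∈ Finset.Icc 1 Q) (hr : r ∈ Finset.Icc 1 Q) :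
    ggg (prm Q) q r = r / Nat.gcd q r := by
  have hq0 : q ≠ 0 := by rw [Finset.mem_Icc] at hq; omega
  have hr0 : r ≠ 0 := by rw [Finset.mem_Icc] at hr; omega
  have hd : Nat.gcd q r ∣ r := Nat.gcd_dvd_right q r
  have hx : r / Nat.gcd q r ∈ Finset.Icc 1 Q := by
    rw [Finset.mem_Icc] at hr ⊢
    exact ⟨Nat.div_pos (Nat.le_of_dvd (by omega) hd) (Nat.gcd_pos_of_pos_right _ (by omega)),
      (Nat.div_le_self _ _).trans hr.2⟩
  rw [← ptt_prm hx]
  unfold ggg ptt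
  refine Finset.prod_congr rfl fun p _ => ?_
  rw [Nat.factorization_div hd, Nat.factorization_gcd hq0 hr0]
  congr 1
  simp only [Finsupp.coe_tsub, Pi.sub_apply, Finsupp.inf_apply]
  omega

lemma ccc_prm {Q q : ℕ} (hq : q ∈ Finset.Icc 1 Q) :
    ccc (prm Q) q = (Nat.totient q : ℝ) / q := by
  have hq0 : q ≠ 0 := by rw [Finset.mem_Icc] at hq; omega
  have h := Nat.totient_eq_mul_prod_factors q
  have h' : (Nat.totient q : ℝ) = q * ∏ p ∈ q.primeFactors, (1 - (p : ℝ)⁻¹) := by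
    have := congrArg (fun x : ℚ => (x : ℝ)) h
    push_cast at this
    exact this
  have hq1 : (q : ℝ) ≠ 0 := by exact_mod_cast hq0
  rw [h', mul_div_cancel_left₀ _ hq1]
  unfold ccc
  symm
  refine Finset.prod_subset_one_on_sdiff (supp_prm hq) ?_ ?_
  · intro p hp
    rw [Finset.mem_sdiff] at hp
    rw [if_pos]
    exact Finsupp.notMem_support_iff.1 (by simpa using hp.2)
  · intro p hp
    rw [if_neg, one_div]
    exact Finsupp.mem_support_iff.1 (by simpa using hp)

lemma gcd_fac {q r p : ℕ} (hq : q ≠ 0) (hr : r ≠ 0)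
    (hp : p ∈ (q * r / Nat.gcd q r ^ 2).primeFactors) :
    q.factorization p ≠ r.factorization p ∧ (p ∣ q ∨ p ∣ r) ∧ p.Prime := by
  have hd : Nat.gcd q r ^ 2 ∣ q * r := by
    rw [sq]; exact mul_dvd_mul (Nat.gcd_dvd_left q r) (Nat.gcd_dvd_right q r)
  have h1 : (q * r / Nat.gcd q r ^ 2).factorization p ≠ 0 :=
    Finsupp.mem_support_iff.1 (by simpa using hp)
  rw [Nat.factorization_div hd, Nat.factorization_pow, Nat.factorization_gcd hq hr,
    Nat.factorization_mul hq hr] at h1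
  simp only [Finsupp.coe_tsub, Pi.sub_apply, Finsupp.inf_apply, Finsupp.coe_add, Pi.add_apply,
    Finsupp.coe_smul, Pi.smul_apply, smul_eq_mul] at h1
  have hpp := Nat.prime_of_mem_primeFactors hp
  refine ⟨by intro h; rw [h] at h1; simp at h1; omega, ?_, hpp⟩
  have := (Nat.dvd_of_mem_primeFactors hp).trans (Nat.div_dvd_of_dvd hd)
  exact hpp.dvd_mul.1 this

lemma wtt_prm {C t : ℝ} (hC : 0 ≤ C) (ht : 1 ≤ t) {Q q r : ℕ} (hq : q ∈ Finset.Icc 1 Q)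
    (hr : r ∈ Finset.Icc 1 Q) :
    Real.exp (C * t * ∑ p ∈ (q * r / Nat.gcd q r ^ 2).primeFactors.filter
      (fun p : ℕ => t < (p : ℝ)), (1 : ℝ) / p) ≤
    wtt (prm Q) (fun p => if t < (p : ℝ) then Real.exp (C * t / p) else 1) q r := by
  have hq0 : q ≠ 0 := by rw [Finset.mem_Icc] at hq; omega
  have hr0 : r ≠ 0 := by rw [Finset.mem_Icc] at hr; omega
  rw [Finset.mul_sum, Real.exp_sum]
  unfold wtt
  calc _ ≤ ∏ p ∈ (q * r / Nat.gcd q r ^ 2).primeFactors.filter (fun p : ℕ => t < (p : ℝ)),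
        (if q.factorization p = r.factorization p then (1 : ℝ) else
          if t < (p : ℝ) then Real.exp (C * t / p) else 1) := by
        refine le_of_eq (Finset.prod_congr rfl fun p hp => ?_)
        obtain ⟨hp1, hp2⟩ := Finset.mem_filter.1 hp
        rw [if_neg (gcd_fac hq0 hr0 hp1).1, if_pos hp2]
        congr 1; ring
    _ ≤ _ := by
        refine Finset.prod_le_prod_of_subset_of_one_le ?_ ?_ ?_
        · intro p hp
          obtain ⟨_, h, hpp⟩ := gcd_fac hq0 hr0 (Finset.mem_filter.1 hp).1
          rcases h with h | h
          · exact supp_prm hq (Nat.mem_primeFactors.2 ⟨hpp, h, hq0⟩)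
          · exact supp_prm hr (Nat.mem_primeFactors.2 ⟨hpp, h, hr0⟩)
        · intro p _
          have := omega_ge hC ht p
          split_ifs at * <;> positivity
        · intro p _ _
          have := omega_ge hC ht p
          by_cases h : q.factorization p = r.factorization p
          · rw [if_pos h]
          · rw [if_neg h]; exact this

/-- Second bilinear estimate: for fixed `ε ∈ (0,1)` and `C ≥ 1`, uniformly in `ψ ≥ 0`,
`Q ≥ 1` and `y, t, s ≥ 1`,
`∑∑_{(q,r) ∈ [1,Q]², D(q,r) ≤ y, L_t(q,r) ≥ 1/s} (ψ(q)φ(q)/q)(ψ(r)φ(r)/r)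
  ≪_{ε,C} e^{-Ct/s} y^{1-ε} Ψ(Q)^{1+ε}`. -/
theorem bilinear_estimate_two (ε C : ℝ) (hε : ε ∈ Set.Ioo (0 : ℝ) 1) (hC : 1 ≤ C) :
    ∃ K : ℝ, 0 < K ∧ ∀ ψ : ℕ → ℝ, (∀ q, 0 ≤ ψ q) → ∀ Q : ℕ, 1 ≤ Q →
      ∀ y t s : ℝ, 1 ≤ y → 1 ≤ t → 1 ≤ s →
        (∑ q ∈ Finset.Icc 1 Q, ∑ r ∈ Finset.Icc 1 Q,
            if Dfun ψ q r ≤ y ∧ 1 / s ≤ Lfun t q r then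
              ψ q * (Nat.totient q : ℝ) / q * (ψ r * (Nat.totient r : ℝ) / r)
            else 0)
          ≤ K * Real.exp (-C * t / s) * y ^ (1 - ε) * Psi ψ Q ^ (1 + ε) := by
  obtain ⟨hε0, hε1⟩ := hε
  obtain ⟨K, hK, hmain⟩ := all_primes ((1 + ε) / 2) (Real.exp C) (2 * C) (by linarith)
    (by linarith) (Real.one_le_exp (by linarith)) (by linarith)
  refine ⟨K, hK, ?_⟩
  intro ψ hψ Q hQ y t s hy ht hs
  have hC0 : 0 ≤ C := by linarith
  set ω : ℕ → ℝ := fun p => if t < (p : ℝ) then Real.exp (C * t / p) else 1 with hω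
  have hPp : ∀ p ∈ prm Q, p.Prime := fun p hp => (Finset.mem_filter.1 hp).2
  have hω1 : ∀ p, 1 ≤ ω p := fun p => omega_ge hC0 ht p
  have hS := hmain ψ ψ ω hψ hψ hω1 (fun p => omega_le hC0 ht p) (prm Q) hPp
    (omega_sum hC0 ht _)
  have hinj : Set.InjOn (ptt (prm Q)) (Finset.Icc 1 Q : Finset ℕ) := by
    intro a ha b hb hab
    rw [ptt_prm (Finset.mem_coe.1 ha), ptt_prm (Finset.mem_coe.1 hb)] at hab
    exact hab
  have hT := hS (Finset.Icc 1 Q) (Finset.Icc 1 Q) y y (by linarith) (by linarith) hinj hinj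
  have hM : MMM (prm Q) ψ (Finset.Icc 1 Q) = Psi ψ Q / 2 := by
    unfold MMM Psi
    rw [mul_div_cancel_left₀ _ (two_ne_zero)]
    refine Finset.sum_congr rfl fun q hq => ?_
    unfold mmm
    rw [ccc_prm hq]; ring
  have hM0 : 0 ≤ Psi ψ Q / 2 := by
    rw [← hM]; exact MMM_nonneg hPp hψ _
  have hle : (∑ q ∈ Finset.Icc 1 Q, ∑ r ∈ Finset.Icc 1 Q,
            if Dfun ψ q r ≤ y ∧ 1 / s ≤ Lfun t q r then
              ψ q * (Nat.totient q : ℝ) / q * (ψ r * (Nat.totient r : ℝ) / r)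
            else 0) ≤ Real.exp (-C * t / s) *
              TTT (prm Q) ψ ψ ω (Finset.Icc 1 Q) (Finset.Icc 1 Q) y y := by
    unfold TTT
    rw [Finset.mul_sum]
    refine Finset.sum_le_sum fun q hq => ?_
    rw [Finset.mul_sum]
    refine Finset.sum_le_sum fun r hr => ?_
    have hF0 := FFF_nonneg hPp hψ hψ hω1 y y q r
    split_ifs with h
    · obtain ⟨hD, hL⟩ := h
      have hq0 : 0 < q := by rw [Finset.mem_Icc] at hq; omega
      have hr0 : 0 < r := by rw [Finset.mem_Icc] at hr; omega
      have hg : 0 < Nat.gcd q r := Nat.gcd_pos_of_pos_left _ hq0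
      have hg' : (0 : ℝ) < (Nat.gcd q r : ℝ) := by exact_mod_cast hg
      unfold Dfun at hD
      rw [div_le_iff₀ hg'] at hD
      have hD1 := (le_max_left _ _).trans hD
      have hD2 := (le_max_right _ _).trans hD
      have hc : ψ q * (ggg (prm Q) q r : ℝ) ≤ y ∧ ψ r * (ggg (prm Q) r q : ℝ) ≤ y := by
        rw [ggg_prm hq hr, ggg_prm hr hq, Nat.gcd_comm r q,
          Nat.cast_div (Nat.gcd_dvd_right q r) hg'.ne', Nat.cast_div (Nat.gcd_dvd_left q r) hg'.ne',
          ← mul_div_assoc, ← mul_div_assoc, div_le_iff₀ hg', div_le_iff₀ hg']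
        constructor <;> linarith
      unfold FFF
      rw [if_pos hc]
      unfold mmm
      rw [ccc_prm hq, ccc_prm hr]
      have hw := wtt_prm (C := C) hC0 ht hq hr
      have hLe : Real.exp (C * t / s) ≤ wtt (prm Q) ω q r := by
        refine le_trans (Real.exp_le_exp.2 ?_) hw
        have h5 : C * t * (1 / s) ≤ C * t * Lfun t q r := by gcongr
        calc C * t / s = C * t * (1 / s) := by ring
          _ ≤ _ := h5
      have h6 : 1 ≤ Real.exp (-C * t / s) * wtt (prm Q) ω q r := by
        calc (1 : ℝ) = Real.exp (-C * t / s) * Real.exp (C * t / s) := by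
              rw [← Real.exp_add, ← Real.exp_zero]; congr 1; ring
          _ ≤ _ := by gcongr
      have h7 : 0 ≤ ψ q * (Nat.totient q : ℝ) / q * (ψ r * (Nat.totient r : ℝ) / r) := by
        have := hψ q
        have := hψ r
        positivity
      calc _ ≤ ψ q * (Nat.totient q : ℝ) / q * (ψ r * (Nat.totient r : ℝ) / r) *
            (Real.exp (-C * t / s) * wtt (prm Q) ω q r) := le_mul_of_one_le_right h7 h6
        _ = _ := by ring
    · positivity
  rw [hM] at hT
  have e1 : (y * y) ^ (1 - (1 + ε) / 2) = y ^ (1 - ε) := by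
    rw [← sq, ← Real.rpow_natCast, ← Real.rpow_mul (by linarith)]
    congr 1; push_cast; ring
  have e2 : (Psi ψ Q / 2 * (Psi ψ Q / 2)) ^ ((1 + ε) / 2) ≤ Psi ψ Q ^ (1 + ε) := by
    have : (Psi ψ Q / 2 * (Psi ψ Q / 2)) ^ ((1 + ε) / 2) = (Psi ψ Q / 2) ^ (1 + ε) := by
      rw [← sq, ← Real.rpow_natCast, ← Real.rpow_mul hM0]
      congr 1; push_cast; ring
    rw [this]
    exact Real.rpow_le_rpow hM0 (by linarith) (by linarith)
  rw [e1] at hT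
  have hy0 : 0 ≤ y ^ (1 - ε) := Real.rpow_nonneg (by linarith) _
  calc _ ≤ _ := hle
    _ ≤ Real.exp (-C * t / s) * (K * y ^ (1 - ε) *
        (Psi ψ Q / 2 * (Psi ψ Q / 2)) ^ ((1 + ε) / 2)) := by gcongr
    _ ≤ Real.exp (-C * t / s) * (K * y ^ (1 - ε) * Psi ψ Q ^ (1 + ε)) := by gcongr
    _ = _ := by ring
end

section
/- Fix ε ∈ (0,1), κ > 0 and C ≥ 1. Let ψ: ℕ → ℝ_{≥0} be a function, let Q ≥ 1 and y, t ≥ 1. Then ∑∑_{(q,r)∈[1,Q]², D(q,r) ≤ y, ω_t(q,r) ≥ κ log t} (ψ(q)φ(q)/q)·(ψ(r)φ(r)/r) ≪_{ε,κ,C} t^{−C}·y^{1−ε}·Ψ(Q)^{1+ε}, uniformly in ψ, Q, y, t, where the implied constant depends only on ε, κ and C. -/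
section
open Finset

/-- off-diagonal kernel -/
noncomputable def offk (q : ℝ) (i j : ℕ) : ℝ := if i = j then 0 else q ^ ((i - j) + (j - i))

lemma offk_nonneg {q : ℝ} (h0 : 0 ≤ q) (i j : ℕ) : 0 ≤ offk q i j := by
  unfold offk; split_ifs <;> positivity

lemma offk_symm (q : ℝ) (i j : ℕ) : offk q i j = offk q j i := by
  unfold offk
  by_cases h : i = j
  · simp [h]
  · rw [if_neg h, if_neg (Ne.symm h), add_comm]

lemma geom_row_aux {q : ℝ} (h0 : 0 ≤ q) (i L : ℕ) :
    (1 - q) * ∑ j ∈ range L, offk q i j ≤ if L ≤ i then q ^ (i - L + 1) else 2 * q - q ^ (L - i) := by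
  induction L with
  | zero => simp; positivity
  | succ L ih =>
    rw [sum_range_succ, mul_add]
    rcases lt_trichotomy L i with h | h | h
    · rw [if_pos h.le] at ih
      rw [if_pos (by omega)]
      have : offk q i L = q ^ (i - L) := by
        unfold offk; rw [if_neg (by omega)]; congr 1; omega
      rw [this]
      have e : i - (L + 1) + 1 = i - L := by omega
      rw [e]
      rw [pow_succ] at ih
      linarith
    · subst h
      simp [offk] at ih ⊢
      linarith
    · rw [if_neg (by omega)] at ih
      rw [if_neg (by omega)]
      have : offk q i L = q ^ (L - i) := by
        unfold offk; rw [if_neg (by omega)]; congr 1; omega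
      rw [this]
      have e : L + 1 - i = (L - i) + 1 := by omega
      rw [e, pow_succ]
      linarith

lemma geom_row {q : ℝ} (h0 : 0 ≤ q) (h1 : q < 1) (i L : ℕ) :
    ∑ j ∈ range L, offk q i j ≤ 2 * q / (1 - q) := by
  rw [le_div_iff₀ (by linarith), mul_comm]
  refine (geom_row_aux h0 i L).trans ?_
  split_ifs
  · rw [pow_succ]
    have : q ^ (i - L) ≤ 1 := pow_le_one₀ h0 h1.le
    nlinarith
  · have : 0 ≤ q ^ (L - i) := by positivity
    linarith

lemma schur {q : ℝ} (h0 : 0 ≤ q) (h1 : q < 1) (L : ℕ) (u w : ℕ → ℝ) (hu : ∀ i, 0 ≤ u i)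
    (hw : ∀ i, 0 ≤ w i) :
    ∑ i ∈ range L, ∑ j ∈ range L, offk q i j * (u i + w j) ≤
      2 * q / (1 - q) * (∑ i ∈ range L, u i + ∑ i ∈ range L, w i) := by
  have e : ∑ i ∈ range L, ∑ j ∈ range L, offk q i j * (u i + w j) =
      ∑ i ∈ range L, (∑ j ∈ range L, offk q i j) * u i
      + ∑ j ∈ range L, (∑ i ∈ range L, offk q j i) * w j := by
    simp_rw [mul_add, sum_add_distrib]
    congr 1
    · simp_rw [sum_mul]
    · rw [sum_comm]
      simp_rw [sum_mul]
      refine sum_congr rfl fun i _ => sum_congr rfl fun j _ => ?_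
      rw [offk_symm]
  rw [e, mul_add, mul_sum, mul_sum]
  gcongr with i _ j _
  · exact hu i
  · exact geom_row h0 h1 i L
  · exact hw j
  · exact geom_row h0 h1 j L

/-- the kernel -/
noncomputable def ker (M q : ℝ) (i j : ℕ) : ℝ := (if i = j then 1 else 0) + M * offk q i j

lemma ker_sum (M q : ℝ) (L : ℕ) (F : ℕ → ℕ → ℝ) :
    ∑ i ∈ range L, ∑ j ∈ range L, ker M q i j * F i j =
    ∑ i ∈ range L, F i i + M * ∑ i ∈ range L, ∑ j ∈ range L, offk q i j * F i j := by
  unfold ker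
  simp_rw [add_mul, sum_add_distrib, mul_sum]
  congr 1
  · refine sum_congr rfl fun i hi => ?_
    simp only [ite_mul, one_mul, zero_mul]
    rw [sum_ite_eq, if_pos hi]
  · simp_rw [mul_assoc]

/-- general Schur bound -/
lemma ker_bound {M q ε : ℝ} (hM : 1 ≤ M) (h0 : 0 ≤ q) (h1 : q < 1) (hε : 0 < ε)
    (L : ℕ) (α β : ℕ → ℝ) (hα : ∀ i, 0 ≤ α i) (hβ : ∀ i, 0 ≤ β i) (D : ℝ)
    (sα : ∑ i ∈ range L, α i ≤ D) (sβ : ∑ i ∈ range L, β i ≤ D) :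
    ∑ i ∈ range L, ∑ j ∈ range L, ker M q i j * (α i * β j) ^ ((1 + ε) / 2) ≤
      M * (1 + 2 * q / (1 - q)) * D ^ (1 + ε) := by
  have hD : 0 ≤ D := (sum_nonneg fun i _ => hα i).trans sα
  have key : ∀ (γ : ℕ → ℝ), (∀ i, 0 ≤ γ i) → ∑ i ∈ range L, γ i ≤ D →
      ∑ i ∈ range L, γ i ^ (1 + ε) ≤ D ^ (1 + ε) := by
    intro γ hγ sγ
    calc ∑ i ∈ range L, γ i ^ (1 + ε) ≤ ∑ i ∈ range L, γ i * D ^ ε := by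
          refine sum_le_sum fun i hi => ?_
          rw [Real.rpow_add_of_nonneg (hγ i) zero_le_one hε.le, Real.rpow_one]
          have : γ i ≤ D := (single_le_sum (f := γ) (fun j _ => hγ j) hi).trans sγ
          have := Real.rpow_le_rpow (hγ i) this hε.le
          exact mul_le_mul_of_nonneg_left this (hγ i)
      _ ≤ D * D ^ ε := by rw [← sum_mul]; gcongr
      _ = D ^ (1 + ε) := by rw [Real.rpow_add_of_nonneg hD zero_le_one hε.le, Real.rpow_one]
  have amgm : ∀ i j, (α i * β j) ^ ((1 + ε) / 2) ≤ α i ^ (1 + ε) / 2 + β j ^ (1 + ε) / 2 := by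
    intro i j
    rw [Real.mul_rpow (hα i) (hβ j)]
    have e : ∀ z : ℝ, 0 ≤ z → z ^ (1 + ε) = (z ^ ((1 + ε) / 2)) ^ 2 := by
      intro z hz
      rw [← Real.rpow_natCast, ← Real.rpow_mul hz]; congr 1; push_cast; ring
    rw [e _ (hα i), e _ (hβ j)]
    nlinarith [sq_nonneg (α i ^ ((1 + ε) / 2) - β j ^ ((1 + ε) / 2))]
  rw [ker_sum]
  have kα := key α hα sα
  have kβ := key β hβ sβ
  have d1 : ∑ i ∈ range L, (α i * β i) ^ ((1 + ε) / 2) ≤ D ^ (1 + ε) := by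
    calc _ ≤ ∑ i ∈ range L, (α i ^ (1 + ε) / 2 + β i ^ (1 + ε) / 2) :=
          sum_le_sum fun i _ => amgm i i
      _ ≤ _ := by rw [sum_add_distrib, ← sum_div, ← sum_div]; linarith
  have d2 : ∑ i ∈ range L, ∑ j ∈ range L, offk q i j * (α i * β j) ^ ((1 + ε) / 2) ≤
      2 * q / (1 - q) * D ^ (1 + ε) := by
    calc _ ≤ ∑ i ∈ range L, ∑ j ∈ range L, offk q i j * (α i ^ (1 + ε) / 2 + β j ^ (1 + ε) / 2) := by
          refine sum_le_sum fun i _ => sum_le_sum fun j _ => ?_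
          exact mul_le_mul_of_nonneg_left (amgm i j) (offk_nonneg h0 i j)
      _ ≤ _ := schur h0 h1 L (fun i => α i ^ (1 + ε) / 2) (fun i => β i ^ (1 + ε) / 2)
          (fun i => by have := hα i; positivity) (fun i => by have := hβ i; positivity)
      _ ≤ _ := by
          have : 0 ≤ 2 * q / (1 - q) := div_nonneg (by linarith) (by linarith)
          refine mul_le_mul_of_nonneg_left ?_ this
          rw [← sum_div, ← sum_div]; linarith
  have hDp : 0 ≤ D ^ (1 + ε) := by positivity
  nlinarith

lemma concentration {M p ε : ℝ} (hM : 1 ≤ M) (hp : 1 < p) (hε : 0 < ε) (hε1 : ε < 1)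
    (hq : p ^ (-((1 - ε) / 2)) ≤ 1 / 2) (L : ℕ) (α β : ℕ → ℝ) (hα : ∀ i, 0 ≤ α i)
    (hβ : ∀ i, 0 ≤ β i) (sα : ∑ i ∈ range L, α i = 1) (sβ : ∑ i ∈ range L, β i = 1)
    (hZ : 1 < ∑ i ∈ range L, ∑ j ∈ range L,
      ker M (p ^ (-((1 - ε) / 2))) i j * (α i * β j) ^ ((1 + ε) / 2)) :
    ∃ k ∈ range L, 1 - α k ≤ (32 * M / ε) ^ (2 / (1 - ε)) / p ∧
      1 - β k ≤ (32 * M / ε) ^ (2 / (1 - ε)) / p := by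
  set q := p ^ (-((1 - ε) / 2)) with hqdef
  have hq0 : 0 < q := by positivity
  have hne : (range L).Nonempty := by
    by_contra h
    rw [not_nonempty_iff_eq_empty] at h
    rw [h] at sα; simp at sα
  obtain ⟨k, hk, hmax⟩ := exists_max_image (range L) (fun i => α i * β i) hne
  refine ⟨k, hk, ?_⟩
  have lα : ∀ i ∈ range L, α i ≤ 1 := fun i hi => sα ▸ single_le_sum (f := α) (fun j _ => hα j) hi
  have lβ : ∀ i ∈ range L, β i ≤ 1 := fun i hi => sβ ▸ single_le_sum (f := β) (fun j _ => hβ j) hi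
  set Δ := max (1 - α k) (1 - β k) with hΔ
  have hΔ0 : 0 ≤ Δ := le_max_of_le_left (by linarith [lα k hk])
  have hΔ1 : Δ ≤ 1 := max_le (by linarith [hα k]) (by linarith [hβ k])
  have hαΔ : 1 - Δ ≤ α k := by linarith [le_max_left (1 - α k) (1 - β k)]
  have hβΔ : 1 - Δ ≤ β k := by linarith [le_max_right (1 - α k) (1 - β k)]
  suffices hh : Δ ≤ (32 * M / ε) ^ (2 / (1 - ε)) / p from
    ⟨(le_max_left _ _).trans hh, (le_max_right _ _).trans hh⟩
  -- half bound
  have sq : ∀ i j, (α i * β j) ^ ((1:ℝ)/2) ≤ (α i + β j) / 2 := by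
    intro i j
    rw [← Real.sqrt_eq_rpow]
    rw [Real.sqrt_le_left (by have := hα i; have := hβ j; positivity)]
    nlinarith [sq_nonneg (α i - β j)]
  have hprod : α k * β k ≤ 1 - Δ := by
    rcases max_choice (1 - α k) (1 - β k) with h | h
    · have : α k = 1 - Δ := by rw [hΔ, h]; ring
      nlinarith [lβ k hk, hα k, hβ k]
    · have : β k = 1 - Δ := by rw [hΔ, h]; ring
      nlinarith [lα k hk, hα k, hβ k]
  have diag : ∑ i ∈ range L, (α i * β i) ^ ((1 + ε) / 2) ≤ 1 - ε / 2 * Δ := by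
    calc _ ≤ ∑ i ∈ range L, (1 - Δ) ^ (ε / 2) * ((α i + β i) / 2) := by
          refine sum_le_sum fun i hi => ?_
          have h1 : 0 ≤ α i * β i := mul_nonneg (hα i) (hβ i)
          rw [show (1 + ε) / 2 = ε / 2 + 1 / 2 by ring,
            Real.rpow_add_of_nonneg h1 (by linarith) (by norm_num)]
          refine mul_le_mul ?_ (sq i i) (by positivity) (Real.rpow_nonneg (by linarith) _)
          exact Real.rpow_le_rpow h1 ((hmax i hi).trans hprod) (by linarith)
      _ = (1 - Δ) ^ (ε / 2) := by
          rw [← mul_sum, ← sum_div, sum_add_distrib, sα, sβ]; norm_num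
      _ ≤ 1 - ε / 2 * Δ := by
          have := rpow_one_add_le_one_add_mul_self (s := -Δ) (by linarith) (p := ε / 2)
            (by linarith) (by linarith)
          rw [← sub_eq_add_neg] at this
          linarith
  have hΔs : Δ ≤ Δ ^ ((1 + ε) / 2) := by
    conv_lhs => rw [← Real.rpow_one Δ]
    exact Real.rpow_le_rpow_of_exponent_ge' hΔ0 hΔ1 (by linarith) (by linarith)
  set G := Δ ^ ((1 + ε) / 2) with hG
  have hG0 : 0 ≤ G := by positivity
  have restα : ∀ i ∈ range L, i ≠ k → α i ≤ Δ := by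
    intro i hi hik
    have := add_sum_erase (range L) α hk
    have h2 := single_le_sum (f := α) (s := (range L).erase k) (fun j _ => hα j)
      (mem_erase.2 ⟨hik, hi⟩)
    linarith
  have restβ : ∀ i ∈ range L, i ≠ k → β i ≤ Δ := by
    intro i hi hik
    have := add_sum_erase (range L) β hk
    have h2 := single_le_sum (f := β) (s := (range L).erase k) (fun j _ => hβ j)
      (mem_erase.2 ⟨hik, hi⟩)
    linarith
  have off : ∑ i ∈ range L, ∑ j ∈ range L, offk q i j * (α i * β j) ^ ((1 + ε) / 2) ≤
      2 * q / (1 - q) * (4 * G) := by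
    have sumg : ∀ γ : ℕ → ℝ, ∑ i ∈ range L, γ i = 1 → 1 - Δ ≤ γ k →
        ∑ i ∈ range L, (if i = k then G else γ i) ≤ 2 * G := by
      intro γ sγ hγ
      rw [← add_sum_erase _ _ hk, if_pos rfl]
      rw [sum_congr rfl (g := γ) (fun i hi => if_neg (ne_of_mem_erase hi))]
      have := add_sum_erase (range L) γ hk
      linarith
    calc _ ≤ ∑ i ∈ range L, ∑ j ∈ range L, offk q i j *
          ((if i = k then G else α i) + (if j = k then G else β j)) := by
          refine sum_le_sum fun i hi => sum_le_sum fun j hj => ?_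
          by_cases hij : i = j
          · simp [offk, hij]
          refine mul_le_mul_of_nonneg_left ?_ (offk_nonneg hq0.le i j)
          have h1 : 0 ≤ α i * β j := mul_nonneg (hα i) (hβ j)
          by_cases hi' : i = k
          · have hj' : j ≠ k := fun h => hij (hi'.trans h.symm)
            rw [if_pos hi', if_neg hj']
            have : (α i * β j) ^ ((1 + ε) / 2) ≤ G := by
              apply Real.rpow_le_rpow h1 _ (by linarith)
              nlinarith [lα i hi, restβ j hj hj', hβ j]
            linarith [hβ j]
          by_cases hj' : j = k
          · rw [if_neg hi', if_pos hj']
            have : (α i * β j) ^ ((1 + ε) / 2) ≤ G := by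
              apply Real.rpow_le_rpow h1 _ (by linarith)
              nlinarith [lβ j hj, restα i hi hi', hα i]
            linarith [hα i]
          rw [if_neg hi', if_neg hj']
          have h2 : α i * β j ≤ 1 := mul_le_one₀ (lα i hi) (hβ j) (lβ j hj)
          have : (α i * β j) ^ ((1 + ε) / 2) ≤ (α i * β j) ^ ((1:ℝ) / 2) :=
            Real.rpow_le_rpow_of_exponent_ge' h1 h2 (by norm_num) (by linarith)
          linarith [sq i j, hα i, hβ j]
      _ ≤ _ := schur hq0.le (by linarith) L _ _
          (fun i => by split_ifs; exacts [hG0, hα i]) (fun i => by split_ifs; exacts [hG0, hβ i])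
      _ ≤ _ := by
          have : 0 ≤ 2 * q / (1 - q) := div_nonneg (by linarith) (by linarith)
          refine mul_le_mul_of_nonneg_left ?_ this
          linarith [sumg α sα hαΔ, sumg β sβ hβΔ]
  rw [ker_sum] at hZ
  have h4 : 2 * q / (1 - q) ≤ 4 * q := by
    rw [div_le_iff₀ (by linarith)]; nlinarith
  have main : ε / 2 * Δ < 16 * M * q * G := by
    have : 2 * q / (1 - q) * (4 * G) ≤ 16 * q * G := by nlinarith
    nlinarith
  rcases hΔ0.eq_or_lt with h | hpos
  · rw [← h]; positivity
  have hsplit : Δ = G * Δ ^ ((1 - ε) / 2) := by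
    rw [hG, ← Real.rpow_add hpos]; conv_lhs => rw [← Real.rpow_one Δ]
    congr 1; ring
  have hGpos : 0 < G := by positivity
  have hlt : Δ ^ ((1 - ε) / 2) ≤ 32 * M / ε * q := by
    rw [hsplit] at main
    have : ε / 2 * Δ ^ ((1 - ε) / 2) < 16 * M * q := by
      by_contra hc
      push Not at hc
      nlinarith
    rw [div_mul_eq_mul_div, le_div_iff₀ hε]; linarith
  have h5 := Real.rpow_le_rpow (by positivity) hlt (z := 2 / (1 - ε))
    (div_nonneg (by norm_num) (by linarith))
  have hne : (1 - ε) ≠ 0 := by linarith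
  rw [← Real.rpow_mul hΔ0, show (1 - ε) / 2 * (2 / (1 - ε)) = 1 by field_simp, Real.rpow_one,
    Real.mul_rpow (by positivity) hq0.le, hqdef, ← Real.rpow_mul (by linarith),
    show -((1 - ε) / 2) * (2 / (1 - ε)) = -1 by field_simp, Real.rpow_neg_one] at h5
  rwa [div_eq_mul_inv]

end

section
open Finset

section core
variable {α : Type*} 

noncomputable def cf (p i : ℕ) : ℝ := if i = 0 then 1 else 1 - 1 / (p : ℝ)

noncomputable def wt (x : α → ℕ → ℕ) (S : Finset ℕ) (v : α) : ℝ := ∏ p ∈ S, cf p (x v p)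

def InjS (x : α → ℕ → ℕ) (S : Finset ℕ) (V : Finset α) : Prop :=
  ∀ v ∈ V, ∀ v' ∈ V, (∀ p ∈ S, x v p = x v' p) → v = v'

lemma cf_nonneg {p : ℕ} (hp : p.Prime) (i : ℕ) : 0 ≤ cf p i := by
  unfold cf; split_ifs
  · norm_num
  · have : (1:ℝ) ≤ p := by exact_mod_cast hp.one_lt.le
    have : 1 / (p:ℝ) ≤ 1 := by rw [div_le_one (by linarith)]; exact this
    linarith

lemma cf_le_one (p i : ℕ) : cf p i ≤ 1 := by
  unfold cf; split_ifs
  · norm_num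
  · have : 0 ≤ 1 / (p:ℝ) := by positivity
    linarith

lemma cf_pos {p : ℕ} (hp : p.Prime) (i : ℕ) : 0 < cf p i := by
  unfold cf; split_ifs
  · norm_num
  · have : (1:ℝ) < p := by exact_mod_cast hp.one_lt
    have : 1 / (p:ℝ) < 1 := by rw [div_lt_one (by linarith)]; exact this
    linarith

lemma wt_pos {S : Finset ℕ} (hS : ∀ p ∈ S, p.Prime) (x : α → ℕ → ℕ) (v : α) : 0 < wt x S v :=
  prod_pos fun p hp => cf_pos (hS p hp) _

/-- sum over a box -/
lemma box_sum (y : α → ℕ → ℕ) (k : ℕ → ℕ) (g : ℕ → ℕ → ℝ) (S : Finset ℕ)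
    (hg : ∀ p ∈ S, ∀ i, 0 ≤ g p i) : ∀ (V : Finset α), InjS y S V →
    (∀ v ∈ V, ∀ p ∈ S, y v p ≤ k p) →
    ∑ v ∈ V, ∏ p ∈ S, g p (y v p) ≤ ∏ p ∈ S, ∑ i ∈ range (k p + 1), g p i := by
  induction S using Finset.induction_on with
  | empty =>
    intro V hV _
    simp only [prod_empty, sum_const, nsmul_eq_mul, mul_one]
    have : V.card ≤ 1 := card_le_one.2 fun a ha b hb => hV a ha b hb (by simp)
    exact_mod_cast this
  | insert p S hp ih =>
    intro V hV hk
    have hg' : ∀ p ∈ S, ∀ i, 0 ≤ g p i := fun p hp => hg p (mem_insert_of_mem hp)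
    rw [prod_insert hp, sum_mul]
    have hmap : ∀ v ∈ V, y v p ∈ range (k p + 1) := fun v hv => by
      have := hk v hv p (mem_insert_self _ _)
      rw [mem_range]; omega
    rw [← sum_fiberwise_of_maps_to hmap]
    refine sum_le_sum fun i _ => ?_
    calc _ = ∑ v ∈ V with y v p = i, g p i * ∏ p ∈ S, g p (y v p) := by
          refine sum_congr rfl fun v hv => ?_
          rw [prod_insert hp, (mem_filter.1 hv).2]
      _ ≤ _ := by
          rw [← mul_sum]
          refine mul_le_mul_of_nonneg_left (ih hg' _ ?_ ?_) (hg p (mem_insert_self _ _) i)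
          · intro v hv v' hv' h
            rw [mem_filter] at hv hv'
            refine hV v hv.1 v' hv'.1 fun r hr => ?_
            rcases mem_insert.1 hr with rfl | hr
            · rw [hv.2, hv'.2]
            · exact h r hr
          · intro v hv r hr
            exact hk v (mem_filter.1 hv).1 r (mem_insert_of_mem hr)

/-- averages of a multiplicative weight -/
lemma a_sum (h : ℕ → ℝ) (S : Finset ℕ) (hS : ∀ p ∈ S, p.Prime) (hh : ∀ p ∈ S, 0 ≤ h p) :
    ∀ n : ℕ, ∀ A : ℝ, (n : ℝ) ≤ A →
    ∑ a ∈ Icc 1 n, ∏ p ∈ S, (1 + if p ∣ a then h p else 0) ≤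
    A * ∏ p ∈ S, (1 + h p / p) := by
  induction S using Finset.induction_on with
  | empty => intro n A h; simpa using h
  | insert p S hp ih =>
    intro n A hA
    have hS' : ∀ p ∈ S, p.Prime := fun p hp => hS p (mem_insert_of_mem hp)
    have hh' : ∀ p ∈ S, 0 ≤ h p := fun p hp => hh p (mem_insert_of_mem hp)
    have ih := ih hS' hh'
    have hpp := hS p (mem_insert_self _ _)
    have hhp := hh p (mem_insert_self _ _)
    have hp0 : (0:ℝ) < p := by exact_mod_cast hpp.pos
    simp_rw [prod_insert hp, add_mul, one_mul, sum_add_distrib]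
    have e : ∑ a ∈ Icc 1 n, (if p ∣ a then h p else 0) * ∏ q ∈ S, (1 + if q ∣ a then h q else 0)
        = h p * ∑ a ∈ Icc 1 (n / p), ∏ q ∈ S, (1 + if q ∣ a then h q else 0) := by
      simp_rw [ite_mul, zero_mul]
      rw [← sum_filter, mul_sum]
      symm
      refine sum_bij (fun a _ => p * a) ?_ ?_ ?_ ?_
      · intro a ha
        rw [mem_Icc] at ha
        simp only [mem_filter, mem_Icc, dvd_mul_right, and_true]
        refine ⟨Nat.mul_pos hpp.pos ha.1, ?_⟩
        rw [mul_comm]; exact (Nat.le_div_iff_mul_le hpp.pos).1 ha.2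
      · intro a _ b _ hab
        exact Nat.eq_of_mul_eq_mul_left hpp.pos hab
      · intro b hb
        simp only [mem_filter, mem_Icc] at hb
        obtain ⟨c, rfl⟩ := hb.2
        refine ⟨c, ?_, rfl⟩
        rw [mem_Icc]
        refine ⟨Nat.pos_of_ne_zero (by rintro rfl; simp at hb), ?_⟩
        rw [Nat.le_div_iff_mul_le hpp.pos, mul_comm]; exact hb.1.2
      · intro a _
        congr 1
        refine prod_congr rfl fun q hq => ?_
        have : q ∣ p * a ↔ q ∣ a := by
          rw [(hS' q hq).dvd_mul, Nat.prime_dvd_prime_iff_eq (hS' q hq) hpp]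
          refine ⟨fun h => h.resolve_left ?_, Or.inr⟩
          rintro rfl; exact hp hq
        simp [this]
    rw [e]
    have i1 := ih n A hA
    have i2 := ih (n / p) (A / p) (Nat.cast_div_le.trans (by gcongr))
    have := mul_le_mul_of_nonneg_left i2 hhp
    calc _ ≤ A * ∏ p ∈ S, (1 + h p / p) + h p * (A / p * ∏ p ∈ S, (1 + h p / p)) := add_le_add i1 this
      _ = _ := by ring

noncomputable def Bp (τ : Finset ℕ) (B : ℝ) (p : ℕ) : ℝ := if p ∈ τ then B else 1

lemma Bp_one_le {τ : Finset ℕ} {B : ℝ} (hB : 1 ≤ B) (p : ℕ) : 1 ≤ Bp τ B p := by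
  unfold Bp; split_ifs <;> linarith

noncomputable def gf (τ : Finset ℕ) (B : ℝ) (k : ℕ → ℕ) (p i : ℕ) : ℝ :=
  cf p i * ((1 / (p:ℝ)) ^ (k p - i) * if i < k p then Bp τ B p else 1)

lemma gf_sum {τ : Finset ℕ} {B : ℝ} (hB : 1 ≤ B) (k : ℕ → ℕ) {p : ℕ} (hp : p.Prime) :
    ∑ i ∈ range (k p + 1), gf τ B k p i ≤ 1 + (Bp τ B p - 1) / p := by
  have hb := Bp_one_le (τ := τ) hB p
  set b := Bp τ B p with hbdef
  set r : ℝ := 1 / (p:ℝ) with hr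
  have hp0 : (0:ℝ) < p := by exact_mod_cast hp.pos
  have hr0 : 0 ≤ r := by positivity
  unfold gf
  rw [← hbdef]
  generalize k p = K
  rw [sum_range_succ]
  simp only [lt_irrefl, if_false, Nat.sub_self, pow_zero, mul_one]
  rcases Nat.eq_zero_or_pos K with rfl | hK
  · simp [cf]; exact div_nonneg (by linarith) hp0.le
  obtain ⟨m, rfl⟩ : ∃ m, K = m + 1 := ⟨K - 1, by omega⟩
  have : ∀ m : ℕ, ∑ i ∈ range (m+1), cf p i * (r ^ (m + 1 - i) * if i < m + 1 then b else 1) = b * r := by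
    intro m
    induction m with
    | zero => simp [cf]; ring
    | succ m ih =>
      rw [sum_range_succ]
      have e : ∑ i ∈ range (m+1), cf p i * (r ^ (m + 1 + 1 - i) * if i < m + 1 + 1 then b else 1) =
          r * ∑ i ∈ range (m+1), cf p i * (r ^ (m + 1 - i) * if i < m + 1 then b else 1) := by
        rw [mul_sum]
        refine sum_congr rfl fun i hi => ?_
        rw [mem_range] at hi
        rw [if_pos hi, if_pos (by omega), show m + 1 + 1 - i = (m + 1 - i) + 1 by omega, pow_succ]
        ring
      rw [e, ih]
      simp [cf, ← hr]
      ring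
  rw [this]
  simp only [cf, Nat.succ_ne_zero, if_false, ← hr]
  rw [sub_div, show b / p = b * r by rw [hr]; ring]
  linarith

noncomputable def av (x : α → ℕ → ℕ) (k : ℕ → ℕ) (S : Finset ℕ) (v : α) : ℕ :=
  ∏ p ∈ S, p ^ (x v p - k p)
noncomputable def bv (x : α → ℕ → ℕ) (k : ℕ → ℕ) (S : Finset ℕ) (v : α) : ℕ :=
  ∏ p ∈ S, p ^ (k p - x v p)

lemma fact_prod (S : Finset ℕ) (hS : ∀ p ∈ S, p.Prime) (e : ℕ → ℕ) {p : ℕ} (hp : p ∈ S) :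
    (∏ r ∈ S, r ^ e r).factorization p = e p := by
  rw [Nat.factorization_prod (fun r hr => pow_ne_zero _ (hS r hr).ne_zero)]
  rw [Finsupp.finsetSum_apply, sum_eq_single p]
  · rw [(hS p hp).factorization_pow]; simp
  · intro b hb hbp
    rw [(hS b hb).factorization_pow]; simp [hbp]
  · exact fun h => absurd hp h

lemma av_pos {S : Finset ℕ} (hS : ∀ p ∈ S, p.Prime) (x : α → ℕ → ℕ) (k : ℕ → ℕ) (v : α) :
    0 < av x k S v := prod_pos fun p hp => pow_pos (hS p hp).pos _
lemma bv_pos {S : Finset ℕ} (hS : ∀ p ∈ S, p.Prime) (x : α → ℕ → ℕ) (k : ℕ → ℕ) (v : α) :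
    0 < bv x k S v := prod_pos fun p hp => pow_pos (hS p hp).pos _

lemma dvd_av {S : Finset ℕ} (hS : ∀ p ∈ S, p.Prime) (x : α → ℕ → ℕ) (k : ℕ → ℕ) (v : α) {p : ℕ}
    (hp : p ∈ S) : p ∣ av x k S v ↔ k p < x v p := by
  rw [(hS p hp).dvd_iff_one_le_factorization (av_pos hS x k v).ne', av,
    fact_prod S hS (fun p => x v p - k p) hp]
  omega

/-- the counting lemma -/
lemma counting {S τ : Finset ℕ} (hS : ∀ p ∈ S, p.Prime) (x : α → ℕ → ℕ) (k : ℕ → ℕ) {B : ℝ}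
    (hB : 1 ≤ B) (V : Finset α) (hV : InjS x S V) (A : ℝ) (hA : 0 ≤ A)
    (hVA : ∀ v ∈ V, (av x k S v : ℝ) ≤ A) :
    ∑ v ∈ V, 1 / (bv x k S v : ℝ) * wt x S v * B ^ (#{p ∈ S | p ∈ τ ∧ x v p ≠ k p}) ≤
      A * (∏ p ∈ S, (1 + (Bp τ B p - 1) / p)) ^ 2 := by
  have hmap : ∀ v ∈ V, av x k S v ∈ Icc 1 ⌊A⌋₊ := fun v hv => by
    rw [mem_Icc]; exact ⟨av_pos hS x k v, Nat.le_floor (hVA v hv)⟩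
  rw [← sum_fiberwise_of_maps_to hmap]
  have hgnn : ∀ p ∈ S, ∀ i, 0 ≤ gf τ B k p i := by
    intro p hp i
    unfold gf
    have := cf_nonneg (hS p hp) i
    have := Bp_one_le (τ := τ) hB p
    split_ifs <;> positivity
  set P := ∏ p ∈ S, (1 + (Bp τ B p - 1) / p) with hP
  have hbox : ∏ p ∈ S, ∑ i ∈ range (k p + 1), gf τ B k p i ≤ P :=
    prod_le_prod (fun p hp => sum_nonneg fun i _ => hgnn p hp i) fun p hp => gf_sum hB k (hS p hp)
  have hP0 : 0 ≤ P := prod_nonneg fun p hp => by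
    have := Bp_one_le (τ := τ) hB p
    have : 0 ≤ (Bp τ B p - 1) / p := div_nonneg (by linarith) (by positivity)
    linarith
  have inner : ∀ a ∈ Icc 1 ⌊A⌋₊, ∑ v ∈ V with av x k S v = a,
      1 / (bv x k S v : ℝ) * wt x S v * B ^ (#{p ∈ S | p ∈ τ ∧ x v p ≠ k p}) ≤
      (∏ p ∈ S, (1 + if p ∣ a then (Bp τ B p - 1) else 0)) * P := by
    intro a _
    set F := ∏ p ∈ S, (1 + if p ∣ a then (Bp τ B p - 1) else 0) with hF
    have hF0 : 0 ≤ F := prod_nonneg fun p hp => by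
      have := Bp_one_le (τ := τ) hB p
      split_ifs <;> linarith
    calc _ ≤ ∑ v ∈ V with av x k S v = a, F * ∏ p ∈ S, gf τ B k p (min (x v p) (k p)) := by
          refine sum_le_sum fun v hv => ?_
          rw [mem_filter] at hv
          rw [hF, ← prod_mul_distrib, wt, bv, card_filter, ← prod_pow_eq_pow_sum]
          push_cast
          rw [one_div, ← prod_inv_distrib, ← prod_mul_distrib, ← prod_mul_distrib]
          refine prod_le_prod ?_ ?_
          · intro p hp
            have := cf_nonneg (hS p hp) (x v p)
            positivity
          · intro p hp
            have hd := dvd_av hS x k v hp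
            rw [hv.2] at hd
            have hb := Bp_one_le (τ := τ) hB p
            have hpow : B ^ (if p ∈ τ ∧ x v p ≠ k p then 1 else 0) =
                if x v p ≠ k p then Bp τ B p else 1 := by
              unfold Bp
              by_cases h1 : p ∈ τ <;> by_cases h2 : x v p = k p <;> simp [h1, h2]
            rw [hpow]
            have hc0 := cf_nonneg (hS p hp) (x v p)
            rcases lt_trichotomy (x v p) (k p) with h | h | h
            · have : ¬ p ∣ a := by rw [hd]; omega
              rw [if_neg this, min_eq_left h.le, if_pos h.ne, gf, if_pos h]
              simp only [one_div, inv_pow]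
              apply le_of_eq; ring
            · have : ¬ p ∣ a := by rw [hd]; omega
              rw [if_neg this, h]
              simp [gf]
            · have h3 : p ∣ a := by rw [hd]; omega
              rw [if_pos h3, if_pos h.ne', min_eq_right h.le]
              have : k p - x v p = 0 := by omega
              rw [this]
              simp only [gf, Nat.sub_self, lt_irrefl, if_false, pow_zero, inv_one, one_mul, mul_one]
              have : cf p (x v p) ≤ cf p (k p) := by
                by_cases hk : k p = 0
                · rw [hk]; simpa [cf] using cf_le_one p (x v p)
                · simp [cf, hk, show x v p ≠ 0 by omega]
              have := cf_nonneg (hS p hp) (k p)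
              nlinarith
      _ ≤ _ := by
          rw [← mul_sum]
          refine mul_le_mul_of_nonneg_left (le_trans ?_ hbox) hF0
          refine box_sum (fun v p => min (x v p) (k p)) k _ S hgnn _ ?_ ?_
          · intro v hv v' hv' h
            rw [mem_filter] at hv hv'
            refine hV v hv.1 v' hv'.1 fun p hp => ?_
            have h1 := h p hp
            have h2 := fact_prod S hS (fun p => x v p - k p) hp
            have h3 := fact_prod S hS (fun p => x v' p - k p) hp
            have h4 : av x k S v = av x k S v' := hv.2.trans hv'.2.symm
            unfold av at h4
            rw [h4, h3] at h2
            simp only at h1 h2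
            omega
          · intro v _ p _; exact min_le_right _ _
  calc _ ≤ ∑ a ∈ Icc 1 ⌊A⌋₊, (∏ p ∈ S, (1 + if p ∣ a then (Bp τ B p - 1) else 0)) * P :=
        sum_le_sum inner
    _ ≤ (A * P) * P := by
        rw [← sum_mul]
        refine mul_le_mul_of_nonneg_right ?_ hP0
        exact a_sum (fun p => Bp τ B p - 1) S hS
          (fun p _ => by have := Bp_one_le (τ := τ) hB p; linarith) _ A (Nat.floor_le hA)
    _ = _ := by ring

end core

end

section
open Finset

section core2
variable {α : Type*} [DecidableEq α]

/-- all hypotheses on an edge set -/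
def EdgeHyp (x : α → ℕ → ℕ) (S : Finset ℕ) (ψ θ : α → ℝ) (E : Finset (α × α)) : Prop :=
  ∀ e ∈ E, ψ e.1 * ∏ p ∈ S, (p:ℝ) ^ (x e.2 p - x e.1 p) ≤ 1 ∧
    θ e.2 * ∏ p ∈ S, (p:ℝ) ^ (x e.1 p - x e.2 p) ≤ 1

lemma edge_sum_right (V W : Finset α) (E : Finset (α × α)) (hE : E ⊆ V ×ˢ W) (m n : α → ℝ) (Y : ℝ)
    (hn : ∀ w, 0 ≤ n w)
    (h : ∀ w ∈ W, ∑ v ∈ V with (v, w) ∈ E, m v ≤ Y) :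
    ∑ e ∈ E, m e.1 * n e.2 ≤ Y * ∑ w ∈ W, n w := by
  have : ∑ e ∈ E, m e.1 * n e.2 = ∑ w ∈ W, ∑ v ∈ V with (v, w) ∈ E, m v * n w := by
    rw [sum_finset_product_right (s := W) (t := fun w => {v ∈ V | (v, w) ∈ E})]
    rintro ⟨v, w⟩
    simp only [mem_filter]
    constructor
    · intro h
      have := mem_product.1 (hE h)
      exact ⟨this.2, this.1, h⟩
    · exact fun h => h.2.2
  rw [this, mul_sum]
  refine sum_le_sum fun w hw => ?_
  rw [← sum_mul]
  exact mul_le_mul_of_nonneg_right (h w hw) (hn w)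

lemma edge_sum_left (V W : Finset α) (E : Finset (α × α)) (hE : E ⊆ V ×ˢ W) (m n : α → ℝ) (Y : ℝ)
    (hm : ∀ w, 0 ≤ m w)
    (h : ∀ v ∈ V, ∑ w ∈ W with (v, w) ∈ E, n w ≤ Y) :
    ∑ e ∈ E, m e.1 * n e.2 ≤ Y * ∑ v ∈ V, m v := by
  have : ∑ e ∈ E, m e.1 * n e.2 = ∑ v ∈ V, ∑ w ∈ W with (v, w) ∈ E, m v * n w := by
    rw [sum_finset_product (s := V) (t := fun v => {w ∈ W | (v, w) ∈ E})]
    rintro ⟨v, w⟩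
    simp only [mem_filter]
    constructor
    · intro h
      have := mem_product.1 (hE h)
      exact ⟨this.1, this.2, h⟩
    · exact fun h => h.2.2
  rw [this, mul_sum]
  refine sum_le_sum fun v hv => ?_
  rw [← mul_sum, mul_comm]
  exact mul_le_mul_of_nonneg_right (h v hv) (hm v)

lemma InjS.mono {x : α → ℕ → ℕ} {S : Finset ℕ} {V V' : Finset α} (h : InjS x S V) (hs : V' ⊆ V) :
    InjS x S V' := fun v hv v' hv' => h v (hs hv) v' (hs hv')

lemma half_bound {S τ : Finset ℕ} (hS : ∀ p ∈ S, p.Prime) (x : α → ℕ → ℕ) (k : ℕ → ℕ) {D R : ℝ}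
    (hD : 1 ≤ D) (hR : (∏ p ∈ S, (1 + (Bp τ (D ^ 4) p - 1) / p)) ^ 2 ≤ R)
    (V W : Finset α) (hV : InjS x S V) (hW : InjS x S W) (ψ θ : α → ℝ) (hψ : ∀ v, 0 ≤ ψ v)
    (hθ : ∀ v, 0 ≤ θ v) (E : Finset (α × α)) (hE : E ⊆ V ×ˢ W) (hyp : EdgeHyp x S ψ θ E)
    (good : ∀ e ∈ E, ∀ p ∈ S, x e.1 p = k p ∨ x e.2 p = k p) (n : ℕ)
    (hn : ∀ e ∈ E, n ≤ 2 * #{p ∈ S | p ∈ τ ∧ x e.1 p ≠ k p})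
    (hμ : 0 < ∑ v ∈ V, ψ v * wt x S v) (hν : 0 < ∑ w ∈ W, θ w * wt x S w) :
    ∑ e ∈ E, (ψ e.1 * wt x S e.1) * (θ e.2 * wt x S e.2) ≤
      2 * R * (D⁻¹) ^ n * √((∑ v ∈ V, ψ v * wt x S v) * ∑ w ∈ W, θ w * wt x S w) := by
  set μ := ∑ v ∈ V, ψ v * wt x S v
  set ν := ∑ w ∈ W, θ w * wt x S w
  have hB : 1 ≤ D ^ 4 := one_le_pow₀ hD
  have hDn : 0 < D ^ n := by positivity
  have bc : ∀ e ∈ E, ∏ p ∈ S, (p:ℝ) ^ (x e.2 p - x e.1 p) = (bv x k S e.1 : ℝ) * av x k S e.2 := by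
    intro e he
    unfold av bv; push_cast
    rw [← prod_mul_distrib]
    refine prod_congr rfl fun p hp => ?_
    rw [← pow_add]; congr 1
    rcases good e he p hp with h | h <;> omega
  have ad : ∀ e ∈ E, ∏ p ∈ S, (p:ℝ) ^ (x e.1 p - x e.2 p) = (av x k S e.1 : ℝ) * bv x k S e.2 := by
    intro e he
    unfold av bv; push_cast
    rw [← prod_mul_distrib]
    refine prod_congr rfl fun p hp => ?_
    rw [← pow_add]; congr 1
    rcases good e he p hp with h | h <;> omega
  have apos : ∀ v, (0:ℝ) < av x k S v := fun v => by exact_mod_cast av_pos hS x k v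
  have bpos : ∀ v, (0:ℝ) < bv x k S v := fun v => by exact_mod_cast bv_pos hS x k v
  have wpos : ∀ v, 0 < wt x S v := fun v => wt_pos hS x v
  set l : ℝ := D ^ n * √(μ / ν) with hl
  have hl0 : 0 < l := by positivity
  -- split
  rw [← sum_filter_add_sum_filter_not E (fun e => (av x k S e.1 : ℝ) ≤ l * av x k S e.2)]
  have p1 : ∑ e ∈ E with (av x k S e.1 : ℝ) ≤ l * av x k S e.2,
      (ψ e.1 * wt x S e.1) * (θ e.2 * wt x S e.2) ≤ (l * (D⁻¹) ^ (2 * n) * R) * ν := by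
    refine edge_sum_right V W _ ((filter_subset _ _).trans hE) (fun v => ψ v * wt x S v)
      (fun v => θ v * wt x S v) _ (fun w => mul_nonneg (hθ w) (wpos w).le) ?_
    intro w hw
    have hc := counting (τ := τ) hS x k hB
      {v ∈ V | (v, w) ∈ E.filter (fun e => (av x k S e.1 : ℝ) ≤ l * av x k S e.2)}
      (hV.mono (filter_subset _ _)) (l * av x k S w) (mul_pos hl0 (apos w)).le
      (by
        intro v hv
        simp only [mem_filter] at hv
        exact hv.2.2)
    have hc2 := hc.trans (mul_le_mul_of_nonneg_left hR (mul_pos hl0 (apos w)).le)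
    calc _ ≤ ∑ v ∈ V with (v, w) ∈ E.filter (fun e => (av x k S e.1 : ℝ) ≤ l * av x k S e.2),
          (1 / (av x k S w : ℝ) * (D⁻¹) ^ (2 * n)) * (1 / (bv x k S v : ℝ) * wt x S v *
            (D ^ 4) ^ (#{p ∈ S | p ∈ τ ∧ x v p ≠ k p})) := by
          refine sum_le_sum fun v hv => ?_
          simp only [mem_filter] at hv
          have h1 := (hyp _ hv.2.1).1
          rw [bc _ hv.2.1] at h1
          simp only at h1
          have h2 : ψ v ≤ 1 / (av x k S w : ℝ) * (1 / (bv x k S v : ℝ)) := by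
            rw [one_div_mul_one_div, le_div_iff₀ (mul_pos (apos w) (bpos v))]
            linarith [mul_comm (av x k S w : ℝ) (bv x k S v)]
          have h3 : 1 ≤ (D⁻¹) ^ (2 * n) * (D ^ 4) ^ (#{p ∈ S | p ∈ τ ∧ x v p ≠ k p}) := by
            rw [inv_pow, ← pow_mul, inv_mul_eq_div, one_le_div (by positivity)]
            have := hn _ hv.2.1
            exact pow_le_pow_right₀ hD (by simp only at this; omega)
          have hx : 0 ≤ 1 / (av x k S w : ℝ) * (1 / (bv x k S v : ℝ)) * wt x S v := by
            have := apos w; have := bpos v; have := wpos v; positivity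
          calc ψ v * wt x S v ≤ 1 / (av x k S w : ℝ) * (1 / (bv x k S v : ℝ)) * wt x S v :=
                mul_le_mul_of_nonneg_right h2 (wpos v).le
            _ ≤ 1 / (av x k S w : ℝ) * (1 / (bv x k S v : ℝ)) * wt x S v *
              ((D⁻¹) ^ (2 * n) * (D ^ 4) ^ (#{p ∈ S | p ∈ τ ∧ x v p ≠ k p})) :=
                le_mul_of_one_le_right hx h3
            _ = _ := by ring
      _ ≤ (1 / (av x k S w : ℝ) * (D⁻¹) ^ (2 * n)) * (l * av x k S w * R) := by
          rw [← mul_sum]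
          have := apos w
          exact mul_le_mul_of_nonneg_left hc2 (by positivity)
      _ = _ := by have := (apos w).ne'; field_simp
  have p2 : ∑ e ∈ E with ¬ (av x k S e.1 : ℝ) ≤ l * av x k S e.2,
      (ψ e.1 * wt x S e.1) * (θ e.2 * wt x S e.2) ≤ (1 / l * R) * μ := by
    refine edge_sum_left V W _ ((filter_subset _ _).trans hE) (fun v => ψ v * wt x S v)
      (fun v => θ v * wt x S v) _ (fun w => mul_nonneg (hψ w) (wpos w).le) ?_
    intro v hv
    have hc := counting (τ := τ) hS x k hB
      {w ∈ W | (v, w) ∈ E.filter (fun e => ¬ (av x k S e.1 : ℝ) ≤ l * av x k S e.2)}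
      (hW.mono (filter_subset _ _)) (av x k S v / l) (div_pos (apos v) hl0).le
      (by
        intro w hw
        simp only [mem_filter, not_le] at hw
        rw [le_div_iff₀ hl0]
        linarith [hw.2.2])
    have hc2 := hc.trans (mul_le_mul_of_nonneg_left hR (div_pos (apos v) hl0).le)
    calc _ ≤ ∑ w ∈ W with (v, w) ∈ E.filter (fun e => ¬ (av x k S e.1 : ℝ) ≤ l * av x k S e.2),
          (1 / (av x k S v : ℝ)) * (1 / (bv x k S w : ℝ) * wt x S w *
            (D ^ 4) ^ (#{p ∈ S | p ∈ τ ∧ x w p ≠ k p})) := by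
          refine sum_le_sum fun w hw => ?_
          simp only [mem_filter] at hw
          have h1 := (hyp _ hw.2.1).2
          rw [ad _ hw.2.1] at h1
          simp only at h1
          have h2 : θ w ≤ 1 / (av x k S v : ℝ) * (1 / (bv x k S w : ℝ)) := by
            rw [one_div_mul_one_div, le_div_iff₀ (mul_pos (apos v) (bpos w))]
            exact h1
          have h3 : 1 ≤ (D ^ 4) ^ (#{p ∈ S | p ∈ τ ∧ x w p ≠ k p}) := one_le_pow₀ hB
          have hx : 0 ≤ 1 / (av x k S v : ℝ) * (1 / (bv x k S w : ℝ)) * wt x S w := by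
            have := apos v; have := bpos w; have := wpos w; positivity
          calc θ w * wt x S w ≤ 1 / (av x k S v : ℝ) * (1 / (bv x k S w : ℝ)) * wt x S w :=
                mul_le_mul_of_nonneg_right h2 (wpos w).le
            _ ≤ 1 / (av x k S v : ℝ) * (1 / (bv x k S w : ℝ)) * wt x S w *
              ((D ^ 4) ^ (#{p ∈ S | p ∈ τ ∧ x w p ≠ k p})) :=
                le_mul_of_one_le_right hx h3
            _ = _ := by ring
      _ ≤ (1 / (av x k S v : ℝ)) * (av x k S v / l * R) := by
          rw [← mul_sum]
          have := apos v
          exact mul_le_mul_of_nonneg_left hc2 (by positivity)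
      _ = _ := by have := (apos v).ne'; field_simp
  refine (add_le_add p1 p2).trans (le_of_eq ?_)
  have e1 : √(μ / ν) * ν = √(μ * ν) := by
    rw [Real.sqrt_div hμ.le, Real.sqrt_mul hμ.le]
    have := Real.mul_self_sqrt hν.le
    have h0 : √ν ≠ 0 := by positivity
    rw [div_mul_eq_mul_div, div_eq_iff h0, mul_assoc, this]
  have e2 : μ / √(μ / ν) = √(μ * ν) := by
    rw [div_eq_iff (by positivity), ← Real.sqrt_mul (by positivity)]
    rw [show μ * ν * (μ / ν) = μ * μ by field_simp, Real.sqrt_mul_self hμ.le]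
  calc l * D⁻¹ ^ (2 * n) * R * ν + 1 / l * R * μ
      = R * (D ^ n * D⁻¹ ^ (2 * n)) * (√(μ / ν) * ν) + R * (D ^ n)⁻¹ * (μ / √(μ / ν)) := by
        rw [hl]; field_simp
    _ = _ := by
        rw [e1, e2, two_mul n, pow_add]
        rw [show D ^ n * (D⁻¹ ^ n * D⁻¹ ^ n) = D⁻¹ ^ n by
          rw [inv_pow, ← mul_assoc, mul_inv_cancel₀ hDn.ne', one_mul]]
        rw [inv_pow]; ring

lemma good_bound {S τ : Finset ℕ} (hS : ∀ p ∈ S, p.Prime) (x : α → ℕ → ℕ) (k : ℕ → ℕ) {D R : ℝ}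
    (hD : 1 ≤ D) (hR : (∏ p ∈ S, (1 + (Bp τ (D ^ 4) p - 1) / p)) ^ 2 ≤ R)
    (V W : Finset α) (hV : InjS x S V) (hW : InjS x S W) (ψ θ : α → ℝ) (hψ : ∀ v, 0 ≤ ψ v)
    (hθ : ∀ v, 0 ≤ θ v) (E : Finset (α × α)) (hE : E ⊆ V ×ˢ W) (hyp : EdgeHyp x S ψ θ E)
    (good : ∀ e ∈ E, ∀ p ∈ S, x e.1 p = k p ∨ x e.2 p = k p) (n : ℕ)
    (hn : ∀ e ∈ E, n ≤ #{p ∈ S | p ∈ τ ∧ x e.1 p ≠ x e.2 p})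
    (hμ : 0 < ∑ v ∈ V, ψ v * wt x S v) (hν : 0 < ∑ w ∈ W, θ w * wt x S w) :
    ∑ e ∈ E, (ψ e.1 * wt x S e.1) * (θ e.2 * wt x S e.2) ≤
      4 * R * (D⁻¹) ^ n * √((∑ v ∈ V, ψ v * wt x S v) * ∑ w ∈ W, θ w * wt x S w) := by
  have hn' : ∀ e ∈ E, n ≤ #{p ∈ S | p ∈ τ ∧ x e.1 p ≠ k p} + #{p ∈ S | p ∈ τ ∧ x e.2 p ≠ k p} := by
    intro e he
    refine (hn e he).trans ((card_le_card ?_).trans (card_union_le _ _))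
    intro p hp
    simp only [mem_filter, mem_union] at hp ⊢
    by_cases h : x e.1 p = k p
    · right; exact ⟨hp.1, hp.2.1, fun h2 => hp.2.2 (h.trans h2.symm)⟩
    · left; exact ⟨hp.1, hp.2.1, h⟩
  rw [← sum_filter_add_sum_filter_not E (fun e => n ≤ 2 * #{p ∈ S | p ∈ τ ∧ x e.1 p ≠ k p})]
  have p1 := half_bound hS x k hD hR V W hV hW ψ θ hψ hθ
    (E.filter (fun e => n ≤ 2 * #{p ∈ S | p ∈ τ ∧ x e.1 p ≠ k p})) ((filter_subset _ _).trans hE)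
    (fun e he => hyp e (mem_filter.1 he).1) (fun e he => good e (mem_filter.1 he).1) n
    (fun e he => (mem_filter.1 he).2) hμ hν
  set E2 := E.filter (fun e => ¬ n ≤ 2 * #{p ∈ S | p ∈ τ ∧ x e.1 p ≠ k p}) with hE2
  have mem2 : ∀ e ∈ E2.map (Equiv.prodComm α α).toEmbedding, e.swap ∈ E2 := by
    intro e he
    simp only [mem_map_equiv] at he
    exact he
  have sub2 : E2 ⊆ E := filter_subset _ _
  have p2 := half_bound hS x k hD hR W V hW hV θ ψ hθ hψ
    (E2.map (Equiv.prodComm α α).toEmbedding)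
    (fun e he => by
      have := mem_product.1 (hE (sub2 (mem2 e he)))
      exact mem_product.2 ⟨this.2, this.1⟩)
    (fun e he => (hyp _ (sub2 (mem2 e he))).symm)
    (fun e he p hp => (good _ (sub2 (mem2 e he)) p hp).symm) n
    (fun e he => by
      have h1 := hn' _ (sub2 (mem2 e he))
      have h2 := (mem_filter.1 (mem2 e he)).2
      simp only [Prod.fst_swap, Prod.snd_swap] at h1 h2
      omega) hν hμ
  rw [sum_map] at p2
  simp only [Equiv.coe_toEmbedding, Equiv.prodComm_apply, Prod.fst_swap, Prod.snd_swap] at p2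
  have e : ∑ e ∈ E2, (ψ e.1 * wt x S e.1) * (θ e.2 * wt x S e.2) =
      ∑ e ∈ E2, (θ e.2 * wt x S e.2) * (ψ e.1 * wt x S e.1) :=
    sum_congr rfl fun e _ => mul_comm _ _
  rw [e]
  rw [mul_comm (∑ w ∈ W, _)] at p2
  linarith

lemma good_bound' {S τ : Finset ℕ} (hS : ∀ p ∈ S, p.Prime) (x : α → ℕ → ℕ) (k : ℕ → ℕ) {D R ε : ℝ}
    (hε : 0 < ε) (hε1 : ε < 1) (hR1 : 1 ≤ R)
    (hD : 1 ≤ D) (hR : (∏ p ∈ S, (1 + (Bp τ (D ^ 4) p - 1) / p)) ^ 2 ≤ R)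
    (V W : Finset α) (hV : InjS x S V) (hW : InjS x S W) (ψ θ : α → ℝ) (hψ : ∀ v, 0 ≤ ψ v)
    (hθ : ∀ v, 0 ≤ θ v) (E : Finset (α × α)) (hE : E ⊆ V ×ˢ W) (hyp : EdgeHyp x S ψ θ E)
    (good : ∀ e ∈ E, ∀ p ∈ S, x e.1 p = k p ∨ x e.2 p = k p) (n : ℕ)
    (hn : ∀ e ∈ E, n ≤ #{p ∈ S | p ∈ τ ∧ x e.1 p ≠ x e.2 p})
    (hμ : 0 < ∑ v ∈ V, ψ v * wt x S v) (hν : 0 < ∑ w ∈ W, θ w * wt x S w) :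
    ∑ e ∈ E, (ψ e.1 * wt x S e.1) * (θ e.2 * wt x S e.2) ≤
      4 * ((D ^ (1 - ε))⁻¹) ^ n * R *
      ((∑ v ∈ V, ψ v * wt x S v) * ∑ w ∈ W, θ w * wt x S w) ^ ((1 + ε) / 2) := by
  have h1 := good_bound hS x k hD hR V W hV hW ψ θ hψ hθ E hE hyp good n hn hμ hν
  have wpos : ∀ v, 0 < wt x S v := fun v => wt_pos hS x v
  have h2 : ∑ e ∈ E, (ψ e.1 * wt x S e.1) * (θ e.2 * wt x S e.2) ≤
      (∑ v ∈ V, ψ v * wt x S v) * ∑ w ∈ W, θ w * wt x S w := by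
    rw [sum_mul_sum, ← sum_product']
    refine sum_le_sum_of_subset_of_nonneg hE fun e _ _ => ?_
    have := hψ e.1; have := hθ e.2; have := wpos e.1; have := wpos e.2; positivity
  have h0 : 0 ≤ ∑ e ∈ E, (ψ e.1 * wt x S e.1) * (θ e.2 * wt x S e.2) := by
    refine sum_nonneg fun e _ => ?_
    have := hψ e.1; have := hθ e.2; have := wpos e.1; have := wpos e.2; positivity
  set T := ∑ e ∈ E, (ψ e.1 * wt x S e.1) * (θ e.2 * wt x S e.2)
  set X := (∑ v ∈ V, ψ v * wt x S v) * ∑ w ∈ W, θ w * wt x S w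
  have hX : 0 < X := mul_pos hμ hν
  calc T = T ^ (1 - ε) * T ^ ε := by
        rw [← Real.rpow_add_of_nonneg h0 (by linarith) hε.le]; simp
    _ ≤ (4 * R * (D⁻¹) ^ n * √X) ^ (1 - ε) * X ^ ε := by
        gcongr
    _ = (4 * R) ^ (1 - ε) * ((D ^ (1 - ε))⁻¹) ^ n * X ^ ((1 + ε) / 2) := by
        rw [Real.mul_rpow (by positivity) (by positivity), Real.mul_rpow (by positivity) (by positivity)]
        rw [Real.sqrt_eq_rpow, ← Real.rpow_mul hX.le, mul_assoc _ (X ^ _), ← Real.rpow_add hX]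
        congr 2
        · rw [← Real.rpow_natCast, ← Real.rpow_mul (by positivity), mul_comm (n:ℝ), Real.rpow_mul (by positivity),
            Real.rpow_natCast, Real.inv_rpow (by positivity)]
        · ring
    _ ≤ (4 * R) * ((D ^ (1 - ε))⁻¹) ^ n * X ^ ((1 + ε) / 2) := by
        gcongr
        conv_rhs => rw [← Real.rpow_one (4 * R)]
        exact Real.rpow_le_rpow_of_exponent_le (by linarith) (by linarith)
    _ = _ := by ring

end core2

end

section
open Finset

section core3
variable {α : Type*} [DecidableEq α]

def Bound (x : α → ℕ → ℕ) (τ : Finset ℕ) (M R ε : ℝ) (S : Finset ℕ) (K : ℝ) : Prop :=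
  ∀ V W : Finset α, InjS x S V → InjS x S W → ∀ ψ θ : α → ℝ, (∀ v, 0 ≤ ψ v) → (∀ v, 0 ≤ θ v) →
  ∀ E : Finset (α × α), E ⊆ V ×ˢ W → EdgeHyp x S ψ θ E → ∀ n : ℕ,
  (∀ e ∈ E, n ≤ #{p ∈ S | p ∈ τ ∧ x e.1 p ≠ x e.2 p}) →
  ∑ e ∈ E, (ψ e.1 * wt x S e.1) * (θ e.2 * wt x S e.2) ≤
      K * (M⁻¹) ^ n * R *
      ((∑ v ∈ V, ψ v * wt x S v) * ∑ w ∈ W, θ w * wt x S w) ^ ((1 + ε) / 2)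

lemma ker_eq (M q : ℝ) (i j : ℕ) :
    ker M q i j = (if i = j then 1 else M) * q ^ ((i - j) + (j - i)) := by
  unfold ker offk
  by_cases h : i = j <;> simp [h]

lemma step (x : α → ℕ → ℕ) (τ : Finset ℕ) {M R ε K : ℝ} {S : Finset ℕ} (hS : ∀ p ∈ S, p.Prime)
    (hM : 1 ≤ M) (hR : 0 ≤ R) (hK : 0 ≤ K) (hε : 0 < ε) (hε1 : ε < 1) {p : ℕ} (hp : p ∈ S)
    (ih : Bound x τ M R ε (S.erase p) K)
    (V W : Finset α) (hV : InjS x S V) (hW : InjS x S W) (ψ θ : α → ℝ) (hψ : ∀ v, 0 ≤ ψ v)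
    (hθ : ∀ v, 0 ≤ θ v) (E : Finset (α × α)) (hE : E ⊆ V ×ˢ W) (hyp : EdgeHyp x S ψ θ E) (n : ℕ)
    (hn : ∀ e ∈ E, n ≤ #{p ∈ S | p ∈ τ ∧ x e.1 p ≠ x e.2 p}) (L : ℕ)
    (hLV : ∀ v ∈ V, x v p < L) (hLW : ∀ v ∈ W, x v p < L) :
    ∑ e ∈ E, (ψ e.1 * wt x S e.1) * (θ e.2 * wt x S e.2) ≤
      K * (M⁻¹) ^ n * R * ∑ i ∈ range L, ∑ j ∈ range L,
        ker M ((p:ℝ) ^ (-((1 - ε) / 2))) i j *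
        ((∑ v ∈ V with x v p = i, ψ v * wt x S v) *
          ∑ w ∈ W with x w p = j, θ w * wt x S w) ^ ((1 + ε) / 2) := by
  have hpp := hS p hp
  have hp1 : (1:ℝ) < p := by exact_mod_cast hpp.one_lt
  have hm1 : ∀ e ∈ E, x e.1 p ∈ range L := fun e he =>
    mem_range.2 (hLV _ (mem_product.1 (hE he)).1)
  have hm2 : ∀ i, ∀ e ∈ E.filter (fun e => x e.1 p = i), x e.2 p ∈ range L := fun i e he =>
    mem_range.2 (hLW _ (mem_product.1 (hE (mem_filter.1 he).1)).2)
  rw [← sum_fiberwise_of_maps_to hm1, mul_sum]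
  refine sum_le_sum fun i _ => ?_
  rw [← sum_fiberwise_of_maps_to (hm2 i), mul_sum]
  refine sum_le_sum fun j _ => ?_
  set E' := {e ∈ {e ∈ E | x e.1 p = i} | x e.2 p = j} with hE'
  have memE' : ∀ e ∈ E', e ∈ E ∧ x e.1 p = i ∧ x e.2 p = j := by
    intro e he
    simp only [hE', mem_filter] at he
    exact ⟨he.1.1, he.1.2, he.2⟩
  set V' := {v ∈ V | x v p = i} with hV'
  set W' := {v ∈ W | x v p = j} with hW'
  set n' := if i = j then n else n - 1 with hn'
  have inj : ∀ (U : Finset α) (i : ℕ), InjS x S U → InjS x (S.erase p) {v ∈ U | x v p = i} := by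
    intro U i hU v hv v' hv' h
    rw [mem_filter] at hv hv'
    refine hU v hv.1 v' hv'.1 fun r hr => ?_
    by_cases hrp : r = p
    · rw [hrp, hv.2, hv'.2]
    · exact h r (mem_erase.2 ⟨hrp, hr⟩)
  have hci := cf_pos hpp i
  have hcj := cf_pos hpp j
  have wtS : ∀ v, wt x S v = cf p (x v p) * wt x (S.erase p) v := fun v =>
    (mul_prod_erase S (fun p => cf p (x v p)) hp).symm
  have key := ih V' W' (inj V i hV) (inj W j hW) (fun v => (p:ℝ) ^ (j - i) * ψ v)
    (fun v => (p:ℝ) ^ (i - j) * θ v) (fun v => mul_nonneg (by positivity) (hψ v))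
    (fun v => mul_nonneg (by positivity) (hθ v)) E'
    (by
      intro e he
      obtain ⟨h1, h2, h3⟩ := memE' e he
      have := mem_product.1 (hE h1)
      exact mem_product.2 ⟨mem_filter.2 ⟨this.1, h2⟩, mem_filter.2 ⟨this.2, h3⟩⟩)
    (by
      intro e he
      obtain ⟨h1, h2, h3⟩ := memE' e he
      have := hyp e h1
      rw [← mul_prod_erase S _ hp, ← mul_prod_erase S _ hp, h2, h3] at this
      constructor
      · refine le_trans (le_of_eq ?_) this.1; ring
      · refine le_trans (le_of_eq ?_) this.2; ring)
    n'
    (by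
      intro e he
      obtain ⟨h1, h2, h3⟩ := memE' e he
      have h4 := hn e h1
      rw [filter_erase]
      by_cases hij : i = j
      · rw [erase_eq_of_notMem]
        · rw [hn', if_pos hij]; exact h4
        · simp [h2, h3, hij]
      · rw [hn', if_neg hij]
        have := pred_card_le_card_erase (s := {p ∈ S | p ∈ τ ∧ x e.1 p ≠ x e.2 p}) (a := p)
        omega)
  set T := ∑ e ∈ E', (ψ e.1 * wt x S e.1) * (θ e.2 * wt x S e.2) with hT
  set Y := (∑ v ∈ V', ψ v * wt x S v) * ∑ w ∈ W', θ w * wt x S w with hY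
  set d := (i - j) + (j - i) with hd
  set u : ℝ := (p:ℝ) ^ d / (cf p i * cf p j) with hu
  have hu0 : 0 < u := by positivity
  have hY0 : 0 ≤ Y := by
    apply mul_nonneg <;> refine sum_nonneg fun v _ => mul_nonneg ?_ (wt_pos hS x v).le
    exacts [hψ v, hθ v]
  have eT : ∑ e ∈ E', (p:ℝ) ^ (j - i) * ψ e.1 * wt x (S.erase p) e.1 *
      ((p:ℝ) ^ (i - j) * θ e.2 * wt x (S.erase p) e.2) = u * T := by
    rw [hT, mul_sum]
    refine sum_congr rfl fun e he => ?_
    obtain ⟨h1, h2, h3⟩ := memE' e he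
    rw [wtS, wtS, h2, h3, hu, hd, pow_add]
    field_simp
  have eY : (∑ v ∈ V', (p:ℝ) ^ (j - i) * ψ v * wt x (S.erase p) v) *
      ∑ v ∈ W', (p:ℝ) ^ (i - j) * θ v * wt x (S.erase p) v = u * Y := by
    have a1 : ∑ v ∈ V', (p:ℝ) ^ (j - i) * ψ v * wt x (S.erase p) v =
        (p:ℝ) ^ (j - i) / cf p i * ∑ v ∈ V', ψ v * wt x S v := by
      rw [mul_sum]
      refine sum_congr rfl fun v hv => ?_
      rw [wtS, (mem_filter.1 hv).2]; field_simp
    have a2 : ∑ v ∈ W', (p:ℝ) ^ (i - j) * θ v * wt x (S.erase p) v =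
        (p:ℝ) ^ (i - j) / cf p j * ∑ v ∈ W', θ v * wt x S v := by
      rw [mul_sum]
      refine sum_congr rfl fun v hv => ?_
      rw [wtS, (mem_filter.1 hv).2]; field_simp
    rw [a1, a2, hu, hd, pow_add, hY]; field_simp
  rw [eT, eY] at key
  have hMn : (M⁻¹) ^ n' ≤ (M⁻¹) ^ n * (if i = j then 1 else M) := by
    by_cases hij : i = j
    · simp [hn', hij]
    · rw [hn', if_neg hij, if_neg hij]
      have hM0 : M ≠ 0 := by linarith
      rcases Nat.eq_zero_or_pos n with rfl | hpos
      · simpa using hM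
      · obtain ⟨m, rfl⟩ : ∃ m, n = m + 1 := ⟨n - 1, by omega⟩
        simp only [Nat.add_sub_cancel]
        rw [pow_succ, mul_assoc, inv_mul_cancel₀ hM0, mul_one]
  have hq : u ^ (-((1 - ε) / 2)) ≤ ((p:ℝ) ^ (-((1 - ε) / 2))) ^ d := by
    rw [← Real.rpow_natCast, ← Real.rpow_mul (by linarith), mul_comm, Real.rpow_mul (by linarith),
      Real.rpow_natCast]
    refine Real.rpow_le_rpow_of_nonpos (by positivity) ?_ (by linarith)
    rw [hu, le_div_iff₀ (by positivity)]
    have : cf p i * cf p j ≤ 1 := mul_le_one₀ (cf_le_one p i) hcj.le (cf_le_one p j)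
    exact mul_le_of_le_one_right (by positivity) this
  have hus : u ^ ((1 + ε) / 2) = u * u ^ (-((1 - ε) / 2)) := by
    conv_rhs => rw [← Real.rpow_one_add' hu0.le (by linarith)]
    congr 1; ring
  rw [Real.mul_rpow hu0.le hY0, hus] at key
  have key2 : T ≤ K * (M⁻¹) ^ n' * R * (u ^ (-((1 - ε) / 2)) * Y ^ ((1 + ε) / 2)) := by
    refine le_of_mul_le_mul_left (key.trans (le_of_eq ?_)) hu0
    ring
  refine key2.trans ?_
  rw [ker_eq]
  have hM0 : 0 < M := by linarith
  calc K * (M⁻¹) ^ n' * R * (u ^ (-((1 - ε) / 2)) * Y ^ ((1 + ε) / 2)) ≤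
      K * ((M⁻¹) ^ n * (if i = j then 1 else M)) * R * (((p:ℝ) ^ (-((1 - ε) / 2))) ^ d * Y ^ ((1 + ε) / 2)) := by
        gcongr
    _ = _ := by ring

end core3

end

section
open Finset

section core4
variable {α : Type*} [DecidableEq α]

lemma step_norm (x : α → ℕ → ℕ) (τ : Finset ℕ) {M R ε K : ℝ} {S : Finset ℕ} (hS : ∀ p ∈ S, p.Prime)
    (hM : 1 ≤ M) (hR : 0 ≤ R) (hK : 0 ≤ K) (hε : 0 < ε) (hε1 : ε < 1) {p : ℕ} (hp : p ∈ S)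
    (ih : Bound x τ M R ε (S.erase p) K)
    (V W : Finset α) (hV : InjS x S V) (hW : InjS x S W) (ψ θ : α → ℝ) (hψ : ∀ v, 0 ≤ ψ v)
    (hθ : ∀ v, 0 ≤ θ v) (E : Finset (α × α)) (hE : E ⊆ V ×ˢ W) (hyp : EdgeHyp x S ψ θ E) (n : ℕ)
    (hn : ∀ e ∈ E, n ≤ #{p ∈ S | p ∈ τ ∧ x e.1 p ≠ x e.2 p}) (L : ℕ)
    (hLV : ∀ v ∈ V, x v p < L) (hLW : ∀ v ∈ W, x v p < L) (a b : ℝ) (ha : 0 < a) (hb : 0 < b) :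
    ∑ e ∈ E, (ψ e.1 * wt x S e.1) * (θ e.2 * wt x S e.2) ≤
      K * (M⁻¹) ^ n * R * (a * b) ^ ((1 + ε) / 2) * ∑ i ∈ range L, ∑ j ∈ range L,
        ker M ((p:ℝ) ^ (-((1 - ε) / 2))) i j *
        (((∑ v ∈ V with x v p = i, ψ v * wt x S v) / a) *
          ((∑ w ∈ W with x w p = j, θ w * wt x S w) / b)) ^ ((1 + ε) / 2) := by
  refine (step x τ hS hM hR hK hε hε1 hp ih V W hV hW ψ θ hψ hθ E hE hyp n hn L hLV hLW).trans
    (le_of_eq ?_)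
  rw [mul_assoc _ ((a * b) ^ _)]
  congr 1
  rw [mul_sum]
  refine sum_congr rfl fun i _ => ?_
  rw [mul_sum]
  refine sum_congr rfl fun j _ => ?_
  have h1 : 0 ≤ ∑ v ∈ V with x v p = i, ψ v * wt x S v :=
    sum_nonneg fun v _ => mul_nonneg (hψ v) (wt_pos hS x v).le
  have h2 : 0 ≤ ∑ v ∈ W with x v p = j, θ v * wt x S v :=
    sum_nonneg fun v _ => mul_nonneg (hθ v) (wt_pos hS x v).le
  rw [mul_left_comm, ← Real.mul_rpow (by positivity) (by positivity)]
  congr 2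
  field_simp

lemma main_induction (x : α → ℕ → ℕ) (τ : Finset ℕ) {M D R ε K0 : ℝ} (p0 : ℕ) (hε : 0 < ε)
    (hε1 : ε < 1) (hD : 1 ≤ D) (hMD : M = D ^ (1 - ε)) (hR1 : 1 ≤ R)
    (hR : ∀ S : Finset ℕ, (∀ p ∈ S, p.Prime) →
      (∏ p ∈ S, (1 + (Bp τ (D ^ 4) p - 1) / p)) ^ 2 ≤ R)
    (hK0 : 1 ≤ K0) (hK : ∀ p : ℕ, p.Prime → M * (1 + 2 * ((p:ℝ) ^ (-((1 - ε) / 2))) /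
      (1 - ((p:ℝ) ^ (-((1 - ε) / 2))))) ≤ K0)
    (hp0 : ∀ p : ℕ, p0 < p → (p:ℝ) ^ (-((1 - ε) / 2)) ≤ 1 / 2)
    (hsum : ∀ S : Finset ℕ, (∀ p ∈ S, p0 < p) →
      ∑ p ∈ S, 3 * M * ((32 * M / ε) ^ (2 / (1 - ε)) / (p:ℝ)) ^ (1 + ε) ≤ 1 / 2) :
    ∀ S : Finset ℕ, (∀ p ∈ S, p.Prime) → Bound x τ M R ε S (8 * K0 ^ #{p ∈ S | p ≤ p0}) := by
  intro S
  induction S using Finset.strongInduction with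
  | H S IH =>
  intro hS V W hV hW ψ θ hψ hθ E hE hyp n hn
  have hM : 1 ≤ M := by rw [hMD]; exact Real.one_le_rpow hD (by linarith)
  have hM0 : 0 < M := by linarith
  have wpos : ∀ v, 0 < wt x S v := fun v => wt_pos hS x v
  set μ := ∑ v ∈ V, ψ v * wt x S v with hμdef
  set ν := ∑ w ∈ W, θ w * wt x S w with hνdef
  have hμ0 : 0 ≤ μ := sum_nonneg fun v _ => mul_nonneg (hψ v) (wpos v).le
  have hν0 : 0 ≤ ν := sum_nonneg fun v _ => mul_nonneg (hθ v) (wpos v).le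
  have hf0 : ∀ e : α × α, 0 ≤ (ψ e.1 * wt x S e.1) * (θ e.2 * wt x S e.2) := fun e => by
    have := hψ e.1; have := hθ e.2; have := wpos e.1; have := wpos e.2; positivity
  have htriv : ∑ e ∈ E, (ψ e.1 * wt x S e.1) * (θ e.2 * wt x S e.2) ≤ μ * ν := by
    rw [sum_mul_sum, ← sum_product']
    exact sum_le_sum_of_subset_of_nonneg hE fun e _ _ => hf0 e
  rcases (mul_nonneg hμ0 hν0).eq_or_lt with hz | hpos
  · rw [← hz] at htriv
    refine htriv.trans ?_
    positivity
  have hμ : 0 < μ := by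
    rcases hμ0.eq_or_lt with h | h
    · rw [← h] at hpos; simp at hpos
    · exact h
  have hν : 0 < ν := by
    rcases hν0.eq_or_lt with h | h
    · rw [← h] at hpos; simp at hpos
    · exact h
  have IH' : ∀ p ∈ S, Bound x τ M R ε (S.erase p) (8 * K0 ^ #{p ∈ S.erase p | p ≤ p0}) :=
    fun p hp => IH _ (erase_ssubset hp) fun r hr => hS r (mem_of_mem_erase hr)
  set L : ℕ → ℕ := fun p => (V ∪ W).sup (fun v => x v p) + 1 with hL
  have hLV : ∀ p, ∀ v ∈ V, x v p < L p := fun p v hv =>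
    Nat.lt_succ_of_le (le_sup (f := fun v => x v p) (mem_union_left _ hv))
  have hLW : ∀ p, ∀ v ∈ W, x v p < L p := fun p v hv =>
    Nat.lt_succ_of_le (le_sup (f := fun v => x v p) (mem_union_right _ hv))
  set a : ℕ → ℕ → ℝ := fun p i => (∑ v ∈ V with x v p = i, ψ v * wt x S v) / μ with ha
  set b : ℕ → ℕ → ℝ := fun p i => (∑ v ∈ W with x v p = i, θ v * wt x S v) / ν with hb
  have ha0 : ∀ p i, 0 ≤ a p i := fun p i =>
    div_nonneg (sum_nonneg fun v _ => mul_nonneg (hψ v) (wpos v).le) hμ0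
  have hb0 : ∀ p i, 0 ≤ b p i := fun p i =>
    div_nonneg (sum_nonneg fun v _ => mul_nonneg (hθ v) (wpos v).le) hν0
  have sa : ∀ p, ∑ i ∈ range (L p), a p i = 1 := fun p => by
    simp only [ha]
    rw [← sum_div, sum_fiberwise_of_maps_to (fun v hv => mem_range.2 (hLV p v hv)), div_self hμ.ne']
  have sb : ∀ p, ∑ i ∈ range (L p), b p i = 1 := fun p => by
    simp only [hb]
    rw [← sum_div, sum_fiberwise_of_maps_to (fun v hv => mem_range.2 (hLW p v hv)), div_self hν.ne']
  have qlt : ∀ p ∈ S, (p:ℝ) ^ (-((1 - ε) / 2)) < 1 := fun p hp =>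
    Real.rpow_lt_one_of_one_lt_of_neg (by exact_mod_cast (hS p hp).one_lt) (by linarith)
  have st : ∀ p (hp : p ∈ S), ∑ e ∈ E, (ψ e.1 * wt x S e.1) * (θ e.2 * wt x S e.2) ≤
      8 * K0 ^ #{p ∈ S.erase p | p ≤ p0} * (M⁻¹) ^ n * R * (μ * ν) ^ ((1 + ε) / 2) *
      ∑ i ∈ range (L p), ∑ j ∈ range (L p),
        ker M ((p:ℝ) ^ (-((1 - ε) / 2))) i j * (a p i * b p j) ^ ((1 + ε) / 2) := fun p hp =>
    step_norm x τ hS hM (by linarith) (by positivity) hε hε1 hp (IH' p hp) V W hV hW ψ θ hψ hθ E hE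
      hyp n hn (L p) (hLV p) (hLW p) μ ν hμ hν
  by_cases c1 : ∃ p ∈ S, p ≤ p0
  · obtain ⟨p, hp, hpp⟩ := c1
    have hcard : #{p ∈ S | p ≤ p0} = #{p ∈ S.erase p | p ≤ p0} + 1 := by
      rw [filter_erase, card_erase_add_one]
      exact mem_filter.2 ⟨hp, hpp⟩
    have hZ := (ker_bound hM (by positivity) (qlt p hp) hε (L p) (a p) (b p) (ha0 p) (hb0 p) 1
      (sa p).le (sb p).le)
    rw [Real.one_rpow, mul_one] at hZ
    have hZ := hZ.trans (hK p (hS p hp))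
    refine (st p hp).trans ?_
    rw [hcard, pow_succ]
    calc _ ≤ 8 * K0 ^ #{p ∈ S.erase p | p ≤ p0} * (M⁻¹) ^ n * R * (μ * ν) ^ ((1 + ε) / 2) * K0 := by
          gcongr
      _ = _ := by ring
  push Not at c1
  have hcard : ∀ p, #{p ∈ S.erase p | p ≤ p0} = 0 := fun p => by
    rw [card_eq_zero, filter_eq_empty_iff]
    intro r hr
    have := c1 r (mem_of_mem_erase hr)
    omega
  have hcard0 : #{p ∈ S | p ≤ p0} = 0 := by
    rw [card_eq_zero, filter_eq_empty_iff]
    intro r hr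
    have := c1 r hr
    omega
  rw [hcard0, pow_zero, mul_one]
  simp only [hcard, pow_zero, mul_one] at st IH'
  by_cases c2 : ∃ p ∈ S, ∑ i ∈ range (L p), ∑ j ∈ range (L p),
        ker M ((p:ℝ) ^ (-((1 - ε) / 2))) i j * (a p i * b p j) ^ ((1 + ε) / 2) ≤ 1
  · obtain ⟨p, hp, hpp⟩ := c2
    refine (st p hp).trans ?_
    exact mul_le_of_le_one_right (by positivity) hpp
  push Not at c2
  have conc : ∀ p, ∃ k, p ∈ S → k ∈ range (L p) ∧ 1 - a p k ≤ (32 * M / ε) ^ (2 / (1 - ε)) / p ∧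
      1 - b p k ≤ (32 * M / ε) ^ (2 / (1 - ε)) / p := by
    intro p
    by_cases hp : p ∈ S
    · obtain ⟨k, h1, h2⟩ := concentration hM (by exact_mod_cast (hS p hp).one_lt) hε hε1
        (hp0 p (c1 p hp)) (L p) (a p) (b p) (ha0 p) (hb0 p) (sa p) (sb p) (c2 p hp)
      exact ⟨k, fun _ => ⟨h1, h2⟩⟩
    · exact ⟨0, fun h => absurd h hp⟩
  choose k hk using conc
  set X := (μ * ν) ^ ((1 + ε) / 2) with hX
  have hX0 : 0 ≤ X := by positivity
  -- bad edges
  have bad : ∀ p ∈ S, ∑ e ∈ E with x e.1 p ≠ k p ∧ x e.2 p ≠ k p,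
      (ψ e.1 * wt x S e.1) * (θ e.2 * wt x S e.2) ≤
      8 * (M⁻¹) ^ n * R * X * (3 * M * ((32 * M / ε) ^ (2 / (1 - ε)) / (p:ℝ)) ^ (1 + ε)) := by
    intro p hp
    obtain ⟨hkL, hka, hkb⟩ := hk p hp
    refine (step_norm x τ hS hM (by linarith) (by norm_num) hε hε1 hp (IH' p hp)
      {v ∈ V | x v p ≠ k p} {v ∈ W | x v p ≠ k p} (hV.mono (filter_subset _ _))
      (hW.mono (filter_subset _ _)) ψ θ hψ hθ {e ∈ E | x e.1 p ≠ k p ∧ x e.2 p ≠ k p} ?_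
      (fun e he => hyp e (mem_filter.1 he).1) n (fun e he => hn e (mem_filter.1 he).1) (L p)
      (fun v hv => hLV p v (mem_filter.1 hv).1) (fun v hv => hLW p v (mem_filter.1 hv).1)
      μ ν hμ hν).trans ?_
    · intro e he
      rw [mem_filter] at he
      have := mem_product.1 (hE he.1)
      exact mem_product.2 ⟨mem_filter.2 ⟨this.1, he.2.1⟩, mem_filter.2 ⟨this.2, he.2.2⟩⟩
    refine mul_le_mul_of_nonneg_left ?_ (by positivity)
    have sums : ∀ (U : Finset α) (f : α → ℝ) (m : ℝ), (∀ v ∈ U, x v p < L p) → 0 < m →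
        m = ∑ v ∈ U, f v →
        ∑ i ∈ range (L p), (∑ v ∈ {v ∈ U | x v p ≠ k p} with x v p = i, f v) / m =
        1 - (∑ v ∈ U with x v p = k p, f v) / m := by
      intro U f m hU hm hmd
      rw [← sum_div, sum_fiberwise_of_maps_to
        (fun v hv => mem_range.2 (hU v (mem_filter.1 hv).1))]
      rw [eq_sub_iff_add_eq, ← add_div, add_comm, sum_filter_add_sum_filter_not, ← hmd,
        div_self hm.ne']
    have kb := ker_bound hM (by positivity) (qlt p hp) hε (L p)
      (fun i => (∑ v ∈ {v ∈ V | x v p ≠ k p} with x v p = i, ψ v * wt x S v) / μ)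
      (fun i => (∑ v ∈ {v ∈ W | x v p ≠ k p} with x v p = i, θ v * wt x S v) / ν)
      (fun i => div_nonneg (sum_nonneg fun v _ => mul_nonneg (hψ v) (wpos v).le) hμ0)
      (fun i => div_nonneg (sum_nonneg fun v _ => mul_nonneg (hθ v) (wpos v).le) hν0)
      ((32 * M / ε) ^ (2 / (1 - ε)) / (p:ℝ))
      (by rw [sums V (fun v => ψ v * wt x S v) μ (hLV p) hμ hμdef]; exact hka)
      (by rw [sums W (fun v => θ v * wt x S v) ν (hLW p) hν hνdef]; exact hkb)
    refine kb.trans ?_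
    have hq := hp0 p (c1 p hp)
    have hq3 : 2 * ((p:ℝ) ^ (-((1 - ε) / 2))) / (1 - ((p:ℝ) ^ (-((1 - ε) / 2)))) ≤ 2 := by
      rw [div_le_iff₀ (by linarith)]; linarith
    have : M * (1 + 2 * ((p:ℝ) ^ (-((1 - ε) / 2))) / (1 - ((p:ℝ) ^ (-((1 - ε) / 2))))) ≤ 3 * M := by
      nlinarith
    exact mul_le_mul_of_nonneg_right this (by positivity)
  have gd := good_bound' hS x k hε hε1 hR1 hD (hR S hS) V W hV hW ψ θ hψ hθ
    {e ∈ E | ∀ p ∈ S, x e.1 p = k p ∨ x e.2 p = k p} ((filter_subset _ _).trans hE)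
    (fun e he => hyp e (mem_filter.1 he).1) (fun e he => (mem_filter.1 he).2) n
    (fun e he => hn e (mem_filter.1 he).1) hμ hν
  rw [← hMD] at gd
  have ngd : ∑ e ∈ E with ¬ ∀ p ∈ S, x e.1 p = k p ∨ x e.2 p = k p,
      (ψ e.1 * wt x S e.1) * (θ e.2 * wt x S e.2) ≤ 8 * (M⁻¹) ^ n * R * X * (1 / 2) := by
    calc _ ≤ ∑ e ∈ E, ∑ p ∈ S, if x e.1 p ≠ k p ∧ x e.2 p ≠ k p then
          (ψ e.1 * wt x S e.1) * (θ e.2 * wt x S e.2) else 0 := by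
          rw [sum_filter]
          refine sum_le_sum fun e _ => ?_
          have nn : ∀ p ∈ S, 0 ≤ if x e.1 p ≠ k p ∧ x e.2 p ≠ k p then
            (ψ e.1 * wt x S e.1) * (θ e.2 * wt x S e.2) else 0 := fun p _ => by
            split_ifs
            · exact hf0 e
            · exact le_rfl
          split_ifs with h
          · exact sum_nonneg nn
          · push Not at h
            obtain ⟨p, hp, h'⟩ := h
            have := single_le_sum nn hp
            rw [if_pos h'] at this
            exact this
      _ = ∑ p ∈ S, ∑ e ∈ E with x e.1 p ≠ k p ∧ x e.2 p ≠ k p,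
          (ψ e.1 * wt x S e.1) * (θ e.2 * wt x S e.2) := by
          rw [sum_comm]
          exact sum_congr rfl fun p _ => (sum_filter _ _).symm
      _ ≤ ∑ p ∈ S, 8 * (M⁻¹) ^ n * R * X *
          (3 * M * ((32 * M / ε) ^ (2 / (1 - ε)) / (p:ℝ)) ^ (1 + ε)) := sum_le_sum bad
      _ ≤ _ := by
          rw [← mul_sum]
          exact mul_le_mul_of_nonneg_left (hsum S c1) (by positivity)
  rw [← sum_filter_add_sum_filter_not E (fun e => ∀ p ∈ S, x e.1 p = k p ∨ x e.2 p = k p)]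
  refine (add_le_add gd ngd).trans (le_of_eq ?_)
  rw [hX]; ring

end core4

end

section
open Finset
lemma mert_prod_dvd (n : ℕ) : (∏ p ∈ Nat.primesLE n, p ^ (n / p)) ∣ n.factorial := by
  apply Finset.prod_dvd_of_isRelPrime
  · intro p hp q hq hpq
    have hp' := (Nat.mem_primesLE.1 hp).2
    have hq' := (Nat.mem_primesLE.1 hq).2
    exact Nat.coprime_iff_isRelPrime.1 (Nat.Coprime.pow _ _ ((Nat.coprime_primes hp' hq').2 hpq))
  · intro p hp
    have hp' := (Nat.mem_primesLE.1 hp).2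
    refine dvd_trans ?_ (Nat.factorial_dvd_factorial (Nat.mul_div_le n p))
    rw [hp'.pow_dvd_iff_le_factorization (Nat.factorial_ne_zero _), Nat.factorization_factorial_mul hp']
    omega

lemma mert_upper (n : ℕ) (hn : 1 ≤ n) :
    ∑ p ∈ Nat.primesLE n, Real.log p / p ≤ Real.log n + Real.log 4 := by
  have hn0 : (0:ℝ) < n := by exact_mod_cast hn
  have h1 : (∏ p ∈ Nat.primesLE n, p ^ (n / p)) ≤ n ^ n :=
    (Nat.le_of_dvd (Nat.factorial_pos n) (mert_prod_dvd n)).trans (Nat.factorial_le_pow n)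
  have h2 : ∑ p ∈ Nat.primesLE n, ((n / p : ℕ) : ℝ) * Real.log p ≤ n * Real.log n := by
    have h3 : Real.log ((∏ p ∈ Nat.primesLE n, p ^ (n / p) : ℕ) : ℝ) ≤ Real.log ((n ^ n : ℕ) : ℝ) := by
      apply Real.log_le_log
      · have : 0 < ∏ p ∈ Nat.primesLE n, p ^ (n / p) :=
          Finset.prod_pos fun p hp => pow_pos (Nat.mem_primesLE.1 hp).2.pos _
        exact_mod_cast this
      · exact_mod_cast h1
    push_cast at h3
    rw [Real.log_prod, Real.log_pow] at h3
    · simpa [Real.log_pow] using h3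
    · intro p hp
      have := (Nat.mem_primesLE.1 hp).2.pos
      positivity
  have h4 := Chebyshev.theta_le_log4_mul_x (x := n) hn0.le
  rw [Chebyshev.theta_eq_sum_primesLE_log] at h4
  have h5 : ∑ p ∈ Nat.primesLE n, (n : ℝ) * (Real.log p / p) ≤
      ∑ p ∈ Nat.primesLE n, (((n / p : ℕ) : ℝ) * Real.log p + Real.log p) := by
    apply Finset.sum_le_sum
    intro p hp
    have hp' := (Nat.mem_primesLE.1 hp).2
    have hp0 : (0:ℝ) < p := by exact_mod_cast hp'.pos
    have hl : 0 ≤ Real.log p := Real.log_natCast_nonneg p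
    have h6 : (n:ℝ) / p ≤ ((n / p : ℕ) : ℝ) + 1 := by
      rw [← Nat.floor_div_eq_div (K := ℝ)]
      exact (Nat.lt_floor_add_one _).le
    calc (n : ℝ) * (Real.log p / p) = (n / p) * Real.log p := by ring
      _ ≤ (((n / p : ℕ) : ℝ) + 1) * Real.log p := by gcongr
      _ = _ := by ring
  rw [← Finset.mul_sum, Finset.sum_add_distrib] at h5
  have : (n:ℝ) * ∑ p ∈ Nat.primesLE n, Real.log p / p ≤ n * (Real.log n + Real.log 4) := by linarith
  exact le_of_mul_le_mul_left this hn0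

lemma prime_sum_small (η : ℝ) (hη : 0 < η) : ∃ c : ℝ, 0 ≤ c ∧ ∀ t : ℝ, 1 ≤ t →
    ∑ p ∈ Nat.primesLE ⌊t⌋₊, 1 / (p : ℝ) ≤ η * Real.log t + c := by
  set P := ⌈Real.exp (1/η)⌉₊ with hP
  have hl4 : 0 ≤ Real.log 4 := Real.log_nonneg (by norm_num)
  refine ⟨η * Real.log 4 + (P + 1), by positivity, fun t ht => ?_⟩
  set n := ⌊t⌋₊
  have hn : 1 ≤ n := Nat.le_floor (by simpa using ht)
  have hnt : (n:ℝ) ≤ t := Nat.floor_le (by linarith)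
  have hm := mert_upper n hn
  have hlog : Real.log n ≤ Real.log t := Real.log_le_log (by exact_mod_cast hn) hnt
  have h1 : ∑ p ∈ Nat.primesLE n, 1 / (p : ℝ) ≤
      ∑ p ∈ Nat.primesLE n, (η * (Real.log p / p) + if p ≤ P then 1 else 0) := by
    apply Finset.sum_le_sum
    intro p hp
    have hp' := (Nat.mem_primesLE.1 hp).2
    have hp1 : (1:ℝ) ≤ p := by exact_mod_cast hp'.pos
    have hl : 0 ≤ Real.log p := Real.log_natCast_nonneg p
    split_ifs with h
    · have : 1 / (p:ℝ) ≤ 1 := by rw [div_le_one (by linarith)]; exact hp1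
      have : 0 ≤ η * (Real.log p / p) := by positivity
      linarith
    · have hle : Real.exp (1/η) ≤ p := (Nat.le_ceil _).trans (by exact_mod_cast (not_le.1 h).le)
      have h2 : 1/η ≤ Real.log p := by
        rw [Real.le_log_iff_exp_le (by linarith)]; exact hle
      rw [div_le_iff₀ hη] at h2
      rw [add_zero, ← mul_div_assoc]
      gcongr
      linarith
  rw [Finset.sum_add_distrib, ← Finset.mul_sum, Finset.sum_ite, Finset.sum_const_zero, add_zero,
    Finset.sum_const, nsmul_eq_mul, mul_one] at h1
  have h3 : #{p ∈ Nat.primesLE n | p ≤ P} ≤ P + 1 := by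
    calc _ ≤ #(Finset.range (P+1)) := Finset.card_le_card (by
          intro p hp; rw [Finset.mem_filter] at hp; rw [Finset.mem_range]; omega)
      _ = _ := by simp
  have h3' : (#{p ∈ Nat.primesLE n | p ≤ P} : ℝ) ≤ P + 1 := by exact_mod_cast h3
  have := mul_le_mul_of_nonneg_left hm hη.le
  have := mul_le_mul_of_nonneg_left hlog hη.le
  linarith

lemma R_bound (B : ℝ) (hB : 1 ≤ B) : ∃ c : ℝ, 0 ≤ c ∧ ∀ t : ℝ, 1 ≤ t →
    ∀ S : Finset ℕ, (∀ p ∈ S, p.Prime) →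
      (∏ p ∈ S, (1 + (Bp (Nat.primesLE ⌊t⌋₊) B p - 1)/(p:ℝ)))^2 ≤ t * Real.exp c := by
  obtain ⟨c, hc, h⟩ := prime_sum_small (1/(2*B)) (by positivity)
  refine ⟨2*B*c, by positivity, fun t ht S hS => ?_⟩
  set τ := Nat.primesLE ⌊t⌋₊
  have h0 : ∀ p ∈ S, 0 ≤ 1 + (Bp τ B p - 1)/(p:ℝ) := by
    intro p hp
    have : 0 ≤ Bp τ B p - 1 := by unfold Bp; split_ifs <;> linarith
    positivity
  have h1 : ∏ p ∈ S, (1 + (Bp τ B p - 1)/(p:ℝ)) ≤ Real.exp (B * ∑ p ∈ τ, 1/(p:ℝ)) := by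
    calc ∏ p ∈ S, (1 + (Bp τ B p - 1)/(p:ℝ)) ≤ ∏ p ∈ S, Real.exp (if p ∈ τ then B * (1/p) else 0) := by
          apply Finset.prod_le_prod h0
          intro p hp
          unfold Bp
          split_ifs with hh
          · have := Real.add_one_le_exp (B * (1/(p:ℝ)))
            refine le_trans ?_ this
            have : (B-1)/(p:ℝ) ≤ B * (1/p) := by
              rw [mul_one_div]; gcongr; linarith
            linarith
          · simp
      _ = Real.exp (∑ p ∈ S, if p ∈ τ then B * (1/(p:ℝ)) else 0) := by rw [Real.exp_sum]
      _ ≤ _ := by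
          rw [Real.exp_le_exp, Finset.sum_ite, Finset.sum_const_zero, add_zero, Finset.mul_sum]
          apply Finset.sum_le_sum_of_subset_of_nonneg
          · intro p hp; exact (Finset.mem_filter.1 hp).2
          · intros; positivity
  calc _ ≤ (Real.exp (B * ∑ p ∈ τ, 1/(p:ℝ)))^2 := by
        gcongr
        exact Finset.prod_nonneg h0
    _ = Real.exp (2 * B * ∑ p ∈ τ, 1/(p:ℝ)) := by rw [← Real.exp_nat_mul]; push_cast; ring_nf
    _ ≤ Real.exp (Real.log t + 2*B*c) := by
        rw [Real.exp_le_exp]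
        have := mul_le_mul_of_nonneg_left (h t ht) (show 0 ≤ 2*B by positivity)
        calc _ ≤ _ := this
          _ = _ := by field_simp
    _ = _ := by rw [Real.exp_add, Real.exp_log (by linarith)]

lemma consts (ε : ℝ) (hε : 0 < ε) (hε1 : ε < 1) (M : ℝ) (hM : 1 ≤ M) : ∃ p0 : ℕ, ∃ K0 : ℝ, 1 ≤ K0 ∧
    (∀ p : ℕ, p.Prime → M*(1 + 2*((p:ℝ)^(-((1-ε)/2)))/(1-((p:ℝ)^(-((1-ε)/2))))) ≤ K0) ∧
    (∀ p : ℕ, p0 < p → (p:ℝ)^(-((1-ε)/2)) ≤ 1/2) ∧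
    (∀ S : Finset ℕ, (∀ p ∈ S, p0 < p) →
      ∑ p ∈ S, 3*M*((32*M/ε)^(2/(1-ε))/(p:ℝ))^(1+ε) ≤ 1/2) := by
  have ha : 0 < (1-ε)/2 := by linarith
  set a := (1-ε)/2
  have hs : Summable (fun p : ℕ => 3*M*((32*M/ε)^(2/(1-ε))/(p:ℝ))^(1+ε)) := by
    apply Summable.mul_left
    have : (fun p : ℕ => ((32*M/ε)^(2/(1-ε))/(p:ℝ))^(1+ε)) =
        fun p : ℕ => ((32*M/ε)^(2/(1-ε)))^(1+ε) * (1/(p:ℝ)^(1+ε)) := by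
      ext p
      rw [Real.div_rpow (by positivity) (by positivity), mul_one_div]
    rw [this]
    exact (Real.summable_one_div_nat_rpow.2 (by linarith)).mul_left _
  obtain ⟨s, hs⟩ := summable_iff_vanishing_norm.1 hs (1/2) (by norm_num)
  have ht : Filter.Tendsto (fun p : ℕ => (p:ℝ)^(-a)) Filter.atTop (nhds 0) :=
    (tendsto_rpow_neg_atTop ha).comp tendsto_natCast_atTop_atTop
  obtain ⟨N, hN⟩ := Filter.eventually_atTop.1 (ht.eventually (ge_mem_nhds (show (0:ℝ) < 1/2 by norm_num)))
  set q0 : ℝ := (2:ℝ)^(-a)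
  have hq0 : q0 < 1 := Real.rpow_lt_one_of_one_lt_of_neg (by norm_num) (by linarith)
  refine ⟨max N (s.sup id), max 1 (M*(1+2*q0/(1-q0))), le_max_left _ _, ?_, ?_, ?_⟩
  · intro p hp
    refine le_trans ?_ (le_max_right _ _)
    have h2 : (2:ℝ) ≤ p := by exact_mod_cast hp.two_le
    have hq : (p:ℝ)^(-a) ≤ q0 := Real.rpow_le_rpow_of_nonpos (by norm_num) h2 (by linarith)
    have : 0 ≤ (p:ℝ)^(-a) := by positivity
    have : 0 < 1 - q0 := by linarith
    gcongr
  · intro p hp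
    exact hN p ((le_max_left _ _).trans hp.le)
  · intro S hS
    have hd : Disjoint S s := by
      rw [Finset.disjoint_left]
      intro p hp hps
      have h1 := hS p hp
      have : p ≤ s.sup id := Finset.le_sup (f := id) hps
      omega
    exact (le_abs_self _).trans (hs S hd).le

end

section
open Finset
def fx (v p : ℕ) : ℕ := v.factorization p

lemma wt_totient (Q v : ℕ) (hv : v ∈ Finset.Icc 1 Q) :
    wt fx (Nat.primesLE Q) v = (Nat.totient v : ℝ) / v := by
  rw [Finset.mem_Icc] at hv
  have hv0 : (v:ℝ) ≠ 0 := by exact_mod_cast (by omega : v ≠ 0)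
  have h1 : (Nat.totient v : ℝ) = v * ∏ p ∈ v.primeFactors, (1 - (p:ℝ)⁻¹) := by
    have := Nat.totient_eq_mul_prod_factors v
    have h2 : ((v.totient : ℚ) : ℝ) = ((v * ∏ p ∈ v.primeFactors, (1 - (p:ℚ)⁻¹) : ℚ) : ℝ) := by rw [this]
    push_cast at h2
    exact h2
  rw [h1, mul_div_cancel_left₀ _ hv0]
  unfold wt
  symm
  calc ∏ p ∈ v.primeFactors, (1 - (p:ℝ)⁻¹) = ∏ p ∈ v.primeFactors, cf p (fx v p) := by
        apply Finset.prod_congr rfl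
        intro p hp
        have : fx v p ≠ 0 := by
          unfold fx
          rw [← Finsupp.mem_support_iff, Nat.support_factorization]; exact hp
        unfold cf
        rw [if_neg this, one_div]
    _ = _ := by
        apply Finset.prod_subset
        · intro p hp
          rw [Nat.mem_primesLE]
          exact ⟨(Nat.le_of_mem_primeFactors hp).trans hv.2, Nat.prime_of_mem_primeFactors hp⟩
        · intro p _ hp
          have : fx v p = 0 := by
            unfold fx
            rw [← Finsupp.notMem_support_iff, Nat.support_factorization]; exact hp
          unfold cf
          rw [if_pos this]

lemma ratio_eq (Q q r : ℕ) (hq : q ∈ Finset.Icc 1 Q) (hr : r ∈ Finset.Icc 1 Q) :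
    ∏ p ∈ Nat.primesLE Q, (p:ℝ)^(fx r p - fx q p) = (r : ℝ) / (Nat.gcd q r : ℝ) := by
  rw [Finset.mem_Icc] at hq hr
  have hq0 : q ≠ 0 := by omega
  have hr0 : r ≠ 0 := by omega
  have hg : Nat.gcd q r ≠ 0 := Nat.gcd_ne_zero_left hq0
  have hd : Nat.gcd q r ∣ r := Nat.gcd_dvd_right q r
  rw [← Nat.cast_div hd (by exact_mod_cast hg)]
  have key : ∏ p ∈ Nat.primesLE Q, p^(fx r p - fx q p) = r / Nat.gcd q r := by
    have hS : ∀ p ∈ Nat.primesLE Q, p.Prime := fun p hp => (Nat.mem_primesLE.1 hp).2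
    have hrg : r / Nat.gcd q r ≠ 0 := (Nat.div_pos (Nat.le_of_dvd (by omega) hd) (by omega)).ne'
    have hp0 : ∏ p ∈ Nat.primesLE Q, p^(fx r p - fx q p) ≠ 0 :=
      Finset.prod_ne_zero_iff.2 fun p hp => pow_ne_zero _ (hS p hp).ne_zero
    have hfac : ∀ p, (r / Nat.gcd q r).factorization p = fx r p - fx q p := by
      intro p
      rw [Nat.factorization_div hd, Nat.factorization_gcd hq0 hr0]
      simp only [Finsupp.tsub_apply, Finsupp.inf_apply, fx]
      omega
    apply Nat.eq_of_factorization_eq hp0 hrg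
    intro p
    rw [hfac]
    by_cases hp : p ∈ Nat.primesLE Q
    · exact fact_prod _ hS _ hp
    · have h1 : (∏ p ∈ Nat.primesLE Q, p^(fx r p - fx q p)).factorization p = 0 := by
        rw [Nat.factorization_prod (fun p hp => pow_ne_zero _ (hS p hp).ne_zero)]
        rw [Finsupp.finset_sum_apply]
        apply Finset.sum_eq_zero
        intro s hs
        rw [(hS s hs).factorization_pow, Finsupp.single_apply, if_neg]
        rintro rfl; exact hp hs
      rw [h1]
      have h2 : fx r p = 0 := by
        unfold fx
        rw [Nat.mem_primesLE, not_and_or] at hp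
        rcases hp with hp | hp
        · exact Nat.factorization_eq_zero_of_lt (by omega)
        · exact Nat.factorization_eq_zero_of_not_prime _ hp
      omega
  rw [← key]
  push_cast
  rfl

lemma omega_le_s7 (Q q r : ℕ) (t : ℝ) (ht : 1 ≤ t) (hq : q ∈ Finset.Icc 1 Q) (hr : r ∈ Finset.Icc 1 Q) :
    omegaFun t q r ≤ #{p ∈ Nat.primesLE Q | p ∈ Nat.primesLE ⌊t⌋₊ ∧ fx q p ≠ fx r p} := by
  rw [Finset.mem_Icc] at hq hr
  have hq0 : q ≠ 0 := by omega
  have hr0 : r ≠ 0 := by omega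
  unfold omegaFun
  apply Finset.card_le_card
  intro p hp
  rw [Finset.mem_filter] at hp
  obtain ⟨hp, hpt⟩ := hp
  have hpp := Nat.prime_of_mem_primeFactors hp
  have hd : Nat.gcd q r ^ 2 ∣ q * r := by
    rw [sq]; exact mul_dvd_mul (Nat.gcd_dvd_left q r) (Nat.gcd_dvd_right q r)
  have hf : (q * r / Nat.gcd q r ^ 2).factorization p = fx q p + fx r p - 2 * min (fx q p) (fx r p) := by
    rw [Nat.factorization_div hd, Nat.factorization_mul hq0 hr0, Nat.factorization_pow, Nat.factorization_gcd hq0 hr0]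
    simp [fx]
  have hne : (q * r / Nat.gcd q r ^ 2).factorization p ≠ 0 := by
    rw [← Finsupp.mem_support_iff, Nat.support_factorization]; exact hp
  rw [hf] at hne
  have hle : p ≤ Q := by
    by_contra h
    have h1 : fx q p = 0 := Nat.factorization_eq_zero_of_lt (by omega)
    have h2 : fx r p = 0 := Nat.factorization_eq_zero_of_lt (by omega)
    omega
  rw [Finset.mem_filter, Nat.mem_primesLE, Nat.mem_primesLE]
  refine ⟨⟨hle, hpp⟩, ⟨Nat.le_floor hpt, hpp⟩, by omega⟩

lemma inj_fx (Q : ℕ) : InjS fx (Nat.primesLE Q) (Finset.Icc 1 Q) := by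
  intro v hv v' hv' h
  rw [Finset.mem_Icc] at hv hv'
  apply Nat.eq_of_factorization_eq (by omega) (by omega)
  intro p
  by_cases hp : p ∈ Nat.primesLE Q
  · exact h p hp
  · rw [Nat.mem_primesLE, not_and_or] at hp
    rcases hp with hp | hp
    · rw [Nat.factorization_eq_zero_of_lt (by omega), Nat.factorization_eq_zero_of_lt (by omega)]
    · rw [Nat.factorization_eq_zero_of_not_prime _ hp, Nat.factorization_eq_zero_of_not_prime _ hp]

lemma final_aux (ε κ C : ℝ) (hε : ε ∈ Set.Ioo (0 : ℝ) 1) (hκ : 0 < κ)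
    (hC : 1 ≤ C) :
    ∃ K : ℝ, 0 < K ∧ ∀ ψ : ℕ → ℝ, (∀ q, 0 ≤ ψ q) → ∀ Q : ℕ, 1 ≤ Q →
      ∀ y t : ℝ, 1 ≤ y → 1 ≤ t →
        (∑ q ∈ Finset.Icc 1 Q, ∑ r ∈ Finset.Icc 1 Q,
            if Dfun ψ q r ≤ y ∧ κ * Real.log t ≤ (omegaFun t q r : ℝ) then
              ψ q * (Nat.totient q : ℝ) / q * (ψ r * (Nat.totient r : ℝ) / r)
            else 0)
          ≤ K * t ^ (-C) * y ^ (1 - ε) * Psi ψ Q ^ (1 + ε) := by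
  classical
  obtain ⟨hε0, hε1⟩ := hε
  set M := Real.exp ((C+1)/κ) with hMdef
  have hM : 1 ≤ M := Real.one_le_exp (by positivity)
  set D := M ^ (1/(1-ε)) with hDdef
  have h1ε : 0 < 1 - ε := by linarith
  have hD : 1 ≤ D := Real.one_le_rpow hM (by positivity)
  have hMD : M = D^(1-ε) := by
    rw [hDdef, ← Real.rpow_mul (by linarith), one_div_mul_cancel h1ε.ne', Real.rpow_one]
  obtain ⟨c, hc, hR⟩ := R_bound (D^4) (one_le_pow₀ hD)
  obtain ⟨p0, K0, hK0, hK, hp0, hsum⟩ := consts ε hε0 hε1 M hM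
  refine ⟨8 * K0^(p0+1) * Real.exp c, by positivity, fun ψ hψ Q hQ y t hy ht => ?_⟩
  have ht0 : 0 < t := by linarith
  have hy0 : 0 < y := by linarith
  set S := Nat.primesLE Q with hSdef
  have hS : ∀ p ∈ S, p.Prime := fun p hp => (Nat.mem_primesLE.1 hp).2
  set V := Finset.Icc 1 Q with hV
  have hRt : 1 ≤ t * Real.exp c := one_le_mul_of_one_le_of_one_le ht (Real.one_le_exp hc)
  have B := main_induction fx (Nat.primesLE ⌊t⌋₊) (M := M) (D := D) (R := t * Real.exp c) (ε := ε) (K0 := K0)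
    p0 hε0 hε1 hD hMD hRt (hR t ht) hK0 hK hp0 hsum S hS
  set E := (V ×ˢ V).filter (fun e => Dfun ψ e.1 e.2 ≤ y ∧ κ * Real.log t ≤ (omegaFun t e.1 e.2 : ℝ)) with hE
  set n := ⌈κ * Real.log t⌉₊ with hn
  have hφ : ∀ v, 0 ≤ ψ v / y := fun v => div_nonneg (hψ v) hy0.le
  have B1 := B V V (inj_fx Q) (inj_fx Q) (fun v => ψ v / y) (fun v => ψ v / y) hφ hφ E
    (Finset.filter_subset _ _) (by
      intro e he
      rw [hE, Finset.mem_filter, Finset.mem_product] at he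
      obtain ⟨⟨h1, h2⟩, h3, -⟩ := he
      rw [ratio_eq Q e.1 e.2 h1 h2, ratio_eq Q e.2 e.1 h2 h1, Nat.gcd_comm e.2 e.1]
      have hg : (0:ℝ) < (Nat.gcd e.1 e.2 : ℝ) := by
        rw [hV, Finset.mem_Icc] at h1
        exact_mod_cast Nat.gcd_pos_of_pos_left _ (by omega)
      unfold Dfun at h3
      rw [div_le_iff₀ hg, max_le_iff] at h3
      constructor
      · rw [div_mul_div_comm, div_le_one (by positivity)]
        linarith [h3.1]
      · rw [div_mul_div_comm, div_le_one (by positivity)]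
        linarith [h3.2]) n (by
      intro e he
      rw [hE, Finset.mem_filter, Finset.mem_product] at he
      obtain ⟨⟨h1, h2⟩, -, h3⟩ := he
      refine le_trans ?_ (omega_le_s7 Q e.1 e.2 t ht h1 h2)
      exact Nat.ceil_le.2 h3)
  have hX : ∑ v ∈ V, ψ v / y * wt fx S v = Psi ψ Q / (2*y) := by
    unfold Psi
    rw [mul_div_mul_left _ _ two_ne_zero, Finset.sum_div]
    apply Finset.sum_congr rfl
    intro v hv
    rw [wt_totient Q v hv]; ring
  have hL : ∑ e ∈ E, (ψ e.1 / y * wt fx S e.1) * (ψ e.2 / y * wt fx S e.2) =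
      (∑ q ∈ V, ∑ r ∈ V,
            if Dfun ψ q r ≤ y ∧ κ * Real.log t ≤ (omegaFun t q r : ℝ) then
              ψ q * (Nat.totient q : ℝ) / q * (ψ r * (Nat.totient r : ℝ) / r)
            else 0) / y^2 := by
    rw [← Finset.sum_product', ← Finset.sum_filter, Finset.sum_div]
    apply Finset.sum_congr rfl
    intro e he
    rw [hE, Finset.mem_filter, Finset.mem_product] at he
    rw [wt_totient Q _ he.1.1, wt_totient Q _ he.1.2]
    field_simp
  have hPsi : 0 ≤ Psi ψ Q := by
    unfold Psi
    have : ∀ q ∈ Finset.Icc 1 Q, 0 ≤ (Nat.totient q : ℝ) * ψ q / q := fun q _ => by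
      have := hψ q; positivity
    have := Finset.sum_nonneg this
    linarith
  have hXX : (Psi ψ Q / (2*y) * (Psi ψ Q / (2*y)))^((1+ε)/2) ≤ Psi ψ Q ^ (1+ε) / y^(1+ε) := by
    rw [← sq, ← Real.rpow_natCast, ← Real.rpow_mul (by positivity)]
    rw [show ((2:ℕ):ℝ) * ((1+ε)/2) = 1+ε by push_cast; ring, ← Real.div_rpow hPsi hy0.le]
    apply Real.rpow_le_rpow (by positivity) _ (by linarith)
    gcongr
    linarith
  have hMn : (M⁻¹)^n ≤ t^(-(C+1)) := by
    rw [Real.rpow_def_of_pos ht0, hMdef, ← Real.exp_neg, ← Real.exp_nat_mul, Real.exp_le_exp]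
    have h1 : κ * Real.log t ≤ n := Nat.le_ceil _
    have h2 : (C+1)/κ * (κ * Real.log t) ≤ (C+1)/κ * n := mul_le_mul_of_nonneg_left h1 (by positivity)
    have h3 : (C+1)/κ * (κ * Real.log t) = (C+1) * Real.log t := by field_simp
    linarith
  have hcard : K0 ^ #{p ∈ S | p ≤ p0} ≤ K0^(p0+1) := by
    apply pow_le_pow_right₀ hK0
    calc _ ≤ #(Finset.range (p0+1)) := Finset.card_le_card (by
          intro p hp; rw [Finset.mem_filter] at hp; rw [Finset.mem_range]; omega)
      _ = _ := by simp
  rw [hX, hL, div_le_iff₀ (by positivity)] at B1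
  refine B1.trans ?_
  have hM0 : 0 ≤ (M⁻¹)^n := by positivity
  calc 8 * K0 ^ #{p ∈ S | p ≤ p0} * (M⁻¹)^n * (t * Real.exp c) * (Psi ψ Q / (2*y) * (Psi ψ Q / (2*y)))^((1+ε)/2) * y^2
      ≤ 8 * K0 ^ (p0+1) * t^(-(C+1)) * (t * Real.exp c) * (Psi ψ Q ^ (1+ε) / y^(1+ε)) * y^2 := by
        gcongr
    _ = 8 * K0 ^ (p0+1) * Real.exp c * (t^(-(C+1)) * t) * (y^2 / y^(1+ε)) * Psi ψ Q ^ (1+ε) := by ring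
    _ = _ := by
        have e1 : t^(-(C+1)) * t = t^(-C) := by
          rw [← Real.rpow_add_one ht0.ne']; congr 1; ring
        have e2 : y^2 / y^(1+ε) = y^(1-ε) := by
          rw [← Real.rpow_natCast, ← Real.rpow_sub hy0]; congr 1; push_cast; ring
        rw [e1, e2]
end

/-- Third bilinear estimate: for fixed `ε ∈ (0,1)`, `κ > 0` and `C ≥ 1`, uniformly in
`ψ ≥ 0`, `Q ≥ 1` and `y, t ≥ 1`,
`∑∑_{(q,r) ∈ [1,Q]², D(q,r) ≤ y, ω_t(q,r) ≥ κ log t} (ψ(q)φ(q)/q)(ψ(r)φ(r)/r)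
  ≪_{ε,κ,C} t^{-C} y^{1-ε} Ψ(Q)^{1+ε}`. -/
theorem bilinear_estimate_three (ε κ C : ℝ) (hε : ε ∈ Set.Ioo (0 : ℝ) 1) (hκ : 0 < κ)
    (hC : 1 ≤ C) :
    ∃ K : ℝ, 0 < K ∧ ∀ ψ : ℕ → ℝ, (∀ q, 0 ≤ ψ q) → ∀ Q : ℕ, 1 ≤ Q →
      ∀ y t : ℝ, 1 ≤ y → 1 ≤ t →
        (∑ q ∈ Finset.Icc 1 Q, ∑ r ∈ Finset.Icc 1 Q,
            if Dfun ψ q r ≤ y ∧ κ * Real.log t ≤ (omegaFun t q r : ℝ) then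
              ψ q * (Nat.totient q : ℝ) / q * (ψ r * (Nat.totient r : ℝ) / r)
            else 0)
          ≤ K * t ^ (-C) * y ^ (1 - ε) * Psi ψ Q ^ (1 + ε) := by
  exact final_aux ε κ C hε hκ hC
end
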